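/- Let Ω ⊆ ℝ^d be a domain, let Pu = −∑_{i,j=1}^d a_ij(x)∂_i∂_j u + ∑_{i=1}^d b_i(x)∂_i u + c(x)u have locally Hölder continuous real coefficients with (a_ij(x)) symmetric positive definite at every x ∈ Ω, and let W, V be locally Hölder continuous real functions on Ω. For μ ∈ ℝ define λ₀(μ) := sup{λ ∈ ℝ : there exists u ∈ C²(Ω) with u > 0 on Ω and (P − μW − λV)u = 0 in Ω}. Then λ₀ is concave where it is finite: for all μ₀, μ₁ ∈ ℝ and s ∈ [0,1], if λ₀(μ₀), λ₀(μ₁) and λ₀(sμ₁ + (1−s)μ₀) are finite real numbers, then λ₀(sμ₁ + (1−s)μ₀) ≥ s·λ₀(μ₁) + (1−s)·λ₀(μ₀). -/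

import Mathlib

open MeasureTheory
open scoped NNReal

noncomputable section

/-- The first partial derivative ∂ᵢu(x). -/
def pd1 {d : ℕ} (u : (Fin d → ℝ) → ℝ) (i : Fin d) (x : Fin d → ℝ) : ℝ :=
  fderiv ℝ u x (Pi.single i 1)

/-- The second partial derivative ∂ᵢ∂ⱼu(x). -/
def pd2 {d : ℕ} (u : (Fin d → ℝ) → ℝ) (i j : Fin d) (x : Fin d → ℝ) : ℝ :=
  fderiv ℝ (fun y => fderiv ℝ u y (Pi.single j 1)) x (Pi.single i 1)

/-- `f` is locally Hölder continuous on Ω. -/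
def LocallyHolderOn {d : ℕ} (f : (Fin d → ℝ) → ℝ) (Ω : Set (Fin d → ℝ)) : Prop :=
  ∀ x ∈ Ω, ∃ α C : ℝ≥0, 0 < α ∧ α ≤ 1 ∧ ∃ s ∈ nhdsWithin x Ω, HolderOnWith C α f s

/-- The second-order elliptic operator
`Pu = -∑ᵢⱼ aᵢⱼ ∂ᵢ∂ⱼu + ∑ᵢ bᵢ ∂ᵢu + c u`. -/
def ellOp {d : ℕ} (a : Fin d → Fin d → (Fin d → ℝ) → ℝ) (b : Fin d → (Fin d → ℝ) → ℝ)
    (c : (Fin d → ℝ) → ℝ) (u : (Fin d → ℝ) → ℝ) (x : Fin d → ℝ) : ℝ :=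
  -(∑ i, ∑ j, a i j x * pd2 u i j x) + (∑ i, b i x * pd1 u i x) + c x * u x

/-- The set of `λ ∈ ℝ` for which `(P - μW - λV)u = 0` admits a positive C² solution in Ω. -/
def posSpec {d : ℕ} (Ω : Set (Fin d → ℝ)) (a : Fin d → Fin d → (Fin d → ℝ) → ℝ)
    (b : Fin d → (Fin d → ℝ) → ℝ) (c W V : (Fin d → ℝ) → ℝ) (μ : ℝ) : Set ℝ :=
  {l : ℝ | ∃ u : (Fin d → ℝ) → ℝ, ContDiffOn ℝ 2 u Ω ∧ (∀ x ∈ Ω, 0 < u x) ∧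
    ∀ x ∈ Ω, ellOp a b c u x = (μ * W x + l * V x) * u x}

section
open MeasureTheory Set Filter Topology
open scoped SchwartzMap ContDiff


abbrev EE (d : ℕ) := Fin d → ℝ
abbrev E1 (d : ℕ) := EE d →L[ℝ] ℝ
abbrev E2 (d : ℕ) := EE d →L[ℝ] EE d →L[ℝ] ℝ

namespace SI
section
variable (d : ℕ)
scoped instance si_e0 : NormedAddCommGroup (EE d) := inferInstance
scoped instance si_e1 : SeminormedAddCommGroup (EE d) := inferInstance
scoped instance si_e2 : SeminormedAddGroup (EE d) := inferInstance
scoped instance si_e3 : AddCommGroup (EE d) := inferInstance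
scoped instance si_e4 : AddGroup (EE d) := inferInstance
scoped instance si_e5 : AddCommMonoid (EE d) := inferInstance
scoped instance si_e6 : AddMonoid (EE d) := inferInstance
scoped instance si_e7 : AddZeroClass (EE d) := inferInstance
scoped instance si_e8 : NormedSpace ℝ (EE d) := inferInstance
scoped instance si_e9 : Module ℝ (EE d) := inferInstance
scoped instance si_e10 : MulAction ℝ (EE d) := inferInstance
scoped instance si_e11 : SMulZeroClass ℝ (EE d) := inferInstance
scoped instance si_e12 : DistribSMul ℝ (EE d) := inferInstance
scoped instance si_e13 : SMul ℝ (EE d) := inferInstance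
scoped instance si_e14 : Norm (EE d) := inferInstance
scoped instance si_e15 : Zero (EE d) := inferInstance
scoped instance si_e16 : Add (EE d) := inferInstance
scoped instance si_p0 : NormedAddCommGroup (E1 d) := inferInstance
scoped instance si_p1 : SeminormedAddCommGroup (E1 d) := inferInstance
scoped instance si_p2 : SeminormedAddGroup (E1 d) := inferInstance
scoped instance si_p3 : AddCommGroup (E1 d) := inferInstance
scoped instance si_p4 : AddGroup (E1 d) := inferInstance
scoped instance si_p5 : AddCommMonoid (E1 d) := inferInstance
scoped instance si_p6 : AddMonoid (E1 d) := inferInstance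
scoped instance si_p7 : AddZeroClass (E1 d) := inferInstance
scoped instance si_p8 : NormedSpace ℝ (E1 d) := inferInstance
scoped instance si_p9 : Module ℝ (E1 d) := inferInstance
scoped instance si_p10 : MulAction ℝ (E1 d) := inferInstance
scoped instance si_p11 : SMulZeroClass ℝ (E1 d) := inferInstance
scoped instance si_p12 : DistribSMul ℝ (E1 d) := inferInstance
scoped instance si_p13 : SMul ℝ (E1 d) := inferInstance
scoped instance si_p14 : Norm (E1 d) := inferInstance
scoped instance si_p15 : Zero (E1 d) := inferInstance
scoped instance si_p16 : Add (E1 d) := inferInstance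
scoped instance si_q0 : NormedAddCommGroup (E2 d) := inferInstance
scoped instance si_q1 : SeminormedAddCommGroup (E2 d) := inferInstance
scoped instance si_q2 : SeminormedAddGroup (E2 d) := inferInstance
scoped instance si_q3 : AddCommGroup (E2 d) := inferInstance
scoped instance si_q4 : AddGroup (E2 d) := inferInstance
scoped instance si_q5 : AddCommMonoid (E2 d) := inferInstance
scoped instance si_q6 : AddMonoid (E2 d) := inferInstance
scoped instance si_q7 : AddZeroClass (E2 d) := inferInstance
scoped instance si_q8 : NormedSpace ℝ (E2 d) := inferInstance
scoped instance si_q9 : Module ℝ (E2 d) := inferInstance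
scoped instance si_q10 : MulAction ℝ (E2 d) := inferInstance
scoped instance si_q11 : SMulZeroClass ℝ (E2 d) := inferInstance
scoped instance si_q12 : DistribSMul ℝ (E2 d) := inferInstance
scoped instance si_q13 : SMul ℝ (E2 d) := inferInstance
scoped instance si_q14 : Norm (E2 d) := inferInstance
scoped instance si_q15 : Zero (E2 d) := inferInstance
scoped instance si_q16 : Add (E2 d) := inferInstance
end
end SI
open scoped SI

variable {d : ℕ} {F : Type} [NormedAddCommGroup F] [NormedSpace ℝ F]

/-- Euclidean bilinear form -/
def ell : E2 d := ∑ i, (ContinuousLinearMap.proj (R := ℝ) (φ := fun _ : Fin d => ℝ) i).smulRight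
  (ContinuousLinearMap.proj (R := ℝ) (φ := fun _ : Fin d => ℝ) i)

lemma ell_apply (x y : EE d) : ell x y = ∑ i, x i * y i := by
  simp [ell]

lemma ell_comm (x y : EE d) : ell x y = ell y x := by simp [ell_apply, mul_comm]

lemma sq_le_ell (x : EE d) : ‖x‖ ^ 2 ≤ ell x x := by
  have h0 : 0 ≤ ell x x := by
    rw [ell_apply]; exact Finset.sum_nonneg fun i _ => mul_self_nonneg _
  have : ‖x‖ ≤ √(ell x x) := by
    refine (pi_norm_le_iff_of_nonneg (Real.sqrt_nonneg _)).2 fun i => ?_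
    refine Real.le_sqrt_of_sq_le ?_
    rw [ell_apply, Real.norm_eq_abs, sq_abs, pow_two]
    exact Finset.single_le_sum (f := fun i => x i * x i) (fun i _ => mul_self_nonneg _)
      (Finset.mem_univ i)
  calc ‖x‖ ^ 2 ≤ √(ell x x) ^ 2 := by gcongr
    _ = _ := Real.sq_sqrt h0

lemma ell_le (x : EE d) : ell x x ≤ d * ‖x‖ ^ 2 := by
  rw [ell_apply]
  calc ∑ i, x i * x i ≤ ∑ i : Fin d, ‖x‖ ^ 2 := Finset.sum_le_sum fun i _ => by
        have := norm_le_pi_norm x i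
        rw [← pow_two, ← sq_abs]; exact pow_le_pow_left₀ (abs_nonneg _) this 2
    _ = _ := by simp

/-- the Gaussian as a Schwartz function -/
def gau (d : ℕ) : 𝓢(EE d, ℝ) where
  toFun z := Real.exp (-(1/2) * ell z z)
  smooth' := by fun_prop
  decay' k n := by
    have hT : Function.HasTemperateGrowth (fun z : EE d => ((-(1/2) : ℝ) • ell) z z) :=
      ContinuousLinearMap.bilinear_hasTemperateGrowth _ .id' .id'
    obtain ⟨l, C, hC, h⟩ := hT.norm_iteratedFDeriv_le_uniform n
    set m := k + l * n
    refine ⟨n.factorial * (1 + C) ^ n * Real.exp (m ^ 2 / 2), fun x => ?_⟩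
    have key := norm_iteratedFDeriv_comp_le (g := Real.exp) (N := ∞) Real.contDiff_exp hT.1
      (n := n) (by exact_mod_cast le_top) x (C := Real.exp (-(1/2) * ell x x))
      (D := (1 + C) * (1 + ‖x‖) ^ l) (fun i _ => by
        rw [norm_iteratedFDeriv_eq_norm_iteratedDeriv, iteratedDeriv_eq_iterate]; simp) (fun i h1 hi => by
        refine (h i hi x).trans ?_
        have h2 : 1 ≤ (1 + C) * (1 + ‖x‖) ^ l :=
          one_le_mul_of_one_le_of_one_le (by linarith) (one_le_pow₀ (by linarith [norm_nonneg x]))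
        refine le_trans ?_ (le_self_pow₀ h2 (by omega))
        gcongr; linarith)
    have h3 : Real.exp (-(1/2) * ell x x) * (1 + ‖x‖) ^ m ≤ Real.exp (m ^ 2 / 2) := by
      have : (1 + ‖x‖) ^ m ≤ Real.exp (m * ‖x‖) := by
        rw [Real.exp_nat_mul]; gcongr; linarith [Real.add_one_le_exp ‖x‖]
      calc _ ≤ Real.exp (-(1/2) * ell x x) * Real.exp (m * ‖x‖) := by gcongr
        _ ≤ _ := by
          rw [← Real.exp_add]; gcongr
          nlinarith [sq_le_ell x, sq_nonneg (m - ‖x‖)]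
    have h4 : ‖x‖ ^ k ≤ (1 + ‖x‖) ^ k := by gcongr; linarith
    calc _ ≤ (1 + ‖x‖) ^ k * (n.factorial * Real.exp (-(1/2) * ell x x) * ((1 + C) * (1 + ‖x‖) ^ l) ^ n) := by
          gcongr; exact key
      _ = n.factorial * (1 + C) ^ n * (Real.exp (-(1/2) * ell x x) * (1 + ‖x‖) ^ m) := by
          rw [mul_pow, pow_add, pow_mul]; ring
      _ ≤ _ := by gcongr

lemma schwartz_decay (q : 𝓢(EE d, F)) :
    ∃ C, 0 ≤ C ∧ ∀ z, (1 + ‖z‖) * ‖q z‖ ≤ C * (1 + ‖z‖) ^ (-((d : ℝ) + 1)) := by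
  have h := fun z => SchwartzMap.one_add_le_sup_seminorm_apply (𝕜 := ℝ) (m := (d + 2, 0)) (k := d + 2)
    (n := 0) le_rfl le_rfl q z
  refine ⟨_, (by positivity : 0 ≤ ((1 + ‖(0:EE d)‖) ^ (d+2) * ‖iteratedFDeriv ℝ 0 q 0‖)).trans (h 0), fun z => ?_⟩
  have h1 := h z
  rw [norm_iteratedFDeriv_zero] at h1
  have : (0:ℝ) < 1 + ‖z‖ := by positivity
  rw [Real.rpow_neg this.le, ← div_eq_mul_inv, le_div_iff₀ (by positivity)]
  have e : (1 + ‖z‖) ^ ((d:ℝ) + 1) = (1 + ‖z‖) ^ (d + 1) := by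
    rw [← Real.rpow_natCast]; norm_cast
  rw [e]; refine le_of_eq_of_le ?_ h1; ring

abbrev DS (q : 𝓢(EE d, F)) : 𝓢(EE d, EE d →L[ℝ] F) := SchwartzMap.fderivCLM ℝ _ _ q

lemma DS_apply (q : 𝓢(EE d, F)) (z) : DS q z = fderiv ℝ q z := rfl

/-- `J q f x s = ∫ f (x + s z) q z dz` -/
def J (q : EE d → F) (f : EE d → ℝ) (x : EE d) (s : ℝ) : F := ∫ z, f (x + s • z) • q z

lemma J_eq (q : EE d → F) (f : EE d → ℝ) (x : EE d) {t : ℝ} (ht : 0 < t) :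
    J q f x t⁻¹ = t ^ d • ∫ y, f y • q (t • (y - x)) := by
  have h1 := integral_add_left_eq_self (μ := volume) (fun y => f y • q (t • (y - x))) x
  have h2 := Measure.integral_comp_smul volume (fun z => f (x + t⁻¹ • z) • q z) t
  rw [← h1]
  simp only [add_sub_cancel_left]
  have : ∀ y : EE d, f (x + y) • q (t • y) = f (x + t⁻¹ • t • y) • q (t • y) := fun y => by
    rw [smul_smul, inv_mul_cancel₀ ht.ne', one_smul]
  simp_rw [this, h2, J]
  simp only [Module.finrank_fin_fun, smul_smul]
  rw [abs_of_pos (by positivity), mul_inv_cancel₀ (by positivity), one_smul]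

/-- derivative kernel -/
def KD (q : 𝓢(EE d, F)) (p : EE d × ℝ) (y : EE d) : EE d × ℝ →L[ℝ] F :=
  (DS q (p.2 • (y - p.1))).comp ((ContinuousLinearMap.snd ℝ (EE d) ℝ).smulRight (y - p.1) -
        p.2 • ContinuousLinearMap.fst ℝ (EE d) ℝ)

lemma KD_cont (q : 𝓢(EE d, F)) (p : EE d × ℝ) : Continuous (KD q p) := by
  have hq' := (DS q).continuous
  refine Continuous.clm_comp (hq'.comp (by fun_prop)) (Continuous.sub ?_ continuous_const)
  exact (ContinuousLinearMap.smulRightL ℝ (EE d × ℝ) (EE d)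
      (ContinuousLinearMap.snd ℝ (EE d) ℝ)).continuous.comp (by fun_prop : Continuous fun y => y - p.1)

lemma KD_bound (q : 𝓢(EE d, F)) (x₀ : EE d) {t₀ : ℝ} (ht : 0 < t₀) :
    ∃ b : EE d → ℝ, Integrable b ∧ ∀ y, ‖q (t₀ • (y - x₀))‖ ≤ b y ∧
      ∀ p ∈ Metric.ball x₀ 1 ×ˢ Ioo (t₀ / 2) (2 * t₀), ‖KD q p y‖ ≤ b y := by
  obtain ⟨C, hC, hd⟩ := schwartz_decay q
  obtain ⟨C', hC', hd'⟩ := schwartz_decay (DS q)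
  set r : ℝ := (d : ℝ) + 1
  have hr : 0 ≤ r := by positivity
  set K : ℝ := 2 + 2 / t₀
  have hK : 0 < K := by positivity
  have hint : Integrable (fun y : EE d => (1 + ‖y - x₀‖) ^ (-r)) :=
    (integrable_one_add_norm (by simp [r])).comp_sub_right x₀
  have hz : ∀ p ∈ Metric.ball x₀ 1 ×ˢ Ioo (t₀ / 2) (2 * t₀), ∀ y : EE d,
      ‖y - p.1‖ ≤ 2 / t₀ * ‖p.2 • (y - p.1)‖ ∧
      (1 + ‖p.2 • (y - p.1)‖) ^ (-r) ≤ K ^ r * (1 + ‖y - x₀‖) ^ (-r) := by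
    rintro ⟨x, t⟩ ⟨hx, ht1, ht2⟩ y
    simp only at *
    have htp : 0 < t := by linarith
    have h1 : ‖y - x‖ ≤ 2 / t₀ * ‖t • (y - x)‖ := by
      rw [norm_smul, Real.norm_of_nonneg htp.le, ← mul_assoc, div_mul_eq_mul_div]
      refine le_mul_of_one_le_left (norm_nonneg _) ?_
      rw [le_div_iff₀ ht]; linarith
    refine ⟨h1, ?_⟩
    have h2 : ‖y - x₀‖ ≤ ‖y - x‖ + 1 := by
      rw [Metric.mem_ball, dist_eq_norm] at hx
      calc _ = ‖(y - x) + (x - x₀)‖ := by simp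
        _ ≤ _ := (norm_add_le _ _).trans (by linarith)
    set n := ‖t • (y - x)‖
    have hn : 0 ≤ n := norm_nonneg _
    have h3 : 1 + ‖y - x₀‖ ≤ K * (1 + n) := by
      have : K * (1 + n) = 2 + 2 * n + 2 / t₀ + 2 / t₀ * n := by simp only [K]; ring
      have : 0 < 2 / t₀ := by positivity
      linarith
    rw [Real.rpow_neg (by positivity), Real.rpow_neg (by positivity), ← div_eq_mul_inv,
      inv_eq_one_div, div_le_div_iff₀ (by positivity) (by positivity), one_mul,
      ← Real.mul_rpow hK.le (by positivity)]
    exact Real.rpow_le_rpow (by positivity) h3 hr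
  have hs : (x₀, t₀) ∈ Metric.ball x₀ 1 ×ˢ Ioo (t₀ / 2) (2 * t₀) :=
    ⟨Metric.mem_ball_self one_pos, by constructor <;> simp <;> linarith⟩
  refine ⟨fun y => C * (K ^ r * (1 + ‖y - x₀‖) ^ (-r)) +
      C' * (K ^ r * (1 + ‖y - x₀‖) ^ (-r)) * (2 / t₀ + 2 * t₀),
      ((hint.const_mul _).const_mul _).add (((hint.const_mul _).const_mul _).mul_const _),
      fun y => ⟨?_, fun p hp => ?_⟩⟩
  · refine le_add_of_le_of_nonneg ?_ (by positivity)
    obtain ⟨-, h2⟩ := hz _ hs y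
    simp only at h2
    refine le_trans ?_ ((hd _).trans (mul_le_mul_of_nonneg_left h2 hC))
    exact le_mul_of_one_le_left (norm_nonneg _) (by linarith [norm_nonneg (t₀ • (y - x₀))])
  · refine le_add_of_nonneg_of_le (by positivity) ?_
    obtain ⟨h1, h2⟩ := hz p hp y
    have hp2 : 0 < p.2 ∧ p.2 < 2 * t₀ := ⟨by linarith [hp.2.1], hp.2.2⟩
    set n := ‖p.2 • (y - p.1)‖
    have hn : 0 ≤ n := norm_nonneg _
    have h3 : ‖(ContinuousLinearMap.snd ℝ (EE d) ℝ).smulRight (y - p.1) -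
        p.2 • ContinuousLinearMap.fst ℝ (EE d) ℝ‖ ≤ (1 + n) * (2 / t₀ + 2 * t₀) := by
      refine (norm_sub_le _ _).trans ?_
      rw [ContinuousLinearMap.norm_smulRight_apply, norm_smul, Real.norm_of_nonneg hp2.1.le]
      have a1 := ContinuousLinearMap.norm_snd_le (𝕜 := ℝ) (E := EE d) (F := ℝ)
      have a2 := ContinuousLinearMap.norm_fst_le (𝕜 := ℝ) (E := EE d) (F := ℝ)
      have a3 : 0 < 2 / t₀ := by positivity
      have a4 := mul_le_mul a1 h1 (norm_nonneg _) zero_le_one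
      have a5 := mul_le_mul hp2.2.le a2 (norm_nonneg _) (by linarith)
      have a6 : 0 ≤ n * t₀ := by positivity
      nlinarith
    calc _ ≤ ‖DS q (p.2 • (y - p.1))‖ * ((1 + n) * (2 / t₀ + 2 * t₀)) :=
          (ContinuousLinearMap.opNorm_comp_le _ _).trans (by gcongr)
      _ = ((1 + n) * ‖DS q (p.2 • (y - p.1))‖) * (2 / t₀ + 2 * t₀) := by ring
      _ ≤ _ := by exact mul_le_mul_of_nonneg_right ((hd' _).trans (mul_le_mul_of_nonneg_left h2 hC')) (by positivity)

lemma KD_integrable (q : 𝓢(EE d, F)) {f : EE d → ℝ} (hf : Continuous f) {M : ℝ} (hM : ∀ x, |f x| ≤ M)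
    (x₀ : EE d) {t₀ : ℝ} (ht : 0 < t₀) : Integrable (fun y => f y • KD q (x₀, t₀) y) := by
  obtain ⟨b, hb, h⟩ := KD_bound q x₀ ht
  have : SecondCountableTopologyEither (EE d) (EE d × ℝ →L[ℝ] F) :=
    secondCountableTopologyEither_of_left _ _
  refine Integrable.mono' (hb.const_mul M) (hf.smul (KD_cont q _)).aestronglyMeasurable
    (Eventually.of_forall fun y => ?_)
  rw [norm_smul]
  exact mul_le_mul (hM y) ((h y).2 _ ⟨Metric.mem_ball_self one_pos, by constructor <;> simp <;> linarith⟩)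
    (norm_nonneg _) ((abs_nonneg _).trans (hM 0))

lemma J_deriv (q : 𝓢(EE d, F)) {f : EE d → ℝ} (hf : Continuous f) {M : ℝ} (hM : ∀ x, |f x| ≤ M)
    (x₀ : EE d) {t₀ : ℝ} (ht : 0 < t₀) :
    HasFDerivAt (fun p : EE d × ℝ => ∫ y, f y • q (p.2 • (y - p.1)))
      (∫ y, f y • KD q (x₀, t₀) y) (x₀, t₀) := by
  obtain ⟨b, hb, h⟩ := KD_bound q x₀ ht
  have hM0 : 0 ≤ M := (abs_nonneg _).trans (hM 0)
  have hq := q.continuous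
  have hqd := q.differentiable
  refine hasFDerivAt_integral_of_dominated_of_fderiv_le (μ := volume) (𝕜 := ℝ)
    (F := fun p y => f y • q (p.2 • (y - p.1)))
    (F' := fun p y => f y • KD q p y) (x₀ := (x₀, t₀)) (bound := fun y => M * b y)
    (prod_mem_nhds (Metric.ball_mem_nhds x₀ one_pos)
      (Ioo_mem_nhds (a := t₀ / 2) (b := 2 * t₀) (by linarith) (by linarith)))
    (Eventually.of_forall fun p => Continuous.aestronglyMeasurable (by fun_prop))
    (Integrable.mono' (hb.const_mul M)
      (Continuous.aestronglyMeasurable (by fun_prop)) (Eventually.of_forall fun y => ?_))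
    (KD_integrable q hf hM x₀ ht).1
    (Eventually.of_forall fun y p hp => ?_) (hb.const_mul M)
    (Eventually.of_forall fun y p hp => ?_)
  · rw [norm_smul]; exact mul_le_mul (hM y) (h y).1 (norm_nonneg _) hM0
  · rw [norm_smul]; exact mul_le_mul (hM y) ((h y).2 p hp) (norm_nonneg _) hM0
  · have e1 : HasFDerivAt (fun p : EE d × ℝ => p.2 • (y - p.1))
        ((ContinuousLinearMap.snd ℝ (EE d) ℝ).smulRight (y - p.1) -
        p.2 • ContinuousLinearMap.fst ℝ (EE d) ℝ) p := by
      refine ((ContinuousLinearMap.snd ℝ (EE d) ℝ).hasFDerivAt.smul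
        ((ContinuousLinearMap.fst ℝ (EE d) ℝ).hasFDerivAt.const_sub y)).congr_fderiv ?_
      ext <;> simp
    exact ((hqd _).hasFDerivAt.comp p e1).const_smul (f y)


lemma J_int (q : 𝓢(EE d, F)) {f : EE d → ℝ} (hf : Continuous f) {M : ℝ} (hM : ∀ x, |f x| ≤ M)
    (x : EE d) (s : ℝ) : Integrable fun z => f (x + s • z) • q z := by
  refine Integrable.mono' (q.integrable.norm.const_mul M)
    (Continuous.aestronglyMeasurable (by have := q.continuous; fun_prop)) (Eventually.of_forall fun z => ?_)
  rw [norm_smul]; gcongr; exact hM _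

lemma J_deriv2 [CompleteSpace F] (q : 𝓢(EE d, F)) {f : EE d → ℝ} (hf : Continuous f) {M : ℝ} (hM : ∀ x, |f x| ≤ M)
    (x : EE d) {t : ℝ} (ht : 0 < t) (v : EE d) (τ : ℝ) :
    t ^ d • (∫ y, f y • KD q (x, t) y) (v, τ)
      = τ • t⁻¹ • J (fun z => DS q z z) f x t⁻¹ - t • J (DS q) f x t⁻¹ v := by
  have hi := KD_integrable q hf hM x ht
  rw [ContinuousLinearMap.integral_apply hi]
  have h1 := hi.apply_continuousLinearMap (0, τ)
  have h2 := hi.apply_continuousLinearMap (v, 0)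
  have e : ∀ w : EE d × ℝ, w = (v, τ) → w = (0, τ) + (v, 0) := by rintro _ rfl; simp
  rw [e _ rfl]
  simp only [map_add]
  rw [integral_add h1 h2, J_eq _ _ _ ht, J_eq _ _ _ ht, smul_add, sub_eq_add_neg]
  congr 1
  · have : ∀ y, (f y • KD q (x, t) y) (0, τ) = (τ * t⁻¹) • (f y • (DS q (t • (y - x))) (t • (y - x))) := by
      intro y; simp [KD, smul_smul]; congr 1; field_simp
    simp_rw [this, integral_smul, smul_smul]; congr 1; ring
  · have h3 : Integrable fun y => f y • DS q (t • (y - x)) := by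
      have := ((J_int (DS q) hf hM x t⁻¹).comp_smul ht.ne').comp_sub_right x
      refine this.congr (Eventually.of_forall fun y => ?_)
      simp [smul_smul, inv_mul_cancel₀ ht.ne']
    have : ∀ y, (f y • KD q (x, t) y) (v, 0) = (-t) • ((f y • (DS q (t • (y - x)))) v) := by
      intro y; simp [KD, smul_comm t]
    rw [_root_.smul_apply, ContinuousLinearMap.integral_apply h3]
    simp_rw [this, integral_smul]; module

lemma J_fderiv [CompleteSpace F] (q : 𝓢(EE d, F)) {f : EE d → ℝ} (hf : Continuous f) {M : ℝ} (hM : ∀ x, |f x| ≤ M)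
    (x : EE d) {s : ℝ} (hs : 0 < s) :
    HasFDerivAt (fun x => J q f x s) (-s⁻¹ • J (DS q) f x s) x := by
  have h := J_deriv q hf hM x (inv_pos.2 hs)
  have h1 := h.comp x (hasFDerivAt_prodMk_left (𝕜 := ℝ) x s⁻¹)
  have h2 := h1.const_smul (s⁻¹ ^ d)
  refine (h2.congr_of_eventuallyEq (Eventually.of_forall fun x => ?_)).congr_fderiv ?_
  · have := J_eq q f x (inv_pos.2 hs)
    rw [inv_inv] at this; simpa using this
  · ext v
    have := J_deriv2 q hf hM x (inv_pos.2 hs) v 0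
    simp only [inv_inv] at this
    simpa using this

lemma J_sderiv [CompleteSpace F] (q : 𝓢(EE d, F)) {f : EE d → ℝ} (hf : Continuous f) {M : ℝ} (hM : ∀ x, |f x| ≤ M)
    (x : EE d) {s : ℝ} (hs : 0 < s) :
    HasDerivAt (fun s => J q f x s) (-s⁻¹ • ((d : ℝ) • J q f x s + J (fun z => DS q z z) f x s)) s := by
  have h := J_deriv q hf hM x (inv_pos.2 hs)
  have h1 := (h.comp_hasDerivAt (f := fun s : ℝ => (x, s⁻¹)) s
    ((hasDerivAt_const s x).prodMk (hasDerivAt_inv hs.ne')))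
  have h2 := (((hasDerivAt_inv hs.ne').pow d).smul h1)
  refine (h2.congr_of_eventuallyEq ?_).congr_deriv ?_
  · filter_upwards [lt_mem_nhds hs] with r hr
    have := J_eq q f x (inv_pos.2 hr)
    rw [inv_inv] at this; simpa using this
  · have e1 := J_deriv2 q hf hM x (inv_pos.2 hs) 0 (-(s^2)⁻¹)
    have e2 := J_eq q f x (inv_pos.2 hs)
    rw [inv_inv] at e1 e2
    simp only [Pi.pow_apply, Function.comp_apply]
    have e3 : (d : ℝ) * s⁻¹ ^ (d - 1) * -(s ^ 2)⁻¹ = - (s⁻¹ * d * s⁻¹ ^ d) := by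
      rcases d with _ | n
      · simp
      · simp; field_simp; ring
    rw [e1, e2, e3]
    simp only [map_zero, smul_zero, sub_zero]
    rw [show (-(s ^ 2)⁻¹ : ℝ) • s • J (fun z => DS q z z) f x s = -s⁻¹ • J (fun z => DS q z z) f x s by
      rw [smul_smul]; congr 1; field_simp]
    module
end

section
open MeasureTheory Set Filter Topology
open scoped SchwartzMap ContDiff

open scoped SI
set_option linter.unusedSectionVars false
variable {d : ℕ} {F : Type} [NormedAddCommGroup F] [NormedSpace ℝ F]

/-- Hölder predicate -/
def Hol (α C : ℝ) (f : EE d → F) (S : Set (EE d)) : Prop :=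
  ∀ x ∈ S, ∀ y ∈ S, ‖f x - f y‖ ≤ C * ‖x - y‖ ^ α

lemma Hol.continuousOn {α C : ℝ} {f : EE d → F} {S : Set (EE d)} (h : Hol α C f S) (hα : 0 < α) : ContinuousOn f S := by
  intro x hx
  rw [ContinuousWithinAt, tendsto_iff_norm_sub_tendsto_zero]
  have h1 : Tendsto (fun y => C * ‖y - x‖ ^ α) (𝓝[S] x) (𝓝 0) := by
    have : Continuous fun y : EE d => C * ‖y - x‖ ^ α := by
      refine continuous_const.mul (Continuous.rpow_const (by fun_prop) fun _ => Or.inr hα.le)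
    have := this.tendsto x
    simp only [sub_self, norm_zero, Real.zero_rpow hα.ne', mul_zero] at this
    exact this.mono_left nhdsWithin_le_nhds
  refine squeeze_zero' (Eventually.of_forall fun _ => norm_nonneg _) ?_ h1
  filter_upwards [self_mem_nhdsWithin] with y hy using h y hy x hx

lemma Hol.continuous {α C : ℝ} {f : EE d → F} (h : Hol α C f univ) (hα : 0 < α) : Continuous f :=
  continuousOn_univ.1 (h.continuousOn hα)

lemma int_DS [CompleteSpace F] (q : 𝓢(EE d, F)) : ∫ z, DS q z = 0 := by
  have h := J_fderiv q (f := fun _ => 1) continuous_const (M := 1) (by simp) 0 one_pos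
  have h2 : HasFDerivAt (fun x => J q (fun _ => 1) x 1) (0 : EE d →L[ℝ] F) 0 := by
    simp only [J]; exact hasFDerivAt_const _ _
  have := h.unique h2
  simpa [J] using this

lemma J_bound (q : 𝓢(EE d, F)) : ∃ C, 0 ≤ C ∧ ∀ (f : EE d → ℝ) (M : ℝ), (∀ x, |f x| ≤ M) →
    ∀ x s, ‖J q f x s‖ ≤ C * M := by
  refine ⟨∫ z, ‖q z‖, integral_nonneg fun _ => norm_nonneg _, fun f M hM x s => ?_⟩
  rw [← integral_mul_const]
  refine norm_integral_le_of_norm_le (q.integrable.norm.mul_const M) (Eventually.of_forall fun z => ?_)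
  rw [norm_smul, mul_comm]; gcongr; exact hM _

lemma J_hol [CompleteSpace F] (q : 𝓢(EE d, F)) : ∃ C, 0 ≤ C ∧ ∀ (f : EE d → ℝ) (M H α : ℝ), 0 < α → α ≤ 1 → 0 ≤ H →
    (∀ x, |f x| ≤ M) → Hol α H f univ → ∀ x, ∀ s > 0, ‖J q f x s - f x • ∫ z, q z‖ ≤ C * H * s ^ α := by
  obtain ⟨C, hC, hd⟩ := schwartz_decay q
  have hint : Integrable (fun y : EE d => (1 + ‖y‖) ^ (-((d:ℝ) + 1))) := integrable_one_add_norm (by simp)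
  refine ⟨∫ z : EE d, C * (1 + ‖z‖) ^ (-((d:ℝ)+1)), integral_nonneg fun _ => by positivity,
    fun f M H α h0 h1 hH hM hf x s hs => ?_⟩
  rw [mul_assoc, ← integral_mul_const, J, ← integral_smul, ← integral_sub (J_int q (hf.continuous h0) hM x s) (q.integrable.smul (f x) : Integrable fun z => f x • q z)]
  refine norm_integral_le_of_norm_le ((hint.const_mul C).mul_const _) (Eventually.of_forall fun z => ?_)
  rw [← sub_smul, norm_smul]
  have e1 := hf (x + s • z) trivial x trivial
  have e2 : ‖z‖ ^ α ≤ 1 + ‖z‖ := by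
    rcases le_total ‖z‖ 1 with h | h
    · exact (Real.rpow_le_one (norm_nonneg _) h h0.le).trans (by simp)
    · calc _ ≤ ‖z‖ ^ (1:ℝ) := Real.rpow_le_rpow_of_exponent_le h h1
        _ ≤ _ := by simp
  rw [add_sub_cancel_left, norm_smul, Real.norm_of_nonneg hs.le, Real.mul_rpow hs.le (norm_nonneg _)] at e1
  calc _ ≤ (H * (s ^ α * (1 + ‖z‖))) * ‖q z‖ := by
        refine mul_le_mul_of_nonneg_right (e1.trans ?_) (norm_nonneg _); gcongr
    _ = ((1 + ‖z‖) * ‖q z‖) * (H * s ^ α) := by ring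
    _ ≤ _ := mul_le_mul_of_nonneg_right (hd z) (by positivity)

/-- radial integrals -/
def II (m : ℝ) (q : EE d → F) (f : EE d → ℝ) (x : EE d) : F :=
  ∫ s in Ioi (0:ℝ), (s ^ m * Real.exp (-(1/2) * s ^ 2)) • J q f x s

lemma wt_nonneg {s : ℝ} (hs : 0 < s) (m : ℝ) : 0 ≤ s ^ m * Real.exp (-(1/2) * s ^ 2) := by positivity

lemma wt_int {m : ℝ} (hm : -1 < m) : IntegrableOn (fun s : ℝ => s ^ m * Real.exp (-(1/2) * s ^ 2)) (Ioi 0) :=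
  integrableOn_rpow_mul_exp_neg_mul_sq (by norm_num) hm

lemma II_meas [CompleteSpace F] (m : ℝ) (q : 𝓢(EE d, F)) {f : EE d → ℝ} (hf : Continuous f) {M : ℝ} (hM : ∀ x, |f x| ≤ M)
    (x : EE d) : AEStronglyMeasurable (fun s => (s ^ m * Real.exp (-(1/2) * s ^ 2)) • J q f x s)
      (volume.restrict (Ioi 0)) := by
  refine ContinuousOn.aestronglyMeasurable (fun s hs => ?_) measurableSet_Ioi
  refine ContinuousAt.continuousWithinAt ?_
  have hs' : (0:ℝ) < s := hs
  exact ((Real.continuousAt_rpow_const _ _ (Or.inl hs'.ne')).mul (by fun_prop)).smul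
    (J_sderiv q hf hM x hs').continuousAt

lemma wt_bd {m β K : ℝ} {s : ℝ} (hs : 0 < s) {v : F} (h : ‖v‖ ≤ K * s ^ β) :
    ‖(s ^ m * Real.exp (-(1/2) * s ^ 2)) • v‖ ≤ K * (s ^ (m + β) * Real.exp (-(1/2) * s ^ 2)) := by
  rw [norm_smul, Real.norm_of_nonneg (wt_nonneg hs m), Real.rpow_add hs]
  calc _ ≤ s ^ m * Real.exp (-(1/2) * s ^ 2) * (K * s ^ β) := by gcongr
    _ = _ := by ring

lemma II_int [CompleteSpace F] {m : ℝ} (q : 𝓢(EE d, F)) {f : EE d → ℝ} (hf : Continuous f) {M : ℝ} (hM : ∀ x, |f x| ≤ M)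
    (x : EE d) {β K : ℝ} (hm : -1 < m + β) (h : ∀ s > 0, ‖J q f x s‖ ≤ K * s ^ β) :
    IntegrableOn (fun s => (s ^ m * Real.exp (-(1/2) * s ^ 2)) • J q f x s) (Ioi 0) := by
  refine Integrable.mono' ((wt_int hm).const_mul K) (II_meas m q hf hM x) ?_
  filter_upwards [ae_restrict_mem measurableSet_Ioi] with s hs
  exact wt_bd hs (h s hs)

lemma II_norm {m : ℝ} (q : EE d → F) {f : EE d → ℝ}
    (x : EE d) {β K : ℝ} (hm : -1 < m + β) (h : ∀ s > 0, ‖J q f x s‖ ≤ K * s ^ β) :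
    ‖II m q f x‖ ≤ K * ∫ s in Ioi (0:ℝ), (s ^ (m + β) * Real.exp (-(1/2) * s ^ 2)) := by
  rw [← integral_const_mul]
  refine norm_integral_le_of_norm_le ((wt_int hm).const_mul K) ?_
  filter_upwards [ae_restrict_mem measurableSet_Ioi] with s hs
  exact wt_bd hs (h s hs)

lemma II_fderiv [CompleteSpace F] {m : ℝ} (q : 𝓢(EE d, F)) {f : EE d → ℝ} (hf : Continuous f) {M : ℝ} (hM : ∀ x, |f x| ≤ M)
    {β K β' K' : ℝ} (hm : -1 < m + β) (h : ∀ x, ∀ s > 0, ‖J q f x s‖ ≤ K * s ^ β)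
    (hm' : -1 < (m - 1) + β') (h' : ∀ x, ∀ s > 0, ‖J (DS q) f x s‖ ≤ K' * s ^ β') (x : EE d) :
    HasFDerivAt (II m q f) (-II (m - 1) (DS q) f x) x := by
  rw [II, ← integral_neg]
  refine hasFDerivAt_integral_of_dominated_of_fderiv_le (μ := volume.restrict (Ioi 0)) (𝕜 := ℝ)
    (F := fun x s => (s ^ m * Real.exp (-(1/2) * s ^ 2)) • J q f x s)
    (F' := fun x s => -((s ^ (m-1) * Real.exp (-(1/2) * s ^ 2)) • J (DS q) f x s))
    (bound := fun s => K' * (s ^ (m - 1 + β') * Real.exp (-(1/2) * s ^ 2)))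
    univ_mem (Eventually.of_forall fun x => II_meas m q hf hM x) (II_int q hf hM x hm (h x))
    (II_meas (m-1) (DS q) hf hM x).neg ?_ ((wt_int hm').const_mul K') ?_
  · filter_upwards [ae_restrict_mem measurableSet_Ioi] with s hs x _
    rw [norm_neg]
    exact wt_bd hs (h' x s hs)
  · filter_upwards [ae_restrict_mem measurableSet_Ioi] with s hs x _
    refine ((J_fderiv q hf hM x hs).const_smul (s ^ m * Real.exp (-(1/2) * s ^ 2))).congr_fderiv ?_
    have hs' : (0:ℝ) < s := hs
    rw [Real.rpow_sub_one hs'.ne', smul_smul]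
    have e : s ^ m * Real.exp (-(1/2) * s ^ 2) * -s⁻¹ = -(s ^ m / s * Real.exp (-(1/2) * s ^ 2)) := by
      field_simp
    rw [e]; exact neg_smul _ _

lemma II_hol [CompleteSpace F] {α : ℝ} (h0 : 0 < α) (h1 : α < 1) (q : 𝓢(EE d, F)) {f : EE d → ℝ} (hf : Continuous f) {M : ℝ} (hM : ∀ x, |f x| ≤ M)
    {K : ℝ} (hK : 0 ≤ K) (h : ∀ x, ∀ s > 0, ‖J q f x s‖ ≤ K * s ^ α)
    (h' : ∀ x, ∀ s > 0, ‖J (DS q) f x s‖ ≤ K * s ^ α) :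
    Hol α (K * (2 / α + 1 / (1 - α))) (II (-1) q f) univ := by
  intro x _ y _
  have i1 := fun x => II_int (m := -1) q hf hM x (by linarith) (h x)
  rcases eq_or_ne x y with rfl | hxy
  · simp [Real.zero_rpow h0.ne']
  set t := ‖x - y‖
  have ht : 0 < t := norm_sub_pos_iff.2 hxy
  rw [II, II, ← integral_sub (i1 x) (i1 y), ← Ioc_union_Ioi_eq_Ioi ht.le]
  have e : ∀ s : ℝ, 0 < s → ∀ v : F, ‖(s ^ (-1:ℝ) * Real.exp (-(1/2) * s ^ 2)) • v‖ ≤ s ^ (-1:ℝ) * ‖v‖ := by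
    intro s hs v
    rw [norm_smul, Real.norm_of_nonneg (wt_nonneg hs _)]
    gcongr
    refine mul_le_of_le_one_right (by positivity) (Real.exp_le_one_iff.2 (by nlinarith [sq_nonneg s]))
  have j1 : IntegrableOn (fun s : ℝ => 2 * K * s ^ (α - 1)) (Ioc 0 t) := by
    have := (intervalIntegral.intervalIntegrable_rpow' (a := 0) (b := t) (r := α - 1) (by linarith)).const_mul (2 * K)
    rwa [intervalIntegrable_iff_integrableOn_Ioc_of_le ht.le] at this
  have j2 : IntegrableOn (fun s : ℝ => K * t * s ^ (α - 2)) (Ioi t) :=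
    (integrableOn_Ioi_rpow_of_lt (by linarith) ht).const_mul _
  have b1 : ∀ s ∈ Ioc 0 t, ‖(s ^ (-1:ℝ) * Real.exp (-(1/2) * s ^ 2)) • J q f x s -
      (s ^ (-1:ℝ) * Real.exp (-(1/2) * s ^ 2)) • J q f y s‖ ≤ 2 * K * s ^ (α - 1) := by
    intro s hs
    rw [← smul_sub]
    refine (e s hs.1 _).trans ?_
    have := norm_sub_le (J q f x s) (J q f y s)
    calc _ ≤ s ^ (-1:ℝ) * (2 * (K * s ^ α)) := by
          have := hs.1
          gcongr; linarith [h x s hs.1, h y s hs.1]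
      _ = _ := by rw [sub_eq_neg_add, Real.rpow_add hs.1]; ring
  have b2 : ∀ s ∈ Ioi t, ‖(s ^ (-1:ℝ) * Real.exp (-(1/2) * s ^ 2)) • J q f x s -
      (s ^ (-1:ℝ) * Real.exp (-(1/2) * s ^ 2)) • J q f y s‖ ≤ K * t * s ^ (α - 2) := by
    intro s hs
    have hs0 : 0 < s := ht.trans hs
    rw [← smul_sub]
    refine (e s hs0 _).trans ?_
    have := Convex.norm_image_sub_le_of_norm_hasFDerivWithin_le (f := fun x => J q f x s) (s := univ)
      (C := s⁻¹ * (K * s ^ α)) (fun z _ => (J_fderiv q hf hM z hs0).hasFDerivWithinAt) (fun z _ => by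
        rw [norm_smul, norm_neg, norm_inv, Real.norm_of_nonneg hs0.le]; gcongr; exact h' z s hs0)
      convex_univ (mem_univ y) (mem_univ x)
    calc _ ≤ s ^ (-1:ℝ) * (s⁻¹ * (K * s ^ α) * t) := by gcongr
      _ = _ := by
        rw [show α - 2 = (-1) + (-1) + α by ring, Real.rpow_add hs0, Real.rpow_add hs0, Real.rpow_neg_one]; ring
  have i2 : IntegrableOn (fun s => (s ^ (-1:ℝ) * Real.exp (-(1/2) * s ^ 2)) • J q f x s -
      (s ^ (-1:ℝ) * Real.exp (-(1/2) * s ^ 2)) • J q f y s) (Ioi 0) := (i1 x).sub (i1 y)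
  rw [← Ioc_union_Ioi_eq_Ioi ht.le] at i2
  rw [setIntegral_union Ioc_disjoint_Ioi_same measurableSet_Ioi i2.left_of_union i2.right_of_union]
  refine (norm_add_le _ _).trans ?_
  have c1 := norm_integral_le_of_norm_le j1 ((ae_restrict_mem measurableSet_Ioc).mono b1)
  have c2 := norm_integral_le_of_norm_le j2 ((ae_restrict_mem measurableSet_Ioi).mono b2)
  have v1 : ∫ s in Ioc 0 t, 2 * K * s ^ (α - 1) = 2 * K * ((t ^ (α - 1 + 1) - 0 ^ (α - 1 + 1)) / (α - 1 + 1)) := by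
    rw [integral_const_mul, ← intervalIntegral.integral_of_le ht.le, integral_rpow (Or.inl (by linarith))]
  rw [v1] at c1
  rw [integral_const_mul (K * t), integral_Ioi_rpow_of_lt (by linarith) ht] at c2
  simp only [sub_add_cancel, Real.zero_rpow h0.ne', sub_zero] at c1
  rw [show α - 2 + 1 = α - 1 by ring] at c2
  have e3 : t * t ^ (α - 1) = t ^ α := by rw [Real.rpow_sub_one ht.ne']; field_simp
  have e4 : K * t * (-t ^ (α - 1) / (α - 1)) = K * (1 / (1 - α)) * t ^ α := by
    rw [← e3]; have : 1 - α ≠ 0 := by linarith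
    have : α - 1 ≠ 0 := by linarith
    field_simp; ring
  rw [e4] at c2
  refine (add_le_add c1 c2).trans (le_of_eq ?_)
  ring
end

section
open MeasureTheory Set Filter Topology
open scoped SchwartzMap ContDiff

open scoped SI
set_option linter.unusedSectionVars false
variable {d : ℕ} {F : Type} [NormedAddCommGroup F] [NormedSpace ℝ F]

instance : NormedAddCommGroup (E1 d) := inferInstance
instance : NormedSpace ℝ (E1 d) := inferInstance
instance : AddCommGroup (E1 d) := inferInstance
instance : Module ℝ (E1 d) := inferInstance
instance : NormSMulClass ℝ (E1 d) := inferInstance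
instance : NormedAddCommGroup (E2 d) := inferInstance
instance : NormedSpace ℝ (E2 d) := inferInstance
instance : AddCommGroup (E2 d) := inferInstance
instance : Module ℝ (E2 d) := inferInstance
instance : NormSMulClass ℝ (E2 d) := NormedSpace.toNormSMulClass

/-- basis vector -/
abbrev eb (k : Fin d) : EE d := Pi.single k 1

/-- quadratic trace -/
def QM (M : EE d →L[ℝ] EE d) : E2 d →L[ℝ] ℝ :=
  ∑ k, (ContinuousLinearMap.apply ℝ ℝ (M (eb k))).comp (ContinuousLinearMap.apply ℝ (E1 d) (M (eb k)))

lemma QM_apply (M : EE d →L[ℝ] EE d) (T : E2 d) : QM M T = ∑ k, T (M (eb k)) (M (eb k)) := by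
  simp [QM]

abbrev trE : E2 d →L[ℝ] ℝ := QM (ContinuousLinearMap.id ℝ (EE d))

lemma gau_apply (z : EE d) : gau d z = Real.exp (-(1/2) * ell z z) := rfl

lemma ell_fderiv (z : EE d) : HasFDerivAt (fun z : EE d => ell z z) ((2:ℝ) • ell z) z := by
  have := (ell (d := d)).hasFDerivAt (x := z) |>.clm_apply (hasFDerivAt_id z)
  refine this.congr_fderiv ?_
  ext v; simp [ell_comm v z]; ring

lemma DS_gau (z : EE d) : DS (gau d) z = -(gau d z) • ell z := by
  rw [DS_apply]
  have := (((ell_fderiv z).const_mul (-(1/2))).exp)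
  refine HasFDerivAt.fderiv (this.congr_fderiv ?_)
  ext v; simp [gau_apply]

lemma DDS_gau (z v w : EE d) : DS (DS (gau d)) z v w = (ell z v * ell z w - ell v w) * gau d z := by
  rw [DS_apply]
  have h0 : (⇑(DS (gau d)) : EE d → E1 d) = fun z => -(gau d z) • ell z := funext DS_gau
  have h1 : HasFDerivAt (gau d) (-(gau d z) • ell z) z := by
    rw [← DS_gau]; exact (gau d).differentiableAt.hasFDerivAt
  have h2 : HasFDerivAt (fun z => -(gau d z) • ell z) _ z :=
    HasFDerivAt.smul (𝕜 := ℝ) h1.neg ((ell (d := d)).hasFDerivAt (x := z))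
  rw [h0, h2.fderiv]
  simp; ring

lemma gau_tr (z : EE d) : (d:ℝ) * gau d z + DS (gau d) z z = - trE (DS (DS (gau d)) z) := by
  have h : ∀ k : Fin d, ell (eb k) (eb k) = 1 := fun k => by simp [ell_apply, Pi.single_apply]
  have h2 : ∑ k : Fin d, ell z (eb k) * ell z (eb k) = ell z z := by
    rw [ell_apply z z]
    refine Finset.sum_congr rfl fun k _ => by simp [ell_apply, Pi.single_apply]
  rw [QM_apply, DS_gau]
  simp only [ContinuousLinearMap.id_apply, DDS_gau, ← Finset.sum_mul, Finset.sum_sub_distrib, h, h2]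
  simp; ring

def cg (d : ℕ) : ℝ := ∫ z, gau d z

lemma cg_pos : 0 < cg d := by
  have hn : 0 ≤ (⇑(gau d) : EE d → ℝ) := fun z => (Real.exp_pos _).le
  rw [cg, integral_pos_iff_support_of_nonneg hn (gau d).integrable]
  have : Function.support (gau d) = univ := by
    ext z; simp [gau_apply, Real.exp_ne_zero]
  rw [this]; exact (NeZero.pos _)

def Res (f : EE d → ℝ) (x : EE d) : ℝ := (cg d)⁻¹ • II 1 (gau d) f x
def Res1 (f : EE d → ℝ) (x : EE d) : E1 d := (cg d)⁻¹ • -II (1-1) (DS (gau d)) f x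
def Res2 (f : EE d → ℝ) (x : EE d) : E2 d := (cg d)⁻¹ • - -II (1-1-1) (DS (DS (gau d))) f x

theorem res_main {α : ℝ} (h0 : 0 < α) (h1 : α < 1) : ∃ C, 0 ≤ C ∧ ∀ (f : EE d → ℝ) (M H : ℝ),
    0 ≤ H → (∀ x, |f x| ≤ M) → Hol α H f univ → (∀ x, HasFDerivAt (Res f) (Res1 f x) x) ∧
      (∀ x, HasFDerivAt (Res1 f) (Res2 f x) x) ∧ (∀ x, |Res f x| ≤ C * M) ∧ (∀ x, ‖Res1 f x‖ ≤ C * M) ∧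
      (∀ x, ‖Res2 f x‖ ≤ C * H) ∧ Hol α (C * H) (Res2 f) univ ∧
      (∀ x, Res f x - trE (Res2 f x) = f x) := by
  obtain ⟨C0, hC0, b0⟩ := J_bound (gau d)
  obtain ⟨C1, hC1, b1⟩ := J_bound (DS (gau d))
  obtain ⟨C2, hC2, b2⟩ := J_hol (DS (DS (gau d)))
  obtain ⟨C3, hC3, b3⟩ := J_hol (DS (DS (DS (gau d))))
  obtain ⟨C4, hC4, b4⟩ := J_hol (gau d)
  rw [int_DS] at b2 b3
  simp only [smul_zero, sub_zero] at b2 b3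
  set A : ℝ → ℝ := fun m => ∫ s in Ioi (0:ℝ), (s ^ m * Real.exp (-(1/2) * s ^ 2))
  have hA : ∀ m, 0 ≤ A m := fun m => setIntegral_nonneg measurableSet_Ioi fun s hs => wt_nonneg hs m
  have hc := cg_pos (d := d)
  have hci : 0 ≤ (cg d)⁻¹ := (inv_pos.2 hc).le
  have h1' : 0 < 1 - α := by linarith
  set B := (C2 + C3) * (2 / α + 1 / (1 - α))
  have hB : 0 ≤ B := by positivity
  refine ⟨(cg d)⁻¹ * (C0 * A 1 + C1 * A 0 + C2 * A (α - 1) + B), by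
    have := hA 1; have := hA 0; have := hA (α - 1); positivity, fun f M H hH hM hf => ?_⟩
  have hfc := hf.continuous h0
  have hM0 : 0 ≤ M := (abs_nonneg _).trans (hM 0)
  have k0 : ∀ x, ∀ s > 0, ‖J (gau d) f x s‖ ≤ C0 * M * s ^ (0:ℝ) := fun x s _ => by simpa using b0 f M hM x s
  have k1 : ∀ x, ∀ s > 0, ‖J (DS (gau d)) f x s‖ ≤ C1 * M * s ^ (0:ℝ) := fun x s _ => by simpa using b1 f M hM x s
  have k2 := b2 f M H α h0 h1.le hH hM hf
  have k3 := b3 f M H α h0 h1.le hH hM hf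
  have k4 := b4 f M H α h0 h1.le hH hM hf
  have D1 := II_fderiv (m := 1) (gau d) hfc hM (by norm_num) k0 (by norm_num) k1
  have D2 := II_fderiv (m := 1 - 1) (DS (gau d)) hfc hM (by norm_num) k1 (by linarith) k2
  have g0 := hA 1; have g1 := hA 0; have g2 := hA (α - 1)
  refine ⟨fun x => HasFDerivAt.const_smul (𝕜 := ℝ) (D1 x) ((cg d)⁻¹), fun x => HasFDerivAt.const_smul (𝕜 := ℝ) (D2 x).neg ((cg d)⁻¹), fun x => ?_, fun x => ?_,
    fun x => ?_, fun x _ y _ => ?_, fun x => ?_⟩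
  · have := II_norm (m := 1) (gau d) x (by norm_num) (k0 x)
    rw [add_zero] at this
    rw [← Real.norm_eq_abs, Res, norm_smul, Real.norm_of_nonneg hci, mul_assoc]
    gcongr
    refine this.trans ?_
    rw [show C0 * M * A 1 = (C0 * A 1) * M by ring]
    gcongr
    nlinarith [mul_nonneg hC1 g1, mul_nonneg hC2 g2]
  · have := II_norm (m := 1 - 1) (DS (gau d)) x (by norm_num) (k1 x)
    rw [add_zero, sub_self] at this
    rw [Res1, norm_smul, norm_neg, Real.norm_of_nonneg hci, mul_assoc, sub_self]
    gcongr
    refine this.trans ?_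
    rw [show C1 * M * A 0 = (C1 * A 0) * M by ring]
    gcongr
    nlinarith [mul_nonneg hC0 g0, mul_nonneg hC2 g2]
  · have := II_norm (m := 1 - 1 - 1) (DS (DS (gau d))) x (by linarith) (k2 x)
    rw [Res2, norm_smul, norm_neg, norm_neg, Real.norm_of_nonneg hci, mul_assoc]
    gcongr
    refine this.trans ?_
    rw [show (1:ℝ) - 1 - 1 + α = α - 1 by ring, show C2 * H * A (α - 1) = (C2 * A (α - 1)) * H by ring]
    gcongr
    nlinarith [mul_nonneg hC0 g0, mul_nonneg hC1 g1]
  · have := II_hol h0 h1 (DS (DS (gau d))) hfc hM (K := (C2 + C3) * H) (by positivity)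
      (fun x s hs => (k2 x s hs).trans (by gcongr; linarith)) (fun x s hs => (k3 x s hs).trans (by gcongr; linarith))
      x trivial y trivial
    rw [Res2, Res2, neg_neg, neg_neg, ← smul_sub, norm_smul, Real.norm_of_nonneg hci, mul_assoc, mul_assoc]
    gcongr
    rw [show (1:ℝ) - 1 - 1 = -1 by ring]
    refine this.trans ?_
    rw [show (C2 + C3) * H * (2 / α + 1 / (1 - α)) * ‖x - y‖ ^ α = B * (H * ‖x - y‖ ^ α) by ring]
    gcongr
    nlinarith [mul_nonneg hC0 g0, mul_nonneg hC1 g1, mul_nonneg hC2 g2]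
  · have hJtr : ∀ s > 0, (d:ℝ) • J (gau d) f x s + J (fun z => DS (gau d) z z) f x s
        = - trE (J (DS (DS (gau d))) f x s) := by
      intro s hs
      have i0 := J_int (gau d) hfc hM x s
      have i2 := J_int (DS (DS (gau d))) hfc hM x s
      have i3 := (trE (d := d)).integrable_comp i2
      rw [J, J, J, ← ContinuousLinearMap.integral_comp_comm _ i2, ← integral_neg, ← integral_smul]
      have e : ∀ z, f (x + s • z) • DS (gau d) z z = - trE (f (x + s • z) • DS (DS (gau d)) z) -
          (d:ℝ) • (f (x + s • z) • gau d z) := fun z => by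
        have := gau_tr z
        rw [map_smul]; simp only [smul_eq_mul]; linear_combination f (x + s • z) * this
      simp_rw [e]
      have i4 : Integrable fun z => (d:ℝ) • (f (x + s • z) • gau d z) := i0.smul (d:ℝ)
      have i5 : Integrable fun z => - trE (f (x + s • z) • DS (DS (gau d)) z) := i3.neg
      rw [integral_sub i5 i4]; ring
    have ji := II_int (m := 1 - 1 - 1) (DS (DS (gau d))) hfc hM x (by linarith) (k2 x)
    have ji0 := II_int (m := 1) (gau d) hfc hM x (by norm_num) (k0 x)
    have ji' := (trE (d := d)).integrable_comp ji
    set φ : ℝ → ℝ := fun s => Real.exp (-(1/2) * s ^ 2) * J (gau d) f x s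
    have dφ : ∀ s ∈ Ioi (0:ℝ), HasDerivAt φ (trE ((s ^ (1-1-1:ℝ) * Real.exp (-(1/2) * s ^ 2)) • J (DS (DS (gau d))) f x s) -
        (s ^ (1:ℝ) * Real.exp (-(1/2) * s ^ 2)) • J (gau d) f x s) s := by
      intro s hs
      have hs' : 0 < s := hs
      have a1 := J_sderiv (gau d) hfc hM x hs'
      have a2 : HasDerivAt (fun s : ℝ => Real.exp (-(1/2) * s ^ 2)) (Real.exp (-(1/2) * s ^ 2) * (-(1/2) * (2 * s))) s := by
        have := ((hasDerivAt_pow 2 s).const_mul (-(1/2) : ℝ)).exp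
        simpa using this
      refine (a2.mul a1).congr_deriv ?_
      rw [hJtr s hs', map_smul, show (1:ℝ)-1-1 = -1 by ring, Real.rpow_neg_one, Real.rpow_one]
      simp only [smul_eq_mul]; ring
    have lim0 : Tendsto φ (𝓝[>] 0) (𝓝 (1 * (f x * cg d))) := by
      refine Tendsto.mul ?_ ?_
      · have : Continuous fun s : ℝ => Real.exp (-(1/2) * s ^ 2) := by fun_prop
        have := this.tendsto 0
        rw [show (-(1/2) * (0:ℝ) ^ 2) = 0 by norm_num, Real.exp_zero] at this
        exact this.mono_left nhdsWithin_le_nhds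
      · rw [tendsto_iff_norm_sub_tendsto_zero]
        have : ContinuousAt (fun s : ℝ => C4 * H * s ^ α) 0 :=
          continuousAt_const.mul (Real.continuousAt_rpow_const _ _ (Or.inr h0.le))
        have := this.tendsto
        simp only [Real.zero_rpow h0.ne', mul_zero] at this
        refine squeeze_zero' (Eventually.of_forall fun _ => norm_nonneg _) ?_ (this.mono_left nhdsWithin_le_nhds)
        filter_upwards [self_mem_nhdsWithin] with s hs using k4 x s hs
    have limT : Tendsto φ atTop (𝓝 0) := by
      have e1 : Tendsto (fun s : ℝ => C0 * M * Real.exp (-s)) atTop (𝓝 0) := by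
        have := (Real.tendsto_exp_neg_atTop_nhds_zero).const_mul (C0 * M); simpa using this
      refine squeeze_zero_norm' ?_ e1
      filter_upwards [eventually_ge_atTop 2] with s hs
      rw [norm_mul, Real.norm_of_nonneg (Real.exp_pos _).le, mul_comm]
      refine mul_le_mul (b0 f M hM x s) (Real.exp_le_exp.2 (by nlinarith)) (Real.exp_pos _).le (by positivity)
    have hφ0 : φ 0 = 1 * (f x * cg d) := by
      simp [φ, J, cg, integral_const_mul]
    have hcont : ContinuousWithinAt φ (Ici 0) 0 := by
      rw [← continuousWithinAt_Ioi_iff_Ici, ContinuousWithinAt, hφ0]; exact lim0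
    have key := integral_Ioi_of_hasDerivAt_of_tendsto hcont dφ (ji'.sub ji0) limT
    rw [integral_sub ji' ji0, ContinuousLinearMap.integral_comp_comm _ ji, hφ0] at key
    rw [Res, Res2, neg_neg, map_smul, ← smul_sub, smul_eq_mul]
    change trE (II (1-1-1) (DS (DS (gau d))) f x) - II 1 (gau d) f x = _ at key
    rw [show II 1 (gau d) f x - trE (II (1-1-1) (DS (DS (gau d))) f x) = f x * cg d by linarith]
    field_simp
end

section
open MeasureTheory Set Filter Topology
open scoped SchwartzMap ContDiff

open scoped SI
set_option linter.unusedSectionVars false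
variable {d : ℕ} {F : Type} [NormedAddCommGroup F] [NormedSpace ℝ F]

abbrev D1 (d : ℕ) := E1 d →L[ℝ] ℝ
abbrev D2 (d : ℕ) := E2 d →L[ℝ] ℝ

namespace SI
section
variable (d : ℕ)
scoped instance si_r0 : NormedAddCommGroup (D1 d) := inferInstance
scoped instance si_r1 : SeminormedAddCommGroup (D1 d) := inferInstance
scoped instance si_r2 : SeminormedAddGroup (D1 d) := inferInstance
scoped instance si_r3 : AddCommGroup (D1 d) := inferInstance
scoped instance si_r4 : AddGroup (D1 d) := inferInstance
scoped instance si_r5 : AddCommMonoid (D1 d) := inferInstance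
scoped instance si_r6 : AddMonoid (D1 d) := inferInstance
scoped instance si_r7 : AddZeroClass (D1 d) := inferInstance
scoped instance si_r8 : NormedSpace ℝ (D1 d) := inferInstance
scoped instance si_r9 : Module ℝ (D1 d) := inferInstance
scoped instance si_r10 : MulAction ℝ (D1 d) := inferInstance
scoped instance si_r11 : SMulZeroClass ℝ (D1 d) := inferInstance
scoped instance si_r12 : DistribSMul ℝ (D1 d) := inferInstance
scoped instance si_r13 : SMul ℝ (D1 d) := inferInstance
scoped instance si_r14 : Norm (D1 d) := inferInstance
scoped instance si_r15 : Zero (D1 d) := inferInstance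
scoped instance si_r16 : Add (D1 d) := inferInstance
scoped instance si_s0 : NormedAddCommGroup (D2 d) := inferInstance
scoped instance si_s1 : SeminormedAddCommGroup (D2 d) := inferInstance
scoped instance si_s2 : SeminormedAddGroup (D2 d) := inferInstance
scoped instance si_s3 : AddCommGroup (D2 d) := inferInstance
scoped instance si_s4 : AddGroup (D2 d) := inferInstance
scoped instance si_s5 : AddCommMonoid (D2 d) := inferInstance
scoped instance si_s6 : AddMonoid (D2 d) := inferInstance
scoped instance si_s7 : AddZeroClass (D2 d) := inferInstance
scoped instance si_s8 : NormedSpace ℝ (D2 d) := inferInstance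
scoped instance si_s9 : Module ℝ (D2 d) := inferInstance
scoped instance si_s10 : MulAction ℝ (D2 d) := inferInstance
scoped instance si_s11 : SMulZeroClass ℝ (D2 d) := inferInstance
scoped instance si_s12 : DistribSMul ℝ (D2 d) := inferInstance
scoped instance si_s13 : SMul ℝ (D2 d) := inferInstance
scoped instance si_s14 : Norm (D2 d) := inferInstance
scoped instance si_s15 : Zero (D2 d) := inferInstance
scoped instance si_s16 : Add (D2 d) := inferInstance
end
end SI
open scoped SI
instance : NormedAddCommGroup (D1 d) := inferInstance
instance : NormedSpace ℝ (D1 d) := inferInstance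
instance : NormSMulClass ℝ (D1 d) := NormedSpace.toNormSMulClass
instance : NormedAddCommGroup (D2 d) := inferInstance
instance : NormedSpace ℝ (D2 d) := inferInstance
instance : NormSMulClass ℝ (D2 d) := NormedSpace.toNormSMulClass

/-- `u` is twice differentiable on `U` with derivatives `u1`, `u2` -/
def IsC2 (u : EE d → ℝ) (u1 : EE d → E1 d) (u2 : EE d → E2 d) (U : Set (EE d)) : Prop :=
  ∀ x ∈ U, HasFDerivAt u (u1 x) x ∧ HasFDerivAt u1 (u2 x) x

/-- the operator -/
def Lop (A : D2 d) (B : D1 d) (g : ℝ) (T : E2 d) (p : E1 d) (r : ℝ) : ℝ := -A T + B p + g * r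

/-- ellipticity -/
def Ell (m : ℝ) (A : D2 d) : Prop := ∃ M : EE d ≃L[ℝ] EE d, A = QM (M : EE d →L[ℝ] EE d) ∧
  ‖(M : EE d →L[ℝ] EE d)‖ ≤ m ∧ ‖(M.symm : EE d →L[ℝ] EE d)‖ ≤ m

lemma IsC2.line {u : EE d → ℝ} {u1 u2} {U : Set (EE d)} (h : IsC2 u u1 u2 U) (x v : EE d) (t : ℝ) (ht : x + t • v ∈ U) :
    HasDerivAt (fun t : ℝ => u (x + t • v)) (u1 (x + t • v) v) t ∧
    HasDerivAt (fun t : ℝ => u1 (x + t • v) v) (u2 (x + t • v) v v) t := by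
  have e : HasDerivAt (fun t : ℝ => x + t • v) v t := by
    simpa using ((hasDerivAt_id t).smul_const v).const_add x
  obtain ⟨h1, h2⟩ := h _ ht
  exact ⟨h1.comp_hasDerivAt t e, by
    have := (h2.comp_hasDerivAt t e).clm_apply (hasDerivAt_const t v); simpa using this⟩

lemma IsC2.localMax {u : EE d → ℝ} {u1 u2} {U : Set (EE d)} (h : IsC2 u u1 u2 U) (hU : IsOpen U) {x : EE d} (hx : x ∈ U)
    (hm : IsLocalMax u x) : u1 x = 0 ∧ ∀ v, u2 x v v ≤ 0 := by
  have h0 : u1 x = 0 := hm.hasFDerivAt_eq_zero (h x hx).1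
  refine ⟨h0, fun v => ?_⟩
  by_contra! hc
  set φ : ℝ → ℝ := fun t => u (x + t • v)
  have hc0 : Continuous fun t : ℝ => x + t • v := by fun_prop
  have hn : ∀ᶠ t in 𝓝 (0:ℝ), x + t • v ∈ U := hc0.continuousAt.eventually_mem (by simpa using hU.mem_nhds hx)
  have hd : deriv φ =ᶠ[𝓝 0] fun t => u1 (x + t • v) v := by
    filter_upwards [hn] with t ht using (h.line x v t ht).1.deriv
  have hd0 : deriv φ 0 = 0 := by rw [hd.self_of_nhds]; simp [h0]
  have hdd : deriv (deriv φ) 0 = u2 x v v := by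
    rw [hd.deriv_eq, (h.line x v 0 (by simpa using hx)).2.deriv]; simp
  have h1 : IsLocalMin φ 0 := isLocalMin_of_deriv_deriv_pos (by rwa [hdd]) hd0
    ((h.line x v 0 (by simpa using hx)).1.continuousAt)
  have h2 : IsLocalMax φ 0 := by
    have : Tendsto (fun t : ℝ => x + t • v) (𝓝 0) (𝓝 x) := by simpa using hc0.tendsto 0
    filter_upwards [this.eventually hm] with t ht
    simpa [φ] using ht
  have h3 : φ =ᶠ[𝓝 0] fun _ => φ 0 := by
    filter_upwards [h1, h2] with t a b using le_antisymm b a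
  have h4 : deriv φ =ᶠ[𝓝 0] fun _ => 0 := by
    have := h3.deriv; simpa using this
  have : deriv (deriv φ) 0 = 0 := by rw [h4.deriv_eq]; simp
  linarith

lemma QM_nonpos (M : EE d →L[ℝ] EE d) {T : E2 d} (h : ∀ v, T v v ≤ 0) : QM M T ≤ 0 := by
  rw [QM_apply]; exact Finset.sum_nonpos fun k _ => h _

lemma norm_eb (k : Fin d) : ‖(eb k : EE d)‖ = 1 := by simp [eb, Pi.norm_single]

lemma QM_le (M : EE d →L[ℝ] EE d) {m : ℝ} (hM : ‖M‖ ≤ m) (T : E2 d) : |QM M T| ≤ d * m ^ 2 * ‖T‖ := by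
  have hm : 0 ≤ m := (norm_nonneg _).trans hM
  rw [QM_apply]
  refine (Finset.abs_sum_le_sum_abs _ _).trans ?_
  calc _ ≤ ∑ k : Fin d, m ^ 2 * ‖T‖ := Finset.sum_le_sum fun k _ => by
        refine (T.le_opNorm₂ _ _).trans ?_
        have : ‖M (eb k)‖ ≤ m := (M.le_opNorm _).trans (by rw [norm_eb, mul_one]; exact hM)
        rw [mul_assoc, mul_comm]; 
        gcongr; nlinarith [norm_nonneg (M (eb k))]
    _ = _ := by simp; ring

lemma isC2_ell : IsC2 (fun x : EE d => ell x x) (fun x => (2:ℝ) • ell x) (fun _ => (2:ℝ) • ell) univ :=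
  fun x _ => ⟨ell_fderiv x, ((2:ℝ) • ell (d := d)).hasFDerivAt⟩

lemma IsC2.add {u v : EE d → ℝ} {u1 u2 v1 v2} {U : Set (EE d)} (h : IsC2 u u1 u2 U) (h' : IsC2 v v1 v2 U) :
    IsC2 (fun x => u x + v x) (fun x => u1 x + v1 x) (fun x => u2 x + v2 x) U :=
  fun x hx => ⟨(h x hx).1.add (h' x hx).1, (h x hx).2.add (h' x hx).2⟩

lemma IsC2.smul {u : EE d → ℝ} {u1 u2} {U : Set (EE d)} (h : IsC2 u u1 u2 U) (c : ℝ) :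
    IsC2 (fun x => c * u x) (fun x => c • u1 x) (fun x => c • u2 x) U :=
  fun x hx => ⟨(h x hx).1.const_mul c, HasFDerivAt.const_smul (𝕜 := ℝ) (h x hx).2 c⟩

lemma Lop_add (A : D2 d) (B : D1 d) (g : ℝ) (T T' p p' r r') :
    Lop A B g (T + T') (p + p') (r + r') = Lop A B g T p r + Lop A B g T' p' r' := by
  simp only [Lop, map_add]; ring

lemma Lop_smul (A : D2 d) (B : D1 d) (g c : ℝ) (T p r) :
    Lop A B g (c • T) (c • p) (c * r) = c * Lop A B g T p r := by
  simp only [Lop, map_smul, smul_eq_mul]; ring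

theorem maxP {u : EE d → ℝ} {u1 u2} (h : IsC2 u u1 u2 univ) {K m β ε N : ℝ} (hK : ∀ x, u x ≤ K)
    {A : EE d → D2 d} {B : EE d → D1 d} {g : EE d → ℝ} (hA : ∀ x, Ell m (A x)) (hB : ∀ x, ‖B x‖ ≤ β)
    (hε : 0 < ε) (hg : ∀ x, ε ≤ g x) (hN : 0 ≤ N)
    (hL : ∀ x, Lop (A x) (B x) (g x) (u2 x) (u1 x) (u x) ≤ N) (x₀ : EE d) : ε * u x₀ ≤ N := by
  set c1 := d * m ^ 2 * ‖(2:ℝ) • ell (d := d)‖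
  set c2 := β * ‖(2:ℝ) • ell (d := d)‖
  have hβ : 0 ≤ β := (norm_nonneg _).trans (hB 0)
  have hc1 : 0 ≤ c1 := by positivity
  have key : ∀ τ > 0, ε * u x₀ ≤ N + τ * (c1 + c2 ^ 2 / (4 * ε) + ε * ell x₀ x₀) := by
    intro τ hτ
    have hq := h.add (isC2_ell.smul (-τ))
    have hcont : Continuous fun x => u x + -τ * ell x x :=
      continuous_iff_continuousAt.2 fun x => (hq x trivial).1.continuousAt
    have hlim : Tendsto (fun x : EE d => u x + -τ * ell x x) (cocompact (EE d)) atBot := by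
      have : Tendsto (fun x : EE d => τ * ‖x‖ ^ 2) (cocompact (EE d)) atTop :=
        ((tendsto_pow_atTop two_ne_zero).comp tendsto_norm_cocompact_atTop).const_mul_atTop hτ
      refine tendsto_atBot_mono (fun x => ?_) (tendsto_atBot_add_const_left _ K (tendsto_neg_atTop_atBot.comp this))
      have := hK x; have := sq_le_ell x
      simp only [Function.comp_apply]; linarith [mul_le_mul_of_nonneg_left (sq_le_ell x) hτ.le]
    obtain ⟨y, hy⟩ := hcont.exists_forall_ge hlim
    obtain ⟨e1, e2⟩ := hq.localMax isOpen_univ (mem_univ y) (Eventually.of_forall hy)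
    obtain ⟨M, hAM, hM, -⟩ := hA y
    have e3 : A y (u2 y + -τ • (2:ℝ) • ell) ≤ 0 := by rw [hAM]; exact QM_nonpos _ e2
    have e4 : B y (u1 y + -τ • (2:ℝ) • ell y) = 0 := by rw [e1]; simp
    have e5 := hL y
    rw [map_add, map_smul, smul_eq_mul] at e3 e4
    rw [Lop] at e5
    have e6 : A y ((2:ℝ) • ell) ≤ c1 := by rw [hAM]; exact (le_abs_self _).trans (QM_le _ hM _)
    have e7 : -(B y ((2:ℝ) • ell y)) ≤ c2 * ‖y‖ := by
      refine (neg_le_abs _).trans ?_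
      have a1 := (B y).le_opNorm ((2:ℝ) • ell y)
      have a2 := ((2:ℝ) • ell (d := d)).le_opNorm y
      rw [Real.norm_eq_abs] at a1
      refine a1.trans ?_
      rw [mul_assoc]; exact mul_le_mul (hB y) a2 (norm_nonneg _) hβ
    have e8 : g y * u y ≤ N + τ * (c1 + c2 * ‖y‖) := by linarith [mul_le_mul_of_nonneg_left e6 hτ.le, mul_le_mul_of_nonneg_left e7 hτ.le]
    have e9 := hy x₀
    have e10 := sq_le_ell y
    rcases lt_or_ge (u y) 0 with hu | hu
    · have : u x₀ ≤ τ * ell x₀ x₀ := by linarith [mul_nonneg hτ.le ((sq_nonneg _).trans e10)]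
      have t1 : 0 ≤ c2 ^ 2 / (4 * ε) := by positivity
      have : ε * u x₀ ≤ ε * (τ * ell x₀ x₀) := by gcongr
      linarith [mul_nonneg hτ.le t1, mul_nonneg hτ.le hc1]
    · have f1 : ε * u y ≤ N + τ * (c1 + c2 * ‖y‖) := le_trans (by gcongr; exact hg y) e8
      have f2 : c2 * ‖y‖ - ε * ‖y‖ ^ 2 ≤ c2 ^ 2 / (4 * ε) := by
        rw [le_div_iff₀ (by positivity)]; nlinarith [sq_nonneg (c2 - 2 * ε * ‖y‖)]
      have f3 : ε * (u x₀ + -τ * ell x₀ x₀) ≤ ε * (u y + -τ * ell y y) := by gcongr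
      have f4 : ε * τ * ‖y‖ ^ 2 ≤ ε * τ * ell y y := by gcongr
      linarith [mul_le_mul_of_nonneg_left f2 hτ.le]
  have : Tendsto (fun τ : ℝ => N + τ * (c1 + c2 ^ 2 / (4 * ε) + ε * ell x₀ x₀)) (𝓝[>] 0) (𝓝 N) := by
    have : Continuous fun τ : ℝ => N + τ * (c1 + c2 ^ 2 / (4 * ε) + ε * ell x₀ x₀) := by fun_prop
    have := this.tendsto 0
    simp only [zero_mul, add_zero] at this
    exact this.mono_left nhdsWithin_le_nhds
  exact ge_of_tendsto this (by filter_upwards [self_mem_nhdsWithin] with τ hτ using key τ hτ)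

theorem maxP_abs {u : EE d → ℝ} {u1 u2} (h : IsC2 u u1 u2 univ) {K m β ε N : ℝ} (hK : ∀ x, |u x| ≤ K)
    {A : EE d → D2 d} {B : EE d → D1 d} {g : EE d → ℝ} (hA : ∀ x, Ell m (A x)) (hB : ∀ x, ‖B x‖ ≤ β)
    (hε : 0 < ε) (hg : ∀ x, ε ≤ g x) (hN : 0 ≤ N)
    (hL : ∀ x, |Lop (A x) (B x) (g x) (u2 x) (u1 x) (u x)| ≤ N) (x₀ : EE d) : ε * |u x₀| ≤ N := by
  rw [← abs_of_pos hε, ← abs_mul, abs_le']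
  refine ⟨maxP h (fun x => (abs_le.1 (hK x)).2) hA hB hε hg hN (fun x => (abs_le.1 (hL x)).2) x₀, ?_⟩
  have := maxP (h.smul (-1)) (K := K) (fun x => by linarith [(abs_le.1 (hK x)).1]) hA hB hε hg hN
    (fun x => by rw [Lop_smul]; linarith [(abs_le.1 (hL x)).1]) x₀
  linarith

lemma Ell_tr : Ell 1 (trE (d := d)) :=
  ⟨ContinuousLinearEquiv.refl ℝ _, rfl, ContinuousLinearMap.norm_id_le, ContinuousLinearMap.norm_id_le⟩

lemma Ell.mono {m m' : ℝ} {A : D2 d} (h : Ell m A) (hm : m ≤ m') : Ell m' A := by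
  obtain ⟨M, h1, h2, h3⟩ := h; exact ⟨M, h1, h2.trans hm, h3.trans hm⟩

lemma Ell.norm_le {m : ℝ} {A : D2 d} (h : Ell m A) : ‖A‖ ≤ d * m ^ 2 := by
  obtain ⟨M, h1, h2, h3⟩ := h
  refine ContinuousLinearMap.opNorm_le_bound _ (by positivity) fun T => ?_
  rw [h1]; exact QM_le _ h2 T
end

section
open MeasureTheory Set Filter Topology
open scoped SchwartzMap ContDiff

open scoped SI
set_option linter.unusedSectionVars false
variable {d : ℕ} {F : Type} [NormedAddCommGroup F] [NormedSpace ℝ F]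

/-- precomposition on `E1` -/
def preM (M : EE d →L[ℝ] EE d) : E1 d →L[ℝ] E1 d := (ContinuousLinearMap.compL ℝ (EE d) (EE d) ℝ).flip M

lemma preM_apply (M : EE d →L[ℝ] EE d) (p : E1 d) (v : EE d) : preM M p v = p (M v) := rfl

/-- pull-back of a bilinear form -/
def pull (M : EE d →L[ℝ] EE d) (T : E2 d) : E2 d := (preM M).comp (T.comp M)

lemma pull_apply (M : EE d →L[ℝ] EE d) (T : E2 d) (v w : EE d) : pull M T v w = T (M v) (M w) := rfl

lemma pull_norm (M : EE d →L[ℝ] EE d) {m : ℝ} (hM : ‖M‖ ≤ m) (T : E2 d) : ‖pull M T‖ ≤ m ^ 2 * ‖T‖ := by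
  have hm : 0 ≤ m := (norm_nonneg _).trans hM
  refine ContinuousLinearMap.opNorm_le_bound₂ _ (by positivity) fun v w => ?_
  rw [pull_apply]
  have h1 : ‖M v‖ ≤ m * ‖v‖ := M.le_of_opNorm_le hM v
  have h2 : ‖M w‖ ≤ m * ‖w‖ := M.le_of_opNorm_le hM w
  calc _ ≤ ‖T‖ * ‖M v‖ * ‖M w‖ := T.le_opNorm₂ _ _
    _ ≤ ‖T‖ * (m * ‖v‖) * (m * ‖w‖) := by gcongr
    _ = _ := by ring

lemma pull_sub (M : EE d →L[ℝ] EE d) (T S : E2 d) : pull M (T - S) = pull M T - pull M S := by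
  ext v w; simp [pull_apply]

lemma IsC2.comp_lin {u : EE d → ℝ} {u1 u2} (h : IsC2 u u1 u2 univ) (M : EE d →L[ℝ] EE d) :
    IsC2 (fun x => u (M x)) (fun x => preM M (u1 (M x))) (fun x => pull M (u2 (M x))) univ := by
  intro x _
  obtain ⟨h1, h2⟩ := h (M x) trivial
  exact ⟨h1.comp x M.hasFDerivAt, (preM M).hasFDerivAt.comp x (h2.comp x M.hasFDerivAt)⟩

lemma IsC2.unique {u : EE d → ℝ} {u1 u2 v1 v2} {U : Set (EE d)} (hU : IsOpen U) (h : IsC2 u u1 u2 U) (h' : IsC2 u v1 v2 U) :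
    ∀ x ∈ U, u1 x = v1 x ∧ u2 x = v2 x := by
  have e : ∀ x ∈ U, u1 x = v1 x := fun x hx => (h x hx).1.unique (h' x hx).1
  refine fun x hx => ⟨e x hx, (h x hx).2.unique ((h' x hx).2.congr_of_eventuallyEq ?_)⟩
  filter_upwards [hU.mem_nhds hx] with y hy using e y hy

lemma Hol.sub {α C C' : ℝ} {f g : EE d → F} {S : Set (EE d)} (h : Hol α C f S) (h' : Hol α C' g S) :
    Hol α (C + C') (fun x => f x - g x) S := fun x hx y hy => by
  have e : f x - g x - (f y - g y) = (f x - f y) - (g x - g y) := by abel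
  rw [e, add_mul]; exact (norm_sub_le _ _).trans (add_le_add (h x hx y hy) (h' x hx y hy))

lemma Hol.comp_lin {α C m : ℝ} (h0 : 0 < α) (h1 : α < 1) (hC : 0 ≤ C) {f : EE d → F} (h : Hol α C f univ) (M : EE d →L[ℝ] EE d)
    (hM : ‖M‖ ≤ m) (hm : 1 ≤ m) : Hol α (m * C) (fun x => f (M x)) univ := fun x _ y _ => by
  have e : ‖M x - M y‖ ≤ m * ‖x - y‖ := by rw [← map_sub]; exact M.le_of_opNorm_le hM _
  calc _ ≤ C * ‖M x - M y‖ ^ α := h _ trivial _ trivial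
    _ ≤ C * (m * ‖x - y‖) ^ α := by gcongr
    _ = C * m ^ α * ‖x - y‖ ^ α := by rw [Real.mul_rpow (by linarith) (norm_nonneg _)]; ring
    _ ≤ C * m ^ (1:ℝ) * ‖x - y‖ ^ α := by gcongr <;> linarith
    _ = _ := by rw [Real.rpow_one]; ring

theorem frozen {α m : ℝ} (h0 : 0 < α) (h1 : α < 1) (hm : 1 ≤ m) : ∃ C, 0 ≤ C ∧ ∀ (A0 : D2 d), Ell m A0 →
    ∀ (v : EE d → ℝ) v1 v2 (K HA H0 : ℝ), IsC2 v v1 v2 univ → (∀ x, |v x| ≤ K) → (∀ x, |A0 (v2 x)| ≤ K) → 0 ≤ HA → 0 ≤ H0 →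
    Hol α HA (fun x => A0 (v2 x)) univ → Hol α H0 v univ → Hol α (C * (HA + H0)) v2 univ := by
  obtain ⟨C, hC, hR⟩ := res_main (d := d) h0 h1
  refine ⟨m ^ 4 * C, by positivity, ?_⟩
  rintro A0 ⟨M, rfl, hM, hM'⟩ v v1 v2 K HA H0 hv hK hK2 hHA hH0 hA hH
  set M₁ := (M : EE d →L[ℝ] EE d)
  set M₂ := (M.symm : EE d →L[ℝ] EE d)
  have hw := hv.comp_lin M₁
  set f : EE d → ℝ := fun x => v (M₁ x) - QM M₁ (v2 (M₁ x)) with hf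
  have htr : ∀ T, trE (pull M₁ T) = QM M₁ T := fun T => by simp [QM_apply, pull_apply]
  have hfH : Hol α (m * H0 + m * HA) f univ :=
    (hH.comp_lin h0 h1 hH0 M₁ hM hm).sub (hA.comp_lin h0 h1 hHA M₁ hM hm)
  obtain ⟨r1, r2, r3, -, -, r6, r7⟩ := hR f (K + K) (m * H0 + m * HA) (by positivity)
    (fun x => (abs_sub _ _).trans (add_le_add (hK _) (hK2 _))) hfH
  have hr : IsC2 (Res f) (Res1 f) (Res2 f) univ := fun x _ => ⟨r1 x, r2 x⟩
  have hz := hw.add (hr.smul (-1))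
  have heq : (fun x => v (M₁ x)) = Res f := by
    funext x
    have := maxP_abs (ε := 1) (N := 0) (m := 1) (β := 0) (K := K + C * (K + K)) (A := fun _ => trE) (B := fun _ => 0) (g := fun _ => 1) hz
      (fun x => (abs_add_le _ _).trans (add_le_add (hK _) (by simpa using r3 x))) (fun _ => Ell_tr) (by simp) one_pos
      (fun _ => le_rfl) le_rfl (fun x => by
        have := r7 x
        rw [Lop, map_add, map_smul, htr, smul_eq_mul]
        simp only [zero_apply, abs_nonpos_iff]
        simp only [hf] at this
        linarith) x
    rw [one_mul] at this; have h2 := abs_nonpos_iff.1 this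
    linarith
  rw [← heq] at hr
  have hp : ∀ x, v2 x = pull M₂ (Res2 f (M₂ x)) := fun x => by
    rw [← (IsC2.unique isOpen_univ hw hr (M₂ x) trivial).2]
    ext a b; simp [pull_apply, M₁, M₂]
  intro x _ y _
  rw [hp, hp, ← pull_sub]
  have r8 := (r6.comp_lin h0 h1 (by positivity) M₂ hM' hm) x trivial y trivial
  refine (pull_norm M₂ hM' _).trans ((mul_le_mul_of_nonneg_left r8 (by positivity)).trans (le_of_eq ?_))
  ring
end

section
open MeasureTheory Set Filter Topology
open scoped SchwartzMap ContDiff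

open scoped SI
set_option linter.unusedSectionVars false
variable {d : ℕ} {F : Type} [NormedAddCommGroup F] [NormedSpace ℝ F]
  {G H : Type} [NormedAddCommGroup G] [NormedAddCommGroup H]

/-- bounded and Hölder with the same constant -/
def Sz (α K : ℝ) (f : EE d → F) (S : Set (EE d)) : Prop := (∀ x ∈ S, ‖f x‖ ≤ K) ∧ Hol α K f S

lemma Hol.mono {α C C' : ℝ} {f : EE d → F} {S : Set (EE d)} (h : Hol α C f S) (hC : C ≤ C') : Hol α C' f S :=
  fun x hx y hy => (h x hx y hy).trans (by gcongr)

lemma Hol.subset {α C : ℝ} {f : EE d → F} {S T : Set (EE d)} (h : Hol α C f S) (hT : T ⊆ S) : Hol α C f T :=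
  fun x hx y hy => h x (hT hx) y (hT hy)

lemma Sz.mono {α C C' : ℝ} {f : EE d → F} {S : Set (EE d)} (h : Sz α C f S) (hC : C ≤ C') : Sz α C' f S :=
  ⟨fun x hx => (h.1 x hx).trans hC, h.2.mono hC⟩

lemma Sz.subset {α C : ℝ} {f : EE d → F} {S T : Set (EE d)} (h : Sz α C f S) (hT : T ⊆ S) : Sz α C f T :=
  ⟨fun x hx => h.1 x (hT hx), h.2.subset hT⟩

lemma Sz.congr {α C : ℝ} {f g : EE d → F} {S : Set (EE d)} (h : Sz α C f S) (he : ∀ x ∈ S, g x = f x) : Sz α C g S :=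
  ⟨fun x hx => by rw [he x hx]; exact h.1 x hx, fun x hx y hy => by rw [he x hx, he y hy]; exact h.2 x hx y hy⟩

lemma Sz.add {α C C' : ℝ} {f g : EE d → F} {S : Set (EE d)} (h : Sz α C f S) (h' : Sz α C' g S) :
    Sz α (C + C') (fun x => f x + g x) S := by
  refine ⟨fun x hx => (norm_add_le _ _).trans (add_le_add (h.1 x hx) (h'.1 x hx)), fun x hx y hy => ?_⟩
  have e : f x + g x - (f y + g y) = (f x - f y) + (g x - g y) := by abel
  rw [e, add_mul]; exact (norm_add_le _ _).trans (add_le_add (h.2 x hx y hy) (h'.2 x hx y hy))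

lemma Sz.sub {α C C' : ℝ} {f g : EE d → F} {S : Set (EE d)} (h : Sz α C f S) (h' : Sz α C' g S) :
    Sz α (C + C') (fun x => f x - g x) S :=
  ⟨fun x hx => (norm_sub_le _ _).trans (add_le_add (h.1 x hx) (h'.1 x hx)), h.2.sub h'.2⟩

lemma Sz.lin {α C a : ℝ} {f : EE d → F} {S : Set (EE d)} (h : Sz α C f S) (ha : 0 ≤ a) (φ : F → ℝ)
    (h1 : ∀ p q, φ (p - q) = φ p - φ q) (h2 : ∀ p, ‖φ p‖ ≤ a * ‖p‖) : Sz α (a * C) (fun x => φ (f x)) S := by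
  refine ⟨fun x hx => (h2 _).trans (by gcongr; exact h.1 x hx), fun x hx y hy => ?_⟩
  rw [← h1, mul_assoc]; exact (h2 _).trans (by gcongr; exact h.2 x hx y hy)

lemma Sz.nonneg {α C : ℝ} {f : EE d → F} {S : Set (EE d)} (h : Sz α C f S) (hS : S.Nonempty) : 0 ≤ C :=
  (norm_nonneg _).trans (h.1 _ hS.choose_spec)

/-- product lemma with extension by zero -/
lemma Sz.bil {α K L c : ℝ} {f : EE d → F} {g : EE d → G} {S T : Set (EE d)} (hf : Sz α L f T) (hg : Sz α K g S)
    (hc : 0 ≤ c) (hK : 0 ≤ K) (hL : 0 ≤ L) (hS : ∀ x ∈ T, x ∉ S → f x = 0) (op : F → G → H)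
    (o1 : ∀ p p' q, op (p - p') q = op p q - op p' q)
    (o2 : ∀ p q q', op p (q - q') = op p q - op p q') (o3 : ∀ p q, ‖op p q‖ ≤ c * ‖p‖ * ‖q‖) :
    (∀ x ∈ T, ‖op (f x) (g x)‖ ≤ 2 * c * L * K) ∧
    ∀ x ∈ T, ∀ y ∈ T, ‖op (f x) (g x) - op (f y) (g y)‖ ≤ 2 * c * L * K * ‖x - y‖ ^ α := by
  have z : ∀ q, op 0 q = 0 := fun q => by simpa using o1 0 0 q
  have hLK : 0 ≤ c * L * K := by positivity
  have b : ∀ x ∈ T, ‖op (f x) (g x)‖ ≤ c * L * K := fun x hx => by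
    by_cases h : x ∈ S
    · exact (o3 _ _).trans (mul_le_mul (mul_le_mul_of_nonneg_left (hf.1 x hx) hc) (hg.1 x h) (norm_nonneg _) (by positivity))
    · rw [hS x hx h, z, norm_zero]; exact hLK
  refine ⟨fun x hx => (b x hx).trans (by linarith), fun x hx y hy => ?_⟩
  have r : 0 ≤ ‖x - y‖ ^ α := by positivity
  have k1 : ∀ z ∈ S, ‖op (f x - f y) (g z)‖ ≤ c * L * K * ‖x - y‖ ^ α := fun z hz => by
    refine (o3 _ _).trans ((mul_le_mul (mul_le_mul_of_nonneg_left (hf.2 x hx y hy) hc) (hg.1 z hz) (norm_nonneg _) (by positivity)).trans (le_of_eq ?_))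
    ring
  by_cases h : x ∈ S
  · by_cases h' : y ∈ S
    · have e : op (f x) (g x) - op (f y) (g y) = op (f x - f y) (g x) + op (f y) (g x - g y) := by
        rw [o1, o2]; abel
      rw [e]
      have k2 : ‖op (f y) (g x - g y)‖ ≤ c * L * K * ‖x - y‖ ^ α := by
        refine (o3 _ _).trans ((mul_le_mul (mul_le_mul_of_nonneg_left (hf.1 y hy) hc) (hg.2 x h y h') (norm_nonneg _) (by positivity)).trans (le_of_eq ?_))
        ring
      exact (norm_add_le _ _).trans ((add_le_add (k1 x h) k2).trans (le_of_eq (by ring)))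
    · have := k1 x h
      rw [o1, hS y hy h', z] at this
      rw [hS y hy h', z]; nlinarith
  · by_cases h' : y ∈ S
    · have := k1 y h'
      rw [o1, hS x hx h, z] at this
      rw [hS x hx h, z]; nlinarith
    · rw [hS x hx h, hS y hy h', z, z, sub_zero, norm_zero]; positivity

lemma Sz.smul {α K L : ℝ} {f : EE d → ℝ} {g : EE d → F} {S T : Set (EE d)} (hf : Sz α L f T) (hg : Sz α K g S)
    (hK : 0 ≤ K) (hL : 0 ≤ L) (hS : ∀ x ∈ T, x ∉ S → f x = 0) : Sz α (2 * L * K) (fun x => f x • g x) T := by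
  have := hf.bil hg (c := 1) zero_le_one hK hL hS (fun a b => a • b) (fun _ _ _ => sub_smul _ _ _) (fun _ _ _ => smul_sub _ _ _)
    (fun p q => by rw [norm_smul, one_mul])
  rw [mul_one] at this; exact this

/-- symmetric tensor -/
def sten (p q : E1 d) : E2 d := ContinuousLinearMap.smulRight p q + ContinuousLinearMap.smulRight q p

lemma sten_apply (p q : E1 d) (v w : EE d) : sten p q v w = p v * q w + q v * p w := by simp [sten]

lemma sten_norm (p q : E1 d) : ‖sten p q‖ ≤ 2 * ‖p‖ * ‖q‖ := by
  refine ContinuousLinearMap.opNorm_le_bound₂ _ (by positivity) fun v w => ?_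
  rw [sten_apply]
  have a1 := p.le_opNorm v; have a2 := p.le_opNorm w; have a3 := q.le_opNorm v; have a4 := q.le_opNorm w
  refine (norm_add_le _ _).trans ?_
  rw [norm_mul, norm_mul]
  calc _ ≤ (‖p‖ * ‖v‖) * (‖q‖ * ‖w‖) + (‖q‖ * ‖v‖) * (‖p‖ * ‖w‖) := by gcongr
    _ = _ := by ring

lemma sten_sub_left (p p' q : E1 d) : sten (p - p') q = sten p q - sten p' q := by
  ext v w; simp [sten_apply]; ring

lemma sten_sub_right (p q q' : E1 d) : sten p (q - q') = sten p q - sten p q' := by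
  ext v w; simp [sten_apply]; ring

lemma IsC2.mul {u v : EE d → ℝ} {u1 u2 v1 v2} {U : Set (EE d)} (h : IsC2 u u1 u2 U) (h' : IsC2 v v1 v2 U) :
    IsC2 (fun x => u x * v x) (fun x => u x • v1 x + v x • u1 x)
      (fun x => u x • v2 x + v x • u2 x + sten (u1 x) (v1 x)) U := by
  intro x hx
  obtain ⟨a1, a2⟩ := h x hx
  obtain ⟨b1, b2⟩ := h' x hx
  refine ⟨a1.mul b1, ?_⟩
  refine ((HasFDerivAt.smul (𝕜 := ℝ) a1 b2).add (HasFDerivAt.smul (𝕜 := ℝ) b1 a2)).congr_fderiv ?_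
  ext a b; simp [sten_apply]; ring

lemma lip_hol {α N K : ℝ} (h0 : 0 < α) (h1 : α < 1) {f : EE d → F} {S : Set (EE d)}
    (hN : ∀ x ∈ S, ‖f x‖ ≤ N) (hK : ∀ x ∈ S, ∀ y ∈ S, ‖f x - f y‖ ≤ K * ‖x - y‖) (hN0 : 0 ≤ N) (hK0 : 0 ≤ K) :
    Sz α (2 * N + K) f S := by
  refine ⟨fun x hx => (hN x hx).trans (by linarith), fun x hx y hy => ?_⟩
  rcases le_total ‖x - y‖ 1 with h | h
  · refine (hK x hx y hy).trans ?_
    rcases eq_or_lt_of_le (norm_nonneg (x - y)) with h2 | h2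
    · rw [← h2]; simp [Real.zero_rpow h0.ne']
    · have : ‖x - y‖ ≤ ‖x - y‖ ^ α := by
        conv_lhs => rw [← Real.rpow_one ‖x - y‖]
        exact Real.rpow_le_rpow_of_exponent_ge h2 h h1.le
      nlinarith
  · have : 1 ≤ ‖x - y‖ ^ α := Real.one_le_rpow h h0.le
    have e := (norm_sub_le (f x) (f y)).trans (add_le_add (hN x hx) (hN y hy))
    nlinarith

/-- cutoff -/
lemma exists_cut {α : ℝ} (h0 : 0 < α) (h1 : α < 1) : ∃ (η : EE d → ℝ) (η1 : EE d → E1 d) (η2 : EE d → E2 d) (L : ℝ),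
    0 ≤ L ∧ IsC2 η η1 η2 univ ∧ Sz α L η univ ∧ Sz α L η1 univ ∧ Sz α L η2 univ ∧
    (∀ x, ‖x‖ ≤ 1/2 → η x = 1 ∧ η1 x = 0 ∧ η2 x = 0) ∧ (∀ x, 3/4 < ‖x‖ → η x = 0 ∧ η1 x = 0 ∧ η2 x = 0) ∧
    ∀ x, 0 ≤ η x ∧ η x ≤ 1 := by
  let b : ContDiffBump (0 : EE d) := ⟨5/8, 3/4, by norm_num, by norm_num⟩
  have hb : ContDiff ℝ ∞ b := b.contDiff
  have hb1 : ContDiff ℝ ∞ (fderiv ℝ b) := hb.fderiv_right (by norm_num)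
  have hb2 : ContDiff ℝ ∞ (fderiv ℝ (fderiv ℝ b)) := hb1.fderiv_right (by norm_num)
  have c0 : HasCompactSupport b := b.hasCompactSupport
  have c1 : HasCompactSupport (fderiv ℝ b) := c0.fderiv (𝕜 := ℝ)
  have c2 : HasCompactSupport (fderiv ℝ (fderiv ℝ b)) := c1.fderiv (𝕜 := ℝ)
  have key : ∀ {G : Type} [NormedAddCommGroup G] [NormedSpace ℝ G] (f : EE d → G), ContDiff ℝ ∞ f → HasCompactSupport f →
      ∃ L, 0 ≤ L ∧ Sz α L f univ := by
    intro G _ _ f hf hc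
    obtain ⟨C, hC⟩ := hc.exists_bound_of_continuous hf.continuous
    obtain ⟨K, hK⟩ := hf.lipschitzWith_of_hasCompactSupport hc (by simp)
    have hC0 := (norm_nonneg _).trans (hC 0)
    refine ⟨2 * C + K, by positivity, lip_hol h0 h1 (fun x _ => hC x) (fun x _ y _ => ?_) hC0 K.2⟩
    have := hK.dist_le_mul x y; rwa [dist_eq_norm, dist_eq_norm] at this
  obtain ⟨L0, p0, s0⟩ := key _ hb c0
  obtain ⟨L1, p1, s1⟩ := key _ hb1 c1
  obtain ⟨L2, p2, s2⟩ := key _ hb2 c2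
  refine ⟨b, fderiv ℝ b, fderiv ℝ (fderiv ℝ b), L0 + L1 + L2, by positivity,
    fun x _ => ⟨(hb.differentiable (by simp) x).hasFDerivAt, (hb1.differentiable (by simp) x).hasFDerivAt⟩,
    s0.mono (by linarith), s1.mono (by linarith), s2.mono (by linarith), fun x hx => ?_, fun x hx => ?_, fun x => ⟨b.nonneg, b.le_one⟩⟩
  · have e : ∀ y, ‖y‖ < 5/8 → (b : EE d → ℝ) =ᶠ[𝓝 y] fun _ => 1 := fun y hy => by
      have : Metric.ball (0 : EE d) (5/8) ∈ 𝓝 y := Metric.isOpen_ball.mem_nhds (by simpa using hy)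
      filter_upwards [this] with z hz
      exact b.one_of_mem_closedBall (Metric.ball_subset_closedBall hz)
    have hx' : ‖x‖ < 5/8 := by linarith
    have e1 : ∀ y, ‖y‖ < 5/8 → fderiv ℝ b y = 0 := fun y hy => by rw [(e y hy).fderiv_eq]; simp
    have e2 : fderiv ℝ b =ᶠ[𝓝 x] fun _ => 0 := by
      have : Metric.ball (0 : EE d) (5/8) ∈ 𝓝 x := Metric.isOpen_ball.mem_nhds (by simpa using hx')
      filter_upwards [this] with z hz using e1 z (by simpa using hz)
    exact ⟨(e x hx').self_of_nhds, e1 x hx', by rw [e2.fderiv_eq]; simp⟩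
  · have e : ∀ y, 3/4 < ‖y‖ → (b : EE d → ℝ) =ᶠ[𝓝 y] fun _ => 0 := fun y hy => by
      have : {z : EE d | 3/4 < ‖z‖} ∈ 𝓝 y := (isOpen_lt continuous_const continuous_norm).mem_nhds hy
      filter_upwards [this] with z hz
      exact b.zero_of_le_dist (by simpa using le_of_lt hz)
    have e1 : ∀ y, 3/4 < ‖y‖ → fderiv ℝ b y = 0 := fun y hy => by rw [(e y hy).fderiv_eq]; simp
    have e2 : fderiv ℝ b =ᶠ[𝓝 x] fun _ => 0 := by
      have : {z : EE d | 3/4 < ‖z‖} ∈ 𝓝 x := (isOpen_lt continuous_const continuous_norm).mem_nhds hx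
      filter_upwards [this] with z hz using e1 z hz
    exact ⟨(e x hx).self_of_nhds, e1 x hx, by rw [e2.fderiv_eq]; simp⟩
end

section
open MeasureTheory Set Filter Topology
open scoped SchwartzMap ContDiff

open scoped SI
set_option linter.unusedSectionVars false
variable {d : ℕ} {F : Type} [NormedAddCommGroup F] [NormedSpace ℝ F]

abbrev B1 : Set (EE d) := Metric.ball 0 1

lemma mv_ball {f : EE d → F} {f' : EE d → EE d →L[ℝ] F} {K : ℝ} {S : Set (EE d)} (hS : Convex ℝ S)
    (h : ∀ x ∈ S, HasFDerivAt f (f' x) x) (hK : ∀ x ∈ S, ‖f' x‖ ≤ K) :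
    ∀ x ∈ S, ∀ y ∈ S, ‖f x - f y‖ ≤ K * ‖x - y‖ := fun x hx y hy =>
  hS.norm_image_sub_le_of_norm_hasFDerivWithin_le (fun z hz => (h z hz).hasFDerivWithinAt) hK hy hx

lemma interp {f : EE d → F} {f' : EE d → EE d →L[ℝ] F} {N K τ : ℝ} (hτ : 0 < τ) (hτ1 : τ < 1)
    (h : ∀ x ∈ B1, HasFDerivAt f (f' x) x) (hN : ∀ x ∈ B1, ‖f x‖ ≤ N) (hK : ∀ x, ‖x‖ ≤ τ → ‖f' x - f' 0‖ ≤ K) :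
    ‖f' 0‖ ≤ 2 * N / τ + K := by
  have hN0 : 0 ≤ N := (norm_nonneg _).trans (hN 0 (by simp))
  have hK0 : 0 ≤ K := (norm_nonneg _).trans (hK 0 (by simpa using hτ.le))
  have sub : ∀ x : EE d, ‖x‖ ≤ τ → x ∈ B1 := fun x hx => by simpa using hx.trans_lt hτ1
  refine ContinuousLinearMap.opNorm_le_of_unit_norm (by positivity) fun v hv => ?_
  have hm : τ • v ∈ Metric.closedBall (0 : EE d) τ := by simp [norm_smul, hv, abs_of_pos hτ]
  have := (convex_closedBall (0 : EE d) τ).norm_image_sub_le_of_norm_hasFDerivWithin_le' (f := f) (φ := f' 0) (C := K) (x := 0) (y := τ • v)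
    (fun z hz => (h z (sub z (by simpa using hz))).hasFDerivWithinAt) (fun z hz => hK z (by simpa using hz))
    (by simpa using hτ.le) hm
  rw [sub_zero, map_smul, norm_smul, hv, Real.norm_of_nonneg hτ.le, mul_one] at this
  have h2 : ‖τ • f' 0 v‖ ≤ 2 * N + K * τ := by
    have e : τ • f' 0 v = (f (τ • v) - f 0) - (f (τ • v) - f 0 - τ • f' 0 v) := by abel
    rw [e]
    have a1 := hN _ (sub _ (by simpa using hm)); have a2 := hN 0 (by simp)
    have := norm_sub_le (f (τ • v) - f 0) (f (τ • v) - f 0 - τ • f' 0 v)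
    have := norm_sub_le (f (τ • v)) (f 0)
    linarith
  rw [norm_smul, Real.norm_of_nonneg hτ.le] at h2
  rw [div_add' _ _ _ hτ.ne', le_div_iff₀ hτ]; linarith

/-- the localized function -/
lemma isC2_cut {η u : EE d → ℝ} {η1 η2 u1 u2} {r : ℝ} (hr : 3/4 < r) (hη : IsC2 η η1 η2 univ)
    (hz : ∀ x, 3/4 < ‖x‖ → η x = 0 ∧ η1 x = 0 ∧ η2 x = 0) (hu : IsC2 u u1 u2 (Metric.ball 0 r)) :
    IsC2 (fun x => η x * u x) (fun x => η x • u1 x + u x • η1 x)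
      (fun x => η x • u2 x + u x • η2 x + sten (η1 x) (u1 x)) univ := by
  intro x _
  rcases lt_or_ge ‖x‖ r with h | h
  · have hx : x ∈ Metric.ball (0 : EE d) r := by simpa using h
    exact (show IsC2 η η1 η2 (Metric.ball 0 r) from fun y _ => hη y trivial).mul hu x hx
  · have hx : 3/4 < ‖x‖ := by linarith
    have hn : {z : EE d | 3/4 < ‖z‖} ∈ 𝓝 x := (isOpen_lt continuous_const continuous_norm).mem_nhds hx
    obtain ⟨e0, e1, e2⟩ := hz x hx
    constructor
    · beta_reduce; rw [e0, e1]; simp only [zero_smul, smul_zero, add_zero]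
      refine (hasFDerivAt_const (0:ℝ) x).congr_of_eventuallyEq ?_
      filter_upwards [hn] with y hy; simp [(hz y hy).1]
    · have : sten (0 : E1 d) (u1 x) = 0 := by ext v w; simp [sten_apply]
      beta_reduce; rw [e0, e1, e2, this]; simp only [zero_smul, smul_zero, add_zero]
      refine (hasFDerivAt_const (0 : E1 d) x).congr_of_eventuallyEq ?_
      filter_upwards [hn] with y hy; simp [(hz y hy).1, (hz y hy).2.1]

theorem unit_est {α m β : ℝ} (h0 : 0 < α) (h1 : α < 1) (hm : 1 ≤ m) (hβ : 0 ≤ β) : ∃ C, 0 ≤ C ∧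
    ∀ (A : EE d → D2 d) (B : EE d → D1 d) (g f u : EE d → ℝ) u1 u2 (κ N0 N1 N2 Na Fs : ℝ), Ell m (A 0) → 0 ≤ κ → κ ≤ 1 →
    Hol α κ A B1 → Sz α β B B1 → Sz α β g B1 → Sz α Fs f B1 → IsC2 u u1 u2 B1 →
    (∀ x ∈ B1, |u x| ≤ N0) → (∀ x ∈ B1, ‖u1 x‖ ≤ N1) → (∀ x ∈ B1, ‖u2 x‖ ≤ N2) → 0 ≤ Na → Hol α Na u2 B1 →
    (∀ x ∈ B1, Lop (A x) (B x) (g x) (u2 x) (u1 x) (u x) = f x) →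
    Hol α (C * (κ * Na + N0 + N1 + N2 + Fs)) u2 (Metric.ball 0 (1/2)) := by
  obtain ⟨C, hC, hfr⟩ := frozen (d := d) h0 h1 hm
  obtain ⟨η, η1, η2, L, hL, hη, s0, s1, s2, ht, hz, -⟩ := exists_cut (d := d) h0 h1
  set a : ℝ := d * m ^ 2
  have ha : 0 ≤ a := by positivity
  refine ⟨C * ((2 * L * (9 + 16 * β) + 24 * a * L) + 6 * L), by positivity, ?_⟩
  intro A B g f u u1 u2 κ N0 N1 N2 Na Fs hA hκ hκ1 HA HB Hg Hf hu b0 b1 b2 hNa b3 hLu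
  have z0 : (0 : EE d) ∈ B1 := by simp
  have ne : (B1 : Set (EE d)).Nonempty := ⟨0, z0⟩
  have n0 : 0 ≤ N0 := (abs_nonneg _).trans (b0 0 z0)
  have n1 : 0 ≤ N1 := (norm_nonneg _).trans (b1 0 z0)
  have n2 : 0 ≤ N2 := (norm_nonneg _).trans (b2 0 z0)
  have nF := Hf.nonneg ne
  have nκ : 0 ≤ κ * Na := by positivity
  set T := κ * Na + N0 + N1 + N2 + Fs with hT
  have hT0 : 0 ≤ T := by positivity
  have cv : Convex ℝ (B1 : Set (EE d)) := convex_ball _ _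
  have su : Sz α (3 * T) u B1 := (lip_hol h0 h1 (N := N0) (K := N1) b0 (mv_ball cv (fun x hx => (hu x hx).1) b1) n0 n1).mono (by linarith)
  have su1 : Sz α (3 * T) u1 B1 := (lip_hol h0 h1 (N := N1) (K := N2) b1 (mv_ball cv (fun x hx => (hu x hx).2) b2) n1 n2).mono (by linarith)
  have su2 : Sz α (N2 + Na) u2 B1 := ⟨fun x hx => (b2 x hx).trans (by linarith), b3.mono (by linarith)⟩
  have sA : Sz α κ (fun x => A 0 - A x) B1 := by
    refine ⟨fun x hx => (HA 0 z0 x hx).trans ?_, fun x hx y hy => ?_⟩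
    · have : ‖0 - x‖ ^ α ≤ 1 := Real.rpow_le_one (norm_nonneg _) (by simpa using le_of_lt (mem_ball_zero_iff.1 hx)) h0.le
      nlinarith
    · have := HA y hy x hx
      rw [norm_sub_rev y x] at this
      simpa using this
  have q1 : Sz α (2 * T) (fun x => (A 0 - A x) (u2 x)) B1 := by
    have := sA.bil su2 (c := 1) zero_le_one (by positivity) hκ (fun x h h' => absurd h h') (fun (p : D2 d) (q : E2 d) => p q)
      (fun _ _ _ => rfl) (fun p q q' => map_sub p q q') (fun p q => by rw [one_mul]; exact p.le_opNorm q)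
    exact (show Sz α _ _ B1 from this).mono (by rw [hT]; nlinarith)
  have q2 : Sz α (6 * β * T) (fun x => B x (u1 x)) B1 := by
    have := HB.bil su1 (c := 1) zero_le_one (by positivity) hβ (fun x h h' => absurd h h') (fun (p : D1 d) (q : E1 d) => p q)
      (fun _ _ _ => rfl) (fun p q q' => map_sub p q q') (fun p q => by rw [one_mul]; exact p.le_opNorm q)
    exact (show Sz α _ _ B1 from this).mono (by linarith)
  have q3 : Sz α (6 * β * T) (fun x => g x • u x) B1 :=
    (Hg.smul su (by positivity) hβ (fun x h h' => absurd h h')).mono (by linarith)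
  have q4 : Sz α ((3 + 12 * β) * T) (fun x => A 0 (u2 x)) B1 := by
    refine (((q1.add q2).add q3).sub Hf).mono (C' := (3 + 12 * β) * T) (by linarith) |>.congr fun x hx => ?_
    rw [← hLu x hx, Lop]; simp
  have zoff : ∀ x : EE d, x ∉ (B1 : Set (EE d)) → 3/4 < ‖x‖ := fun x hx => by
    have : 1 ≤ ‖x‖ := by simpa using hx
    linarith
  have r1 := s0.smul q4 (by positivity) hL (fun x _ h => (hz x (zoff x h)).1)
  have r2 : Sz α (2 * 2 * L * (3 * T)) (fun x => sten (η1 x) (u1 x)) univ :=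
    s1.bil su1 (c := 2) zero_le_two (by positivity) hL (fun x _ h => (hz x (zoff x h)).2.1) sten
      sten_sub_left sten_sub_right sten_norm
  have r3 : Sz α (2 * 1 * L * (3 * T)) (fun x => u x • η2 x) univ :=
    s2.bil su (c := 1) zero_le_one (by positivity) hL (fun x _ h => (hz x (zoff x h)).2.2) (fun p q => q • p)
      (fun _ _ _ => smul_sub _ _ _) (fun _ _ _ => sub_smul _ _ _) (fun p q => by rw [norm_smul, one_mul, mul_comm])
  have r4 := s0.smul su (by positivity) hL (fun x _ h => (hz x (zoff x h)).1)
  have r5 := (r3.add r2).lin ha (A 0) (fun p q => map_sub _ _ _) (fun p => (A 0).le_of_opNorm_le hA.norm_le p)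
  have hv := isC2_cut (by norm_num) hη hz hu
  set v2 := (fun x => η x • u2 x + u x • η2 x + sten (η1 x) (u1 x))
  have r6 : Sz α ((2 * L * (9 + 16 * β) + 24 * a * L) * T) (fun x => A 0 (v2 x)) univ := by
    refine (r1.add r5).congr (fun x _ => ?_) |>.mono ?_
    · simp only [v2, add_assoc, map_add, map_smul]
    · have := mul_nonneg hL hT0
      have := mul_nonneg ha this
      have := mul_nonneg hβ (mul_nonneg hL hT0)
      nlinarith
  have fin := hfr (A 0) hA _ _ _ (max ((2 * L * (9 + 16 * β) + 24 * a * L) * T) (6 * L * T)) _ (6 * L * T) hv (fun x => (r4.1 x trivial).trans ((le_of_eq (by ring)).trans (le_max_right _ _)))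
    (fun x => (r6.1 x trivial).trans (le_max_left _ _)) (by positivity) (by positivity) r6.2 (r4.2.mono (le_of_eq (by ring)))
  intro x hx y hy
  have e : ∀ x ∈ Metric.ball (0 : EE d) (1/2), v2 x = u2 x := fun x hx => by
    obtain ⟨t0, t1, t2⟩ := ht x (by simpa using le_of_lt (mem_ball_zero_iff.1 hx))
    have : sten (0 : E1 d) (u1 x) = 0 := by ext v w; simp [sten_apply]
    simp [v2, t0, t1, t2, this]
  rw [← e x hx, ← e y hy]
  refine (fin x trivial y trivial).trans (le_of_eq ?_)
  ring
end

section
open MeasureTheory Set Filter Topology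
open scoped SchwartzMap ContDiff

open scoped SI
set_option linter.unusedSectionVars false
variable {d : ℕ} {F : Type} [NormedAddCommGroup F] [NormedSpace ℝ F]

lemma IsC2.scale {u : EE d → ℝ} {u1 u2} {U V : Set (EE d)} (h : IsC2 u u1 u2 U) (x0 : EE d) (s : ℝ)
    (hV : ∀ y ∈ V, x0 + s • y ∈ U) :
    IsC2 (fun y => u (x0 + s • y)) (fun y => s • u1 (x0 + s • y)) (fun y => s ^ 2 • u2 (x0 + s • y)) V := by
  intro y hy
  obtain ⟨h1, h2⟩ := h _ (hV y hy)
  have e : HasFDerivAt (fun y : EE d => x0 + s • y) (s • ContinuousLinearMap.id ℝ (EE d)) y :=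
    ((hasFDerivAt_id y).const_smul s).const_add x0
  refine ⟨(h1.comp y e).congr_fderiv (by ext; simp), ?_⟩
  refine (HasFDerivAt.const_smul (𝕜 := ℝ) (h2.comp y e) s).congr_fderiv ?_
  ext a b; simp; ring

/-- weighted Hölder bound -/
def WH (α N : ℝ) (δ : EE d → ℝ) (f : EE d → F) : Prop := ∀ x, 0 < δ x → δ x ^ 2 * ‖f x‖ ≤ N ∧
  ∀ y, 0 < δ y → min (δ x) (δ y) ^ (2 + α) * ‖f x - f y‖ ≤ N * ‖x - y‖ ^ α

structure IsWt (δ : EE d → ℝ) (d0 : ℝ) : Prop where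
  le : ∀ x, δ x ≤ d0
  lip : ∀ x y, |δ x - δ y| ≤ ‖x - y‖

lemma IsWt.ball {δ : EE d → ℝ} {d0 : ℝ} (h : IsWt δ d0) {x0 : EE d} (h0 : 0 < δ x0) {y : EE d} (hy : y ∈ B1) :
    δ x0 / 2 ≤ δ (x0 + (δ x0 / 2) • y) := by
  have h1 := h.lip x0 (x0 + (δ x0 / 2) • y)
  have h2 : ‖y‖ < 1 := by simpa using hy
  rw [sub_add_cancel_left, norm_neg, norm_smul, Real.norm_of_nonneg (by positivity)] at h1
  have := (abs_le.1 h1).2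
  linarith [mul_le_of_le_one_right (by positivity : 0 ≤ δ x0 / 2) h2.le]

lemma scale_sub (x0 x y : EE d) {s : ℝ} (hs : 0 < s) : ‖(x0 + s • x) - (x0 + s • y)‖ = s * ‖x - y‖ := by
  rw [add_sub_add_left_eq_sub, ← smul_sub, norm_smul, Real.norm_of_nonneg hs.le]

lemma WH.scale {α N d0 : ℝ} {δ : EE d → ℝ} {f : EE d → F} (h : WH α N δ f) (h0 : 0 < α) (hw : IsWt δ d0) {x0 : EE d} (hx : 0 < δ x0) :
    Sz α N (fun y => (δ x0 / 2) ^ 2 • f (x0 + (δ x0 / 2) • y)) B1 := by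
  set s := δ x0 / 2
  have hs : 0 < s := by positivity
  have nn : ∀ v : F, ‖s ^ 2 • v‖ = s ^ 2 * ‖v‖ := fun v => by rw [norm_smul, Real.norm_of_nonneg (by positivity)]
  constructor
  · intro y hy
    have hb := hw.ball hx hy
    rw [nn]
    refine le_trans ?_ (h _ (hs.trans_le hb)).1
    gcongr
  · intro x hx1 y hy1
    have hb := hw.ball hx hx1
    have hb' := hw.ball hx hy1
    have := (h _ (hs.trans_le hb)).2 _ (hs.trans_le hb')
    rw [scale_sub _ _ _ hs, Real.mul_rpow hs.le (norm_nonneg _)] at this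
    rw [← smul_sub, nn]
    have h3 : s ^ (2 + α) * ‖f (x0 + s • x) - f (x0 + s • y)‖ ≤ N * (s ^ α * ‖x - y‖ ^ α) := by
      refine le_trans ?_ this
      gcongr; exact le_min hb hb'
    rw [Real.rpow_add hs, Real.rpow_two] at h3
    have hp : 0 < s ^ α := by positivity
    refine le_of_mul_le_mul_left ?_ hp
    linarith

lemma Sz.scale {α β : ℝ} {f : EE d → F} {U : Set (EE d)} (h : Sz α β f U) (h0 : 0 < α) {x0 : EE d} {s : ℝ} (hs : 0 < s) (hs1 : s ≤ 1)
    (hβ : 0 ≤ β) (hV : ∀ y ∈ B1, x0 + s • y ∈ U) {c : ℝ} (hc : 0 ≤ c) (hc1 : c ≤ 1) : Sz α β (fun y => c • f (x0 + s • y)) B1 := by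
  have nn : ∀ v : F, ‖c • v‖ ≤ ‖v‖ := fun v => by
    rw [norm_smul, Real.norm_of_nonneg hc]; nlinarith [norm_nonneg v]
  refine ⟨fun y hy => (nn _).trans (h.1 _ (hV y hy)), fun x hx y hy => ?_⟩
  rw [← smul_sub]
  refine (nn _).trans ((h.2 _ (hV x hx) _ (hV y hy)).trans ?_)
  rw [scale_sub _ _ _ hs]; gcongr; nlinarith [norm_nonneg (x - y)]

lemma half_iter {P : ℝ → Prop} {R : ℝ} (hR : 0 ≤ R) (h : ∀ S, 0 ≤ S → P S → P (S / 2 + R)) (hm : ∀ S T, S ≤ T → P S → P T)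
    (hcl : ∀ S, (∀ ε > 0, P (S + ε)) → P S) (h0 : ∃ S, 0 ≤ S ∧ P S) : P (2 * R) := by
  obtain ⟨S, hS, hP⟩ := h0
  have key : ∀ n : ℕ, P (S / 2 ^ n + 2 * R) := by
    intro n
    induction n with
    | zero => exact hm _ _ (by simp [hR]) hP
    | succ n ih => refine hm _ _ ?_ (h _ (by positivity) ih); rw [pow_succ]; field_simp; linarith
  refine hcl _ fun ε hε => ?_
  obtain ⟨n, hn⟩ := pow_unbounded_of_one_lt (S / ε) one_lt_two
  refine hm _ _ ?_ (key n)
  have : S / 2 ^ n ≤ ε := by rw [div_le_iff₀ (by positivity)]; rw [div_lt_iff₀ hε] at hn; linarith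
  linarith

set_option maxHeartbeats 1000000 in
theorem weighted {α m β : ℝ} (h0 : 0 < α) (h1 : α < 1) (hm : 1 ≤ m) (hβ : 0 ≤ β) : ∃ d0 C, 0 < d0 ∧ d0 ≤ 1 ∧ 0 ≤ C ∧
    ∀ (δ : EE d → ℝ) (A : EE d → D2 d) (B : EE d → D1 d) (g f u : EE d → ℝ) u1 u2 (N0 Fs : ℝ), IsWt δ d0 →
    (∀ x ∈ {x | 0 < δ x}, Ell m (A x)) → Hol α β A {x | 0 < δ x} → Sz α β B {x | 0 < δ x} → Sz α β g {x | 0 < δ x} →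
    IsC2 u u1 u2 {x | 0 < δ x} → 0 ≤ N0 → 0 ≤ Fs → (∀ x, 0 < δ x → |u x| ≤ N0) →
    (∃ S, (∀ x, 0 < δ x → δ x * ‖u1 x‖ ≤ S) ∧ WH α S δ u2) → WH α Fs δ f →
    (∀ x, 0 < δ x → Lop (A x) (B x) (g x) (u2 x) (u1 x) (u x) = f x) →
    (∀ x, 0 < δ x → δ x * ‖u1 x‖ ≤ C * (N0 + Fs)) ∧ WH α (C * (N0 + Fs)) δ u2 := by
  obtain ⟨C, hC, hun⟩ := unit_est (d := d) h0 h1 hm hβ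
  set Q := 8 * C + 8 with hQ
  have hQ0 : 0 < Q := by positivity
  have hQ8 : 8 ≤ Q := by linarith
  obtain ⟨τ, hτ0, hτ1, hτ⟩ : ∃ τ : ℝ, 0 < τ ∧ τ < 1 ∧ 4 * τ ^ α = 1 / (8 * Q) := by
    refine ⟨(1 / (32 * Q)) ^ (1 / α), by positivity, Real.rpow_lt_one (by positivity) ?_ (by positivity), ?_⟩
    · rw [div_lt_one (by positivity)]; linarith
    · rw [← Real.rpow_mul (by positivity), one_div_mul_cancel h0.ne', Real.rpow_one]; field_simp; norm_num
  obtain ⟨t, ht⟩ : ∃ t, t = τ / (256 * Q) := ⟨_, rfl⟩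
  have ht0 : 0 < t := by rw [ht]; positivity
  have ht1 : t < 1 := by rw [ht, div_lt_one (by positivity)]; linarith
  have htQ : Q * t = τ / 256 := by rw [ht]; field_simp
  obtain ⟨κ, hκ⟩ : ∃ κ, κ = 1 / (8 * Q) := ⟨_, rfl⟩
  have hκ0 : 0 < κ := by rw [hκ]; positivity
  have hκ1 : κ ≤ 1 := by rw [hκ, div_le_one (by positivity)]; linarith
  have hκQ : Q * κ = 1 / 8 := by rw [hκ]; field_simp
  obtain ⟨d0, hd0, hd1, hdκ⟩ : ∃ d0 : ℝ, 0 < d0 ∧ d0 ≤ 1 ∧ β * d0 ^ α ≤ κ := by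
    refine ⟨(κ / (β + 1)) ^ (1 / α), by positivity, Real.rpow_le_one (by positivity) ?_ (by positivity), ?_⟩
    · rw [div_le_one (by positivity)]; linarith
    · rw [← Real.rpow_mul (by positivity), one_div_mul_cancel h0.ne', Real.rpow_one, mul_div_assoc', div_le_iff₀ (by positivity)]; linarith
  obtain ⟨c, hc⟩ : ∃ c, c = 1 + 4 / t + 32 / (t * τ) := ⟨_, rfl⟩
  have hc0 : 0 ≤ c := by rw [hc]; positivity
  refine ⟨d0, 2 * (Q * c), hd0, hd1, by positivity, ?_⟩
  intro δ A B g f u u1 u2 N0 Fs hw hA HA HB Hg hu hN0 hF hb hfin hWf hL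
  rw [mul_assoc 2]
  refine half_iter (P := fun S => (∀ x, 0 < δ x → δ x * ‖u1 x‖ ≤ S) ∧ WH α S δ u2) (R := Q * c * (N0 + Fs)) (by positivity) ?_ ?_ ?_ ?_
  · rintro S hS ⟨hS1, hS2⟩
    -- rescaling data
    have hU : ∀ x0, 0 < δ x0 → ∀ y ∈ B1, x0 + (δ x0 / 2) • y ∈ {x | 0 < δ x} := fun x0 hx y hy =>
      (by positivity : (0:ℝ) < δ x0 / 2).trans_le (hw.ball hx hy)
    have hC2 : ∀ x0, 0 < δ x0 → _ := fun x0 hx => hu.scale x0 (δ x0 / 2) (hU x0 hx)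
    have bd1 : ∀ K, (∀ x, 0 < δ x → δ x * ‖u1 x‖ ≤ K) → ∀ x0, 0 < δ x0 → ∀ y ∈ B1, ‖(δ x0 / 2) • u1 (x0 + (δ x0 / 2) • y)‖ ≤ K := by
      intro K hK x0 hx y hy
      rw [norm_smul, Real.norm_of_nonneg (by positivity)]
      exact (mul_le_mul_of_nonneg_right (hw.ball hx hy) (norm_nonneg _)).trans (hK _ (hU x0 hx y hy))
    have bd2 : ∀ K, (∀ x, 0 < δ x → δ x ^ 2 * ‖u2 x‖ ≤ K) → ∀ x0, 0 < δ x0 → ∀ y ∈ B1, ‖(δ x0 / 2) ^ 2 • u2 (x0 + (δ x0 / 2) • y)‖ ≤ K := by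
      intro K hK x0 hx y hy
      rw [norm_smul, Real.norm_of_nonneg (by positivity)]
      exact (mul_le_mul_of_nonneg_right (pow_le_pow_left₀ (by positivity) (hw.ball hx hy) 2) (norm_nonneg _)).trans (hK _ (hU x0 hx y hy))
    obtain ⟨N1, hN1⟩ : ∃ N1, N1 = 2 * (2 * N0 / t + t * S) := ⟨_, rfl⟩
    obtain ⟨N2, hN2⟩ : ∃ N2, N2 = 4 * (2 * N1 / τ + τ ^ α * S) := ⟨_, rfl⟩
    have p1 : 0 ≤ N1 := by rw [hN1]; positivity
    have p2 : 0 ≤ N2 := by rw [hN2]; positivity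
    have b1 : ∀ x, 0 < δ x → δ x * ‖u1 x‖ ≤ N1 := by
      intro x hx
      have := interp (N := N0) (K := t * S) ht0 ht1 (fun y hy => (hC2 x hx y hy).1) (fun y hy => hb _ (hU x hx y hy)) (fun y hy => by
        have := mv_ball (convex_ball (0 : EE d) 1) (fun y hy => (hC2 x hx y hy).2) (bd2 S (fun x hx => (hS2 x hx).1) x hx) y
          (by simpa using hy.trans_lt ht1) 0 (by simp)
        refine this.trans ?_
        rw [sub_zero]; linarith [mul_le_mul_of_nonneg_left hy hS])
      simp only [smul_zero, add_zero] at this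
      rw [norm_smul, Real.norm_of_nonneg (by positivity)] at this
      rw [hN1]; linarith
    have b2 : ∀ x, 0 < δ x → δ x ^ 2 * ‖u2 x‖ ≤ N2 := by
      intro x hx
      have := interp (N := N1) (K := τ ^ α * S) hτ0 hτ1 (fun y hy => (hC2 x hx y hy).2) (bd1 N1 b1 x hx) (fun y hy => by
        have := (hS2.scale h0 hw hx).2 y (by simpa using hy.trans_lt hτ1) 0 (by simp)
        refine this.trans ?_
        rw [sub_zero, mul_comm]; gcongr)
      simp only [smul_zero, add_zero] at this
      rw [norm_smul, Real.norm_of_nonneg (by positivity)] at this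
      rw [hN2]; linarith
    have b3 : ∀ x, 0 < δ x → ∀ y, 0 < δ y → min (δ x) (δ y) ^ (2 + α) * ‖u2 x - u2 y‖ ≤
        (8 * C * (κ * S + N0 + N1 + N2 + Fs) + 8 * N2) * ‖x - y‖ ^ α := by
      intro x hx y hy
      have pm : 0 < min (δ x) (δ y) := lt_min hx hy
      have hmx := min_le_left (δ x) (δ y)
      have hmy := min_le_right (δ x) (δ y)
      generalize min (δ x) (δ y) = μ at pm hmx hmy
      have hKp : 0 ≤ 8 * C * (κ * S + N0 + N1 + N2 + Fs) := by positivity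
      rcases lt_or_ge ‖x - y‖ (δ x / 4) with hxy | hxy
      · obtain ⟨s, hs⟩ : ∃ s, s = δ x / 2 := ⟨_, rfl⟩
        have hs0 : 0 < s := by rw [hs]; positivity
        have hs1 : s ≤ d0 := by have := hw.le x; linarith
        have hV := hU x hx; have h2 := hC2 x hx; have h3 := bd1 N1 b1 x hx; have h4 := bd2 N2 b2 x hx
        have h5 := hS2.scale h0 hw hx; have h6 := hWf.scale h0 hw hx
        rw [← hs] at hV h2 h3 h4 h5 h6
        have hE := hun (fun y => A (x + s • y)) (fun y => s • B (x + s • y)) (fun y => s ^ 2 • g (x + s • y))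
          (fun y => s ^ 2 • f (x + s • y)) _ _ _ κ N0 N1 N2 S Fs (hA _ (hV 0 (by simp))) hκ0.le hκ1 (fun a ha b hb => by
            refine (HA _ (hV a ha) _ (hV b hb)).trans ?_
            rw [scale_sub _ _ _ hs0, Real.mul_rpow hs0.le (norm_nonneg _), ← mul_assoc]
            refine mul_le_mul_of_nonneg_right (le_trans ?_ hdκ) (by positivity)
            gcongr) (HB.scale h0 hs0 (hs1.trans hd1) hβ hV hs0.le (hs1.trans hd1)) (Hg.scale h0 hs0 (hs1.trans hd1) hβ hV (by positivity)
              (pow_le_one₀ hs0.le (hs1.trans hd1))) h6 h2 (fun y hy => hb _ (hV y hy)) h3 h4 hS h5.2 (fun y hy => by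
            rw [← hL _ (hV y hy)]; simp only [Lop, map_smul, smul_eq_mul, smul_apply]; ring)
        have hy2 : ‖(1 / s) • (y - x)‖ < 1 / 2 := by
          rw [norm_smul, Real.norm_of_nonneg (by positivity), norm_sub_rev, one_div_mul_eq_div, div_lt_iff₀ hs0]; linarith
        have hE2 := hE 0 (by simp) ((1 / s) • (y - x)) (by simpa using hy2)
        have e1 : x + s • ((1 / s) • (y - x)) = y := by rw [smul_smul, mul_one_div_cancel hs0.ne', one_smul]; abel
        beta_reduce at hE2
        rw [smul_zero, add_zero, e1, ← smul_sub, norm_smul, Real.norm_of_nonneg (by positivity), zero_sub, norm_neg, norm_smul,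
          Real.norm_of_nonneg (by positivity), norm_sub_rev y x, Real.mul_rpow (by positivity) (norm_nonneg _), Real.div_rpow zero_le_one hs0.le, Real.one_rpow] at hE2
        have hp : 0 < s ^ α := by positivity
        have h7 : s ^ (2 + α) * ‖u2 x - u2 y‖ ≤ C * (κ * S + N0 + N1 + N2 + Fs) * ‖x - y‖ ^ α := by
          rw [Real.rpow_add hs0, Real.rpow_two]
          have := mul_le_mul_of_nonneg_left hE2 hp.le
          have e : s ^ α * (C * (κ * S + N0 + N1 + N2 + Fs) * (1 / s ^ α * ‖x - y‖ ^ α)) = C * (κ * S + N0 + N1 + N2 + Fs) * ‖x - y‖ ^ α := by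
            field_simp
          linarith
        have h8 : μ ^ (2 + α) ≤ 8 * s ^ (2 + α) := by
          calc μ ^ (2 + α) ≤ (2 * s) ^ (2 + α) := by gcongr; linarith
            _ = 2 ^ (2 + α) * s ^ (2 + α) := Real.mul_rpow (by norm_num) hs0.le
            _ ≤ 2 ^ (3:ℝ) * s ^ (2 + α) := by gcongr <;> linarith
            _ = _ := by norm_num
        have h9 : 0 ≤ 8 * N2 * ‖x - y‖ ^ α := by positivity
        have := mul_le_mul_of_nonneg_right h8 (norm_nonneg (u2 x - u2 y))
        rw [add_mul]; linarith
      · have h5 : ∀ z, 0 < δ z → μ ≤ δ z → μ ^ 2 * ‖u2 z‖ ≤ N2 := fun z hz hm => (by gcongr : μ ^ 2 * ‖u2 z‖ ≤ δ z ^ 2 * ‖u2 z‖).trans (b2 z hz)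
        have h6 : μ ^ 2 * ‖u2 x - u2 y‖ ≤ 2 * N2 := by
          have := h5 x hx hmx; have := h5 y hy hmy
          have := mul_le_mul_of_nonneg_left (norm_sub_le (u2 x) (u2 y)) (sq_nonneg μ)
          linarith
        have h7 : μ ^ α ≤ 4 * ‖x - y‖ ^ α := by
          calc μ ^ α ≤ (4 * ‖x - y‖) ^ α := by gcongr; linarith
            _ = 4 ^ α * ‖x - y‖ ^ α := Real.mul_rpow (by norm_num) (norm_nonneg _)
            _ ≤ 4 ^ (1:ℝ) * ‖x - y‖ ^ α := by gcongr; norm_num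
            _ = _ := by norm_num
        rw [Real.rpow_add pm, Real.rpow_two]
        have h8 := mul_le_mul h7 h6 (by positivity) (by positivity)
        have h9 : 0 ≤ 8 * C * (κ * S + N0 + N1 + N2 + Fs) * ‖x - y‖ ^ α := by positivity
        rw [add_mul]; linarith
    have hNN : N0 ≤ N0 + Fs := by linarith
    have c1 : N1 = 4 / t * N0 + 2 * t * S := by rw [hN1]; field_simp; ring
    have c2 : N2 = 32 / (t * τ) * N0 + 16 * t / τ * S + 4 * τ ^ α * S := by rw [hN2, hN1]; field_simp; ring
    have c3 : 16 * t / τ = 1 / (16 * Q) := by rw [ht]; field_simp; norm_num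
    have c4 : 2 * t ≤ 1 / (16 * Q) := by rw [ht, mul_div_assoc', div_le_div_iff₀ (by positivity) (by positivity)]; linarith [mul_le_mul_of_nonneg_right hτ1.le hQ0.le]
    rw [c3, hτ] at c2
    have c5 : κ * S + N0 + N1 + N2 + Fs ≤ c * (N0 + Fs) + 1 / (2 * Q) * S := by
      have e1 : κ = 1 / (8 * Q) := hκ
      have e2 : 1 / (2 * Q) = 4 * (1 / (8 * Q)) := by field_simp; norm_num
      have e3 : 1 / (16 * Q) = 1 / (8 * Q) / 2 := by field_simp; norm_num
      have e4 : 0 ≤ 4 / t := by positivity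
      have e5 : 0 ≤ 32 / (t * τ) := by positivity
      have e6 : 0 < 1 / (8 * Q) := by positivity
      rw [c1, c2, e1, hc, e2]; rw [e3] at c4 ⊢
      generalize 1 / (8 * Q) = q at *
      generalize 4 / t = a at *
      generalize 32 / (t * τ) = b at *
      linarith [mul_nonneg e4 hF, mul_nonneg e5 hF, mul_nonneg e6.le hS, mul_le_mul_of_nonneg_right c4 hS]
    have c6 : Q * (κ * S + N0 + N1 + N2 + Fs) ≤ S / 2 + Q * c * (N0 + Fs) := by
      refine (mul_le_mul_of_nonneg_left c5 hQ0.le).trans (le_of_eq ?_)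
      field_simp; ring
    have pκ : 0 ≤ κ * S := by positivity
    have c7 : ∀ z, z ≤ κ * S + N0 + N1 + N2 + Fs → z ≤ S / 2 + Q * c * (N0 + Fs) := fun z hz => by
      refine (hz.trans ?_).trans c6
      have : 0 ≤ κ * S + N0 + N1 + N2 + Fs := by positivity
      exact le_mul_of_one_le_left this (by linarith)
    refine ⟨fun x hx => (b1 x hx).trans (c7 _ (by linarith)), fun x hx => ⟨(b2 x hx).trans (c7 _ (by linarith)), fun y hy => (b3 x hx y hy).trans ?_⟩⟩
    refine mul_le_mul_of_nonneg_right (le_trans ?_ c6) (by positivity)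
    rw [hQ, add_mul]; linarith
  · rintro S T hST ⟨a, b⟩
    exact ⟨fun x hx => (a x hx).trans hST, fun x hx => ⟨(b x hx).1.trans hST, fun y hy => ((b x hx).2 y hy).trans (by gcongr)⟩⟩
  · intro S h
    refine ⟨fun x hx => le_of_forall_pos_le_add fun ε hε => (h ε hε).1 x hx, fun x hx =>
      ⟨le_of_forall_pos_le_add fun ε hε => ((h ε hε).2 x hx).1, fun y hy => ?_⟩⟩
    rcases eq_or_lt_of_le (show 0 ≤ ‖x - y‖ ^ α by positivity) with hz | hz
    · have := ((h 1 one_pos).2 x hx).2 y hy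
      rw [← hz, mul_zero] at this ⊢; exact this
    · rw [← div_le_iff₀ hz]
      exact le_of_forall_pos_le_add fun ε hε => by rw [div_le_iff₀ hz]; exact ((h ε hε).2 x hx).2 y hy
  · obtain ⟨S, a, b⟩ := hfin
    exact ⟨max S 0, le_max_right _ _, fun x hx => (a x hx).trans (le_max_left _ _), fun x hx => ⟨(b x hx).1.trans (le_max_left _ _), fun y hy =>
      ((b x hx).2 y hy).trans (by gcongr; exact le_max_left _ _)⟩⟩
end

section
open MeasureTheory Set Filter Topology
open scoped SchwartzMap ContDiff

open scoped SI
set_option linter.unusedSectionVars false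
variable {d : ℕ} {F : Type} [NormedAddCommGroup F] [NormedSpace ℝ F]

/-- operator from matrix -/
def Aof (a : Fin d → Fin d → ℝ) : D2 d := ∑ i, ∑ j, a i j •
  (ContinuousLinearMap.apply ℝ ℝ (eb j)).comp (ContinuousLinearMap.apply ℝ (E1 d) (eb i))

lemma Aof_apply (a : Fin d → Fin d → ℝ) (T : E2 d) : Aof a T = ∑ i, ∑ j, a i j * T (eb i) (eb j) := by
  simp [Aof]

/-- quadratic form -/
def qf (a : Fin d → Fin d → ℝ) (x : EE d) : ℝ := ∑ i, ∑ j, a i j * x i * x j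

/-- uniform ellipticity of a matrix -/
def EllQ (l : ℝ) (a : Fin d → Fin d → ℝ) : Prop := (∀ i j, a i j = a j i) ∧
  ∀ x : EE d, l * ell x x ≤ qf a x ∧ qf a x ≤ l⁻¹ * ell x x

open scoped MatrixOrder ComplexOrder Matrix.Norms.L2Operator in
lemma exists_root (a : Fin d → Fin d → ℝ) (hs : ∀ i j, a i j = a j i) (hp : ∀ x, 0 ≤ qf a x) :
    ∃ B : Fin d → Fin d → ℝ, ∀ i j, a i j = ∑ k, B k i * B k j := by
  have h : (Matrix.of a).PosSemidef := by
    refine .of_dotProduct_mulVec_nonneg (by ext i j; simp [hs i j]) fun x => ?_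
    refine (hp x).trans_eq ?_
    simp only [qf, dotProduct, Matrix.mulVec, Matrix.of_apply, star_trivial, Finset.mul_sum]
    exact Finset.sum_congr rfl fun i _ => Finset.sum_congr rfl fun j _ => by ring
  obtain ⟨B, hB⟩ := CStarAlgebra.nonneg_iff_eq_star_mul_self.mp h.nonneg
  refine ⟨B, fun i j => ?_⟩
  have := congrFun (congrFun hB i) j
  simpa [Matrix.mul_apply] using this

lemma ell_nonneg (x : EE d) : 0 ≤ ell x x := (sq_nonneg _).trans (sq_le_ell x)

lemma ellQ_Ell {l : ℝ} (hl : 0 < l) (hl1 : l ≤ 1) {a : Fin d → Fin d → ℝ} (h : EllQ l a) : Ell (d / l + 1) (Aof a) := by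
  obtain ⟨B, hB⟩ := exists_root a h.1 fun x => (mul_nonneg hl.le (ell_nonneg x)).trans (h.2 x).1
  let b : EE d →ₗ[ℝ] EE d := Matrix.toLin' (Matrix.of B)
  let M : EE d →ₗ[ℝ] EE d := Matrix.toLin' (Matrix.of fun i k => B k i)
  have hb : ∀ x k, b x k = ∑ i, B k i * x i := fun x k => by simp [b, Matrix.mulVec, dotProduct]
  have hM : ∀ x i, M x i = ∑ k, B k i * x k := fun x i => by simp [M, Matrix.mulVec, dotProduct]
  have e1 : ∀ x, ell (b x) (b x) = qf a x := fun x => by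
    simp only [ell_apply, hb, qf, hB, Finset.sum_mul, Finset.mul_sum]
    rw [Finset.sum_comm]; refine Finset.sum_congr rfl fun i _ => ?_
    rw [Finset.sum_comm]; refine Finset.sum_congr rfl fun j _ => ?_
    exact Finset.sum_congr rfl fun k _ => by ring
  have e2 : ∀ x v, ell x (M v) = ell (b x) v := fun x v => by
    simp only [ell_apply, hb, hM, Finset.sum_mul, Finset.mul_sum]
    rw [Finset.sum_comm]
    exact Finset.sum_congr rfl fun i _ => Finset.sum_congr rfl fun j _ => by ring
  have binj : Function.Injective b := (injective_iff_map_eq_zero b).2 fun x hx => by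
    have := (h.2 x).1
    rw [← e1, hx, map_zero] at this
    have h2 := sq_le_ell x
    have : ‖x‖ ^ 2 ≤ 0 := h2.trans (nonpos_of_mul_nonpos_right this hl)
    exact norm_eq_zero.1 (pow_eq_zero_iff two_ne_zero |>.1 (le_antisymm this (sq_nonneg _)))
  have bsurj := LinearMap.injective_iff_surjective.1 binj
  have cs : ∀ x y : EE d, ell x y ^ 2 ≤ ell x x * ell y y := fun x y => by
    have := Finset.sum_mul_sq_le_sq_mul_sq Finset.univ x y
    simpa [ell_apply, pow_two] using this
  have e3 : ∀ v, l * ell v v ≤ ell (M v) (M v) := fun v => by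
    obtain ⟨x, rfl⟩ := bsurj v
    have a1 := cs x (M (b x))
    rw [e2] at a1
    have a2 := (h.2 x).1
    rw [← e1] at a2
    rcases eq_or_lt_of_le (ell_nonneg (b x)) with h0 | h0
    · rw [← h0, mul_zero]; exact ell_nonneg _
    · have a3 := ell_nonneg (M (b x))
      generalize ell (b x) (b x) = V at *
      generalize ell (M (b x)) (M (b x)) = W at *
      have : V * (l * V) ≤ V * W := by nlinarith
      exact le_of_mul_le_mul_left this h0
  have Minj : Function.Injective M := (injective_iff_map_eq_zero M).2 fun x hx => by
    have := e3 x
    rw [hx, map_zero] at this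
    have h2 := sq_le_ell x
    have : ‖x‖ ^ 2 ≤ 0 := h2.trans (nonpos_of_mul_nonpos_right this hl)
    exact norm_eq_zero.1 (pow_eq_zero_iff two_ne_zero |>.1 (le_antisymm this (sq_nonneg _)))
  have hdl : (0:ℝ) ≤ d / l := by positivity
  have hm1 : (d:ℝ) / l ≤ (d / l + 1) ^ 2 := by nlinarith
  have sq_imp : ∀ {p q c : ℝ}, 0 ≤ q → 0 ≤ c → p ^ 2 ≤ c ^ 2 * q ^ 2 → p ≤ c * q := fun h1 h2 h3 =>
    abs_le_of_sq_le_sq' (by rw [mul_pow]; exact h3) (by positivity) |>.2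
  have n1 : ∀ v, ‖M v‖ ≤ (d / l + 1) * ‖v‖ := fun v => by
    refine (pi_norm_le_iff_of_nonneg (by positivity)).2 fun i => ?_
    have hBk : ∀ k, |B k i| ≤ 1 / l := fun k => by
      have h1 := (h.2 (eb i)).2
      have h2 : qf a (eb i) = a i i := by simp [qf, Pi.single_apply]
      have h3 : ell (eb i : EE d) (eb i) = 1 := by simp [ell_apply, Pi.single_apply]
      rw [h2, h3, hB] at h1
      have h4 := Finset.single_le_sum (f := fun k => B k i * B k i) (fun k _ => mul_self_nonneg _) (Finset.mem_univ k)
      have h5 : 1 ≤ 1 / l := by rw [le_div_iff₀ hl]; linarith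
      refine abs_le_of_sq_le_sq ?_ (by positivity)
      rw [one_div] at *; beta_reduce at h4; nlinarith
    rw [hM, Real.norm_eq_abs]
    calc _ ≤ ∑ k, |B k i * v k| := Finset.abs_sum_le_sum_abs _ _
      _ ≤ ∑ k : Fin d, 1 / l * ‖v‖ := Finset.sum_le_sum fun k _ => by
          rw [abs_mul]; exact mul_le_mul (hBk k) (norm_le_pi_norm v k) (abs_nonneg _) (by positivity)
      _ = d / l * ‖v‖ := by simp; ring
      _ ≤ _ := by gcongr; linarith
  have n2 : ∀ v, ‖v‖ ≤ (d / l + 1) * ‖M v‖ := fun v => by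
    refine sq_imp (norm_nonneg _) (by positivity) ?_
    have h1 := sq_le_ell v; have h2 := e3 v; have h3 := ell_le (M v)
    have h4 : ell v v ≤ d / l * ‖M v‖ ^ 2 := by
      rw [div_mul_eq_mul_div, le_div_iff₀ hl]; linarith
    exact h1.trans (h4.trans (by gcongr))
  let Me : EE d ≃L[ℝ] EE d := (LinearEquiv.ofInjectiveEndo M Minj).toContinuousLinearEquiv
  have hMe : ∀ v, Me v = M v := fun v => rfl
  refine ⟨Me, ?_, ContinuousLinearMap.opNorm_le_bound _ (by positivity) n1,
    ContinuousLinearMap.opNorm_le_bound _ (by positivity) fun v => ?_⟩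
  · ext T
    rw [Aof_apply, QM_apply]
    have hk : ∀ k, M (eb k) = ∑ i, B k i • (eb i : EE d) := fun k => by
      ext i; rw [hM]; simp [Pi.single_apply]
    have : ∀ k, T ((Me : EE d →L[ℝ] EE d) (eb k)) ((Me : EE d →L[ℝ] EE d) (eb k)) = ∑ i, ∑ j, B k i * B k j * T (eb i) (eb j) := fun k => by
      rw [ContinuousLinearEquiv.coe_coe, hMe, hk]
      simp only [map_sum, map_smul, sum_apply, smul_apply, smul_eq_mul, Finset.mul_sum]
      exact Finset.sum_comm.trans (Finset.sum_congr rfl fun i _ => Finset.sum_congr rfl fun j _ => by ring)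
    simp only [this, hB, Finset.sum_mul]
    refine Eq.trans ?_ Finset.sum_comm
    exact Finset.sum_congr rfl fun i _ => Finset.sum_comm
  · have := n2 (Me.symm v)
    rwa [← hMe, Me.apply_symm_apply] at this
end

section
open MeasureTheory Set Filter Topology
open scoped SchwartzMap ContDiff

open scoped SI
set_option linter.unusedSectionVars false
variable {d : ℕ} {F : Type} [NormedAddCommGroup F] [NormedSpace ℝ F]

def Good (α K : ℝ) (u : EE d → ℝ) (u1 : EE d → E1 d) (u2 : EE d → E2 d) : Prop :=
  IsC2 u u1 u2 univ ∧ Sz α K u univ ∧ Sz α K u1 univ ∧ Sz α K u2 univ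

structure Cls (α m β ε : ℝ) (A : EE d → D2 d) (B : EE d → D1 d) (g : EE d → ℝ) : Prop where
  el : ∀ x, Ell m (A x)
  hA : Hol α β A univ
  hB : Sz α β B univ
  hg : Sz α β g univ
  ge : ∀ x, ε ≤ g x

set_option maxHeartbeats 1000000 in
theorem glob {α m β ε : ℝ} (h0 : 0 < α) (h1 : α < 1) (hm : 1 ≤ m) (hβ : 0 ≤ β) (hε : 0 < ε) : ∃ C, 0 ≤ C ∧
    ∀ (A : EE d → D2 d) (B : EE d → D1 d) (g f u : EE d → ℝ) u1 u2 (Fs : ℝ), Cls α m β ε A B g →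
    (∃ K, Good α K u u1 u2) → Sz α Fs f univ →
    (∀ x, Lop (A x) (B x) (g x) (u2 x) (u1 x) (u x) = f x) → Good α (C * Fs) u u1 u2 := by
  obtain ⟨d0, C, hd0, hd1, hC, hw⟩ := weighted (d := d) h0 h1 hm hβ
  refine ⟨2 / ε + 3 * (C * (1 / ε + 1) / d0 ^ 3), by positivity, ?_⟩
  intro A B g f u u1 u2 Fs hc ⟨K, hu, k0, k1, k2⟩ hf hL
  have hF : 0 ≤ Fs := hf.nonneg univ_nonempty
  have hK : 0 ≤ K := k0.nonneg univ_nonempty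
  have b0 : ∀ x, |u x| ≤ Fs / ε := fun x => by
    rw [le_div_iff₀ hε, mul_comm]
    exact maxP_abs hu (fun x => k0.1 x trivial) hc.el (fun x => hc.hB.1 x trivial) hε hc.ge hF
      (fun x => by rw [hL]; exact hf.1 x trivial) x
  have pa : 0 < d0 ^ (2 + α) := by positivity
  have pa1 : d0 ^ (2 + α) ≤ 1 := Real.rpow_le_one hd0.le hd1 (by linarith)
  have pa3 : d0 ^ 3 ≤ d0 ^ (2 + α) := by
    rw [← Real.rpow_natCast]; exact Real.rpow_le_rpow_of_exponent_ge hd0 hd1 (by push_cast; linarith)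
  have wh : ∀ {G : Type} [NormedAddCommGroup G] [NormedSpace ℝ G] {φ : EE d → G} {N}, 0 ≤ N → Sz α N φ univ → WH α N (fun _ => d0) φ := by
    intro G _ _ φ N hN h x _
    refine ⟨?_, fun y _ => ?_⟩
    · exact (mul_le_of_le_one_left (norm_nonneg _) (pow_le_one₀ hd0.le hd1)).trans (h.1 x trivial)
    · rw [min_self]; exact (mul_le_of_le_one_left (norm_nonneg _) pa1).trans (h.2 x trivial y trivial)
  obtain ⟨r1, r2⟩ := hw (fun _ => d0) A B g f u u1 u2 (Fs / ε) Fs ⟨fun _ => le_rfl, fun _ _ => by simp⟩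
    (fun x _ => hc.el x) (hc.hA.subset (subset_univ _)) (hc.hB.subset (subset_univ _)) (hc.hg.subset (subset_univ _))
    (fun x _ => hu x trivial) (by positivity) hF (fun x _ => b0 x)
    ⟨K, fun x _ => (mul_le_of_le_one_left (norm_nonneg _) hd1).trans (k1.1 x trivial), wh hK k2⟩ (wh hF hf) (fun x _ => hL x)
  obtain ⟨X, hX⟩ : ∃ X, X = C * (1 / ε + 1) / d0 ^ 3 * Fs := ⟨_, rfl⟩
  have hX0 : 0 ≤ X := by rw [hX]; positivity
  have e : C * (Fs / ε + Fs) = X * d0 ^ 3 := by rw [hX]; field_simp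
  rw [e] at r1 r2
  have d2 : d0 ^ 3 ≤ d0 ^ 2 := pow_le_pow_of_le_one hd0.le hd1 (by norm_num)
  have d1 : d0 ^ 3 ≤ d0 := by simpa using pow_le_pow_of_le_one hd0.le hd1 (show 1 ≤ 3 by norm_num)
  have b1 : ∀ x, ‖u1 x‖ ≤ X := fun x => le_of_mul_le_mul_left ((r1 x hd0).trans (by
    rw [mul_comm]; exact mul_le_mul_of_nonneg_right d1 hX0)) hd0
  have b2 : ∀ x, ‖u2 x‖ ≤ X := fun x => le_of_mul_le_mul_left ((r2 x hd0).1.trans (by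
    rw [mul_comm]; exact mul_le_mul_of_nonneg_right d2 hX0)) (by positivity : 0 < d0 ^ 2)
  have b3 : Hol α X u2 univ := fun x _ y _ => by
    have := (r2 x hd0).2 y hd0
    rw [min_self] at this
    refine le_of_mul_le_mul_left (this.trans ?_) pa
    have : 0 ≤ X * ‖x - y‖ ^ α := by positivity
    calc _ = d0 ^ 3 * (X * ‖x - y‖ ^ α) := by ring
      _ ≤ _ := by gcongr
  have e2 : (2 / ε + 3 * (C * (1 / ε + 1) / d0 ^ 3)) * Fs = 2 * (Fs / ε) + 3 * X := by rw [hX]; ring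
  have e3 : 0 ≤ Fs / ε := by positivity
  rw [e2]
  exact ⟨hu, (lip_hol h0 h1 (fun x _ => b0 x) (mv_ball convex_univ (fun x hx => (hu x hx).1) fun x _ => b1 x) e3 hX0).mono (by linarith),
    (lip_hol h0 h1 (fun x _ => b1 x) (mv_ball convex_univ (fun x hx => (hu x hx).2) fun x _ => b2 x) hX0 hX0).mono (by linarith),
    Sz.mono ⟨fun x _ => b2 x, b3⟩ (by linarith)⟩

def Solv (α C : ℝ) (A : EE d → D2 d) (B : EE d → D1 d) (g : EE d → ℝ) : Prop :=
  ∀ f, (∃ Fs, Sz α Fs f univ) → ∃ u u1 u2, (∀ Fs, Sz α Fs f univ → Good α (C * Fs) u u1 u2) ∧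
    ∀ x, Lop (A x) (B x) (g x) (u2 x) (u1 x) (u x) = f x

lemma Lop_Sz {α θ K : ℝ} {A : EE d → D2 d} {B : EE d → D1 d} {g u : EE d → ℝ} {u1 u2} (hA : Sz α θ A univ) (hB : Sz α θ B univ)
    (hg : Sz α θ g univ) (hu : Sz α K u univ) (hu1 : Sz α K u1 univ) (hu2 : Sz α K u2 univ) :
    Sz α (6 * θ * K) (fun x => Lop (A x) (B x) (g x) (u2 x) (u1 x) (u x)) univ := by
  have hK := hu.nonneg univ_nonempty
  have hθ := hg.nonneg univ_nonempty
  have s1 := hA.bil hu2 (c := 1) zero_le_one hK hθ (fun x _ h => absurd trivial h) (fun p q => p q) (fun _ _ _ => rfl)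
    (fun _ _ _ => map_sub _ _ _) (fun p q => by rw [one_mul]; exact p.le_opNorm q)
  have s2 := hB.bil hu1 (c := 1) zero_le_one hK hθ (fun x _ h => absurd trivial h) (fun p q => p q) (fun _ _ _ => rfl)
    (fun _ _ _ => map_sub _ _ _) (fun p q => by rw [one_mul]; exact p.le_opNorm q)
  have s3 := hg.smul hu hK hθ (fun x _ h => absurd trivial h)
  have s1' : Sz α (2 * θ * K) (fun x => A x (u2 x)) univ := by rw [mul_one] at s1; exact s1
  have s2' : Sz α (2 * θ * K) (fun x => B x (u1 x)) univ := by rw [mul_one] at s2; exact s2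
  refine ((((s2'.sub s1').add s3)).mono (by linarith : _ ≤ 6 * θ * K)).congr fun x _ => ?_
  simp only [Lop, smul_eq_mul]; ring

lemma Sz.tsum [CompleteSpace F] {α c : ℝ} (w : ℕ → EE d → F) (h : ∀ n, Sz α (c * (1/2) ^ n) (w n) univ) :
    (∀ x, Summable fun n => w n x) ∧ Sz α (c * 2) (fun x => ∑' n, w n x) univ := by
  have hs : HasSum (fun n : ℕ => c * (1/2:ℝ) ^ n) (c * 2) := hasSum_geometric_two.mul_left c
  have sm : ∀ x, Summable fun n => w n x := fun x => .of_norm_bounded hs.summable fun n => (h n).1 x trivial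
  refine ⟨sm, fun x _ => tsum_of_norm_bounded hs fun n => (h n).1 x trivial, fun x _ y _ => ?_⟩
  beta_reduce
  rw [← (sm x).tsum_sub (sm y)]
  exact tsum_of_norm_bounded (hs.mul_right _) fun n => (h n).2 x trivial y trivial

theorem solv_step {α C θ : ℝ} (hC : 0 ≤ C) (hθC : 6 * θ * C ≤ 1 / 2) {A A' : EE d → D2 d} {B B' : EE d → D1 d} {g g' : EE d → ℝ}
    (hS : Solv α C A B g) (hA : Sz α θ (fun x => A' x - A x) univ) (hB : Sz α θ (fun x => B' x - B x) univ)
    (hg : Sz α θ (fun x => g' x - g x) univ) : Solv α (C * 2) A' B' g' := by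
  have h : ∀ f : EE d → ℝ, ∃ w : (EE d → ℝ) × (EE d → E1 d) × (EE d → E2 d), (∃ Fs, Sz α Fs f univ) →
    (∀ Fs, Sz α Fs f univ → Good α (C * Fs) w.1 w.2.1 w.2.2) ∧
    ∀ x, Lop (A x) (B x) (g x) (w.2.2 x) (w.2.1 x) (w.1 x) = f x := fun f => by
    by_cases hf : ∃ Fs, Sz α Fs f univ
    · obtain ⟨u, u1, u2, h⟩ := hS f hf; exact ⟨⟨u, u1, u2⟩, fun _ => h⟩
    · exact ⟨⟨0, 0, 0⟩, fun h => absurd h hf⟩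
  choose S hS using h
  intro f0 ⟨F0, hF0⟩
  let E : (EE d → ℝ) → EE d → ℝ := fun f x => Lop (A x - A' x) (B x - B' x) (g x - g' x) ((S f).2.2 x) ((S f).2.1 x) ((S f).1 x)
  let f : ℕ → EE d → ℝ := fun n => E^[n] f0
  have fs : ∀ n, f (n+1) = E (f n) := fun n => Function.iterate_succ_apply' _ _ _
  have fz : ∀ Fs, Sz α Fs f0 univ → ∀ n, Sz α (Fs * (1/2) ^ n) (f n) univ := fun Fs hFs n => by
    induction n with
    | zero => change Sz α _ f0 univ; simpa using hFs
    | succ n ih =>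
      rw [fs]
      obtain ⟨-, q1, q2, q3⟩ := (hS _ ⟨_, ih⟩).1 _ ih
      have ng : ∀ {G : Type} [NormedAddCommGroup G] {p q : EE d → G}, Sz α θ (fun x => p x - q x) univ → Sz α θ (fun x => q x - p x) univ :=
        fun {G _ p q} h => ⟨fun x hx => by rw [norm_sub_rev]; exact h.1 x hx, fun x hx y hy => by
          have := h.2 x hx y hy; rw [← norm_neg] at this; refine le_of_eq_of_le (congrArg _ ?_) this; beta_reduce; abel⟩
      refine (Lop_Sz (ng hA) (ng hB) (ng hg) q1 q2 q3).mono ?_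
      have : 0 ≤ Fs * (1/2) ^ n := ih.nonneg univ_nonempty
      calc _ = (6 * θ * C) * (Fs * (1/2) ^ n) := by ring
        _ ≤ 1/2 * (Fs * (1/2) ^ n) := by gcongr
        _ = _ := by ring
  have gd : ∀ Fs, Sz α Fs f0 univ → ∀ n, Good α (C * Fs * (1/2) ^ n) (S (f n)).1 (S (f n)).2.1 (S (f n)).2.2 := fun Fs hFs n => by
    rw [mul_assoc]; exact (hS _ ⟨_, fz Fs hFs n⟩).1 _ (fz Fs hFs n)
  have g0 := gd F0 hF0
  have s0 := fun Fs hFs => Sz.tsum (fun n => (S (f n)).1) fun n => (gd Fs hFs n).2.1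
  have s1 := fun Fs hFs => Sz.tsum (fun n => (S (f n)).2.1) fun n => (gd Fs hFs n).2.2.1
  have s2 := fun Fs hFs => Sz.tsum (fun n => (S (f n)).2.2) fun n => (gd Fs hFs n).2.2.2
  have sg : Summable fun n : ℕ => C * F0 * (1/2:ℝ) ^ n := summable_geometric_two.mul_left _
  refine ⟨fun x => ∑' n, (S (f n)).1 x, fun x => ∑' n, (S (f n)).2.1 x, fun x => ∑' n, (S (f n)).2.2 x, fun Fs hFs => ⟨fun x _ => ⟨?_, ?_⟩, ?_, ?_, ?_⟩, fun x => ?_⟩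
  · exact hasFDerivAt_tsum sg (fun n x => ((g0 n).1 x trivial).1) (fun n x => (g0 n).2.2.1.1 x trivial) ((s0 F0 hF0).1 0) x
  · exact hasFDerivAt_tsum sg (fun n x => ((g0 n).1 x trivial).2) (fun n x => (g0 n).2.2.2.1 x trivial) ((s1 F0 hF0).1 0) x
  · exact ((s0 Fs hFs).2).mono (by linarith)
  · exact ((s1 Fs hFs).2).mono (by linarith)
  · exact ((s2 Fs hFs).2).mono (by linarith)
  · have q0 := ((s0 F0 hF0).1 x).hasSum.mul_left (g' x)
    have q1 := ((s1 F0 hF0).1 x).hasSum.mapL (B' x)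
    have q2 := (((s2 F0 hF0).1 x).hasSum.mapL (A' x)).neg
    have q := ((q2.add q1).add q0).tendsto_sum_nat
    have tz : Tendsto (fun n => f n x) atTop (𝓝 0) := by
      refine squeeze_zero_norm (fun n => (fz F0 hF0 n).1 x trivial) ?_
      simpa using (tendsto_pow_atTop_nhds_zero_of_lt_one (by norm_num : (0:ℝ) ≤ 1/2) (by norm_num)).const_mul F0
    have t2 : Tendsto (fun n => f 0 x - f n x) atTop (𝓝 (f 0 x)) := by simpa using tz.const_sub (f 0 x)
    refine tendsto_nhds_unique (q.congr fun n => ?_) t2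
    rw [← Finset.sum_range_sub' (fun n => f n x)]
    refine Finset.sum_congr rfl fun k _ => ?_
    beta_reduce
    rw [fs, ← (hS _ ⟨_, fz F0 hF0 k⟩).2 x]
    simp only [E, Lop, sub_apply]; ring

def EllA (l : ℝ) (A : D2 d) : Prop := ∃ a, EllQ l a ∧ A = Aof a

lemma EllA_tr {l : ℝ} (h0 : 0 < l) (h1 : l ≤ 1) : EllA l (trE (d := d)) := by
  have e : ∀ x : EE d, qf (fun i j => if i = j then 1 else 0) x = ell x x := fun x => by
    simp [qf, ell_apply]
  refine ⟨fun i j => if i = j then 1 else 0, ⟨fun i j => by simp [eq_comm], fun x => ?_⟩, ?_⟩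
  · rw [e]
    have := ell_nonneg x
    exact ⟨mul_le_of_le_one_left this h1, le_mul_of_one_le_left this ((one_le_inv₀ h0).2 h1)⟩
  · ext T; simp [Aof_apply, QM_apply]

lemma EllA.comb {l t : ℝ} {A A' : D2 d} (h : EllA l A) (h' : EllA l A') (t0 : 0 ≤ t) (t1 : t ≤ 1) :
    EllA l (A + t • (A' - A)) := by
  obtain ⟨a, ⟨s1, q1⟩, rfl⟩ := h
  obtain ⟨a', ⟨s2, q2⟩, rfl⟩ := h'
  have e : ∀ x, qf (fun i j => a i j + t * (a' i j - a i j)) x = (1 - t) * qf a x + t * qf a' x := fun x => by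
    simp only [qf, Finset.mul_sum, ← Finset.sum_add_distrib]
    exact Finset.sum_congr rfl fun i _ => Finset.sum_congr rfl fun j _ => by ring
  refine ⟨fun i j => a i j + t * (a' i j - a i j), ⟨fun i j => by beta_reduce; rw [s1 i j, s2 i j], fun x => ?_⟩, ?_⟩
  · rw [e]
    obtain ⟨p1, p2⟩ := q1 x
    obtain ⟨p3, p4⟩ := q2 x
    have := sub_nonneg.2 t1
    constructor
    · linarith [mul_le_mul_of_nonneg_left p1 this, mul_le_mul_of_nonneg_left p3 t0]
    · linarith [mul_le_mul_of_nonneg_left p2 this, mul_le_mul_of_nonneg_left p4 t0]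
  · ext T
    simp only [Aof_apply, add_apply, smul_apply, sub_apply, smul_eq_mul, ← Finset.sum_sub_distrib, Finset.mul_sum, ← Finset.sum_add_distrib]
    exact Finset.sum_congr rfl fun i _ => Finset.sum_congr rfl fun j _ => by ring

lemma EllA.toEll {l : ℝ} (h0 : 0 < l) (h1 : l ≤ 1) {A : D2 d} (h : EllA l A) : Ell (d / l + 1) A := by
  obtain ⟨a, h, rfl⟩ := h; exact ellQ_Ell h0 h1 h

lemma Sz.csmul {α K t : ℝ} {f : EE d → F} {S : Set (EE d)} (h : Sz α K f S) (ht : 0 ≤ t) : Sz α (t * K) (fun x => t • f x) S := by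
  refine ⟨fun x hx => ?_, fun x hx y hy => ?_⟩
  · rw [norm_smul, Real.norm_of_nonneg ht]; gcongr; exact h.1 x hx
  · rw [← smul_sub, norm_smul, Real.norm_of_nonneg ht, mul_assoc]; gcongr; exact h.2 x hx y hy

set_option maxHeartbeats 1000000 in
theorem solve {α l β ε Fs : ℝ} (h0 : 0 < α) (h1 : α < 1) (hl0 : 0 < l) (hl1 : l ≤ 1) (hε : 0 < ε)
    {A : EE d → D2 d} {B : EE d → D1 d} {g f : EE d → ℝ} (hE : ∀ x, EllA l (A x)) (hA : Hol α β A univ) (hB : Sz α β B univ)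
    (hg : Sz α β g univ) (hge : ∀ x, ε ≤ g x) (hf : Sz α Fs f univ) :
    ∃ u u1 u2, (∃ K, Good α K u u1 u2) ∧ ∀ x, Lop (A x) (B x) (g x) (u2 x) (u1 x) (u x) = f x := by
  have hβ := hB.nonneg univ_nonempty
  set m := d / l + 1
  have hm : 1 ≤ m := le_add_of_nonneg_left (by positivity)
  obtain ⟨C, hC, hgl⟩ := glob (d := d) (β := β + 1) (ε := min ε 1) h0 h1 hm (by linarith) (by positivity)
  obtain ⟨c0, hc0⟩ : ∃ c, c = ‖trE (d := d)‖ := ⟨_, rfl⟩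
  have hc00 : 0 ≤ c0 := by rw [hc0]; exact norm_nonneg _
  obtain ⟨T, hT⟩ : ∃ T, T = d * m ^ 2 + c0 + β + 1 := ⟨_, rfl⟩
  have hT0 : 0 ≤ T := by rw [hT]; positivity
  have hdm : 0 ≤ d * m ^ 2 := by positivity
  have cst : ∀ {G : Type} [NormedAddCommGroup G] (c : G), Sz α ‖c‖ (fun _ : EE d => c) univ := fun c =>
    ⟨fun _ _ => le_rfl, fun x _ y _ => by rw [sub_self, norm_zero]; positivity⟩
  have zA : Sz α T (fun x => A x - trE) univ := by
    refine ⟨fun x _ => ?_, fun x hx y hy => ?_⟩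
    · have := ((hE x).toEll hl0 hl1).norm_le
      refine (norm_sub_le _ _).trans ?_
      rw [← hc0]; linarith
    · rw [sub_sub_sub_cancel_right]; exact (hA.mono (by linarith)) x hx y hy
  have zB : Sz α T B univ := hB.mono (by linarith)
  have zg : Sz α T (fun x => g x - 1) univ := (hg.sub (cst (1:ℝ))).mono (by rw [norm_one]; linarith)
  obtain ⟨n, hn⟩ := exists_nat_gt (12 * C * T)
  have hn0 : (0:ℝ) < n := lt_of_le_of_lt (by positivity) hn
  let S : ℝ → Prop := fun t => ∃ C, 0 ≤ C ∧ Solv α C (fun x => trE + t • (A x - trE)) (fun x => t • B x) (fun x => 1 + t * (g x - 1))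
  have up : ∀ t, 0 ≤ t → t ≤ 1 → S t → Solv α C (fun x => trE + t • (A x - trE)) (fun x => t • B x) (fun x => 1 + t * (g x - 1)) := by
    rintro t t0 t1 ⟨C', -, h⟩ f ⟨Fs, hf⟩
    obtain ⟨u, u1, u2, q1, q2⟩ := h f ⟨Fs, hf⟩
    refine ⟨u, u1, u2, fun F' hF' => hgl _ _ _ f u u1 u2 F' ⟨fun x => ?_, ?_, ?_, ?_, fun x => ?_⟩ ⟨_, q1 _ hF'⟩ hF' q2, q2⟩
    · exact ((EllA_tr hl0 hl1).comb (hE x) t0 t1).toEll hl0 hl1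
    · intro x hx y hy
      have : trE + t • (A x - trE) - (trE + t • (A y - trE)) = t • (A x - A y) := by module
      rw [this, norm_smul, Real.norm_of_nonneg t0]
      exact (mul_le_of_le_one_left (norm_nonneg _) t1).trans ((hA.mono (by linarith)) x hx y hy)
    · exact (hB.csmul t0).mono (by linarith [mul_le_of_le_one_left hβ t1])
    · refine (((cst (1 - t : ℝ)).add (hg.csmul t0)).mono ?_).congr fun x _ => by simp only [smul_eq_mul]; ring
      rw [Real.norm_of_nonneg (by linarith)]; linarith [mul_le_of_le_one_left hβ t1]
    · have a1 := mul_le_mul_of_nonneg_left ((min_le_left ε 1).trans (hge x)) t0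
      have a2 := mul_le_mul_of_nonneg_left (min_le_right ε 1) (sub_nonneg.2 t1)
      linarith
  have ind : ∀ k : ℕ, k ≤ n → S (k / n) := fun k => by
    induction k with
    | zero =>
      intro _
      obtain ⟨C, hC, hr⟩ := res_main (d := d) h0 h1
      refine ⟨3 * C, by positivity, fun f ⟨Fs, hf⟩ => ⟨Res f, Res1 f, Res2 f, fun Fs hf => ?_, fun x => ?_⟩⟩
      · have hF := hf.nonneg univ_nonempty
        have hCF : 0 ≤ C * Fs := by positivity
        obtain ⟨r1, r2, r3, r4, r5, r6, -⟩ := hr f Fs Fs hF (fun x => hf.1 x trivial) hf.2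
        have e : 3 * C * Fs = 2 * (C * Fs) + C * Fs := by ring
        refine ⟨fun x _ => ⟨r1 x, r2 x⟩, ?_, ?_, ?_⟩
        · rw [e]; exact lip_hol h0 h1 (fun x _ => r3 x) (mv_ball convex_univ (fun x _ => r1 x) fun x _ => r4 x) hCF hCF
        · rw [e]; exact lip_hol h0 h1 (fun x _ => r4 x) (mv_ball convex_univ (fun x _ => r2 x) fun x _ => r5 x) hCF hCF
        · exact Sz.mono ⟨fun x _ => r5 x, r6⟩ (by linarith)
      · have := (hr f Fs Fs (hf.nonneg univ_nonempty) (fun x => hf.1 x trivial) hf.2).2.2.2.2.2.2 x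
        rw [← this]; simp [Lop]; ring
    | succ k ih =>
      intro hk
      have hk' : (k:ℝ) + 1 ≤ n := by exact_mod_cast hk
      have t0 : (0:ℝ) ≤ k / n := by positivity
      have t1 : (k:ℝ) / n ≤ 1 := (div_le_one hn0).2 (by linarith)
      have n0 : (0:ℝ) ≤ 1 / n := by positivity
      have e : ((k + 1 : ℕ) : ℝ) / n = k / n + 1 / n := by push_cast; ring
      refine ⟨C * 2, by positivity, ?_⟩
      refine solv_step hC (θ := 1 / n * T) ?_ (up _ t0 t1 (ih (by omega))) ?_ ?_ ?_
      · rw [show 6 * (1 / n * T) * C = (6 * T * C) / n by ring, div_le_iff₀ hn0]; linarith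
      · exact (zA.csmul n0).congr fun x _ => by rw [e]; module
      · exact (zB.csmul n0).congr fun x _ => by rw [e]; module
      · exact (zg.csmul n0).congr fun x _ => by rw [e, smul_eq_mul]; ring
  have h := ind n le_rfl
  rw [div_self hn0.ne'] at h
  obtain ⟨u, u1, u2, q1, q2⟩ := up 1 zero_le_one le_rfl h f ⟨_, hf⟩
  refine ⟨u, u1, u2, ⟨_, q1 _ hf⟩, fun x => ?_⟩
  rw [← q2 x]; simp
end

section
open MeasureTheory Set Filter Topology
open scoped SchwartzMap ContDiff

open scoped SI
set_option linter.unusedSectionVars false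
variable {d : ℕ} {F : Type} [NormedAddCommGroup F] [NormedSpace ℝ F]

lemma Sz_const {α : ℝ} (c : F) : Sz α ‖c‖ (fun _ : EE d => c) univ :=
  ⟨fun _ _ => le_rfl, fun x _ y _ => by rw [sub_self, norm_zero]; positivity⟩

lemma extA {α l β L : ℝ} (hl0 : 0 < l) (hl1 : l ≤ 1) (hβ : 0 ≤ β) {χ : EE d → ℝ} {S : Set (EE d)} (hχ : Sz α L χ univ)
    (h01 : ∀ x, 0 ≤ χ x ∧ χ x ≤ 1) (hz : ∀ x, x ∉ S → χ x = 0) {A : EE d → D2 d} {B : EE d → D1 d} {g : EE d → ℝ}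
    (hE : ∀ x ∈ S, EllA l (A x)) (hA : Hol α β A S) (hB : Sz α β B S) (hg : Sz α β g S) :
    ∃ β', 0 ≤ β' ∧ (∀ x, EllA l (trE + χ x • (A x - trE))) ∧ Sz α β' (fun x => trE + χ x • (A x - trE)) univ ∧
      Sz α β' (fun x => χ x • B x) univ ∧ Sz α β' (fun x => χ x • g x) univ := by
  have hL := hχ.nonneg univ_nonempty
  obtain ⟨m, hm⟩ : ∃ m : ℝ, m = d / l + 1 := ⟨_, rfl⟩
  obtain ⟨c0, hc0⟩ : ∃ c, c = ‖trE (d := d)‖ := ⟨_, rfl⟩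
  have hc00 : 0 ≤ c0 := by rw [hc0]; exact norm_nonneg _
  have hdm : 0 ≤ d * m ^ 2 := by positivity
  have zA : Sz α (d * m ^ 2 + c0 + β) (fun x => A x - trE) S := by
    refine ⟨fun x hx => ?_, fun x hx y hy => ?_⟩
    · have := ((hE x hx).toEll hl0 hl1).norm_le
      refine (norm_sub_le _ _).trans ?_
      rw [← hc0, hm]; linarith
    · rw [sub_sub_sub_cancel_right]; exact (hA.mono (by linarith)) x hx y hy
  have s1 := (Sz_const (trE (d := d))).add (hχ.smul zA (by positivity) hL fun x _ => hz x)
  have s2 := hχ.smul hB hβ hL fun x _ => hz x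
  have s3 := hχ.smul hg hβ hL fun x _ => hz x
  rw [← hc0] at s1
  have p1 : 0 ≤ c0 + 2 * L * (d * m ^ 2 + c0 + β) := by positivity
  have p2 : 0 ≤ 2 * L * β := by positivity
  refine ⟨_, add_nonneg p1 p2, fun x => ?_, s1.mono (by linarith), s2.mono (by linarith), s3.mono (by linarith)⟩
  by_cases hx : x ∈ S
  · exact (EllA_tr hl0 hl1).comb (hE x hx) (h01 x).1 (h01 x).2
  · rw [hz x hx, zero_smul, add_zero]; exact EllA_tr hl0 hl1

lemma cut_at {α : ℝ} (h0 : 0 < α) (h1 : α < 1) (x₀ : EE d) {ρ : ℝ} (hρ : 0 < ρ) :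
    ∃ (η : EE d → ℝ) (η1 : EE d → E1 d) (η2 : EE d → E2 d) (L : ℝ),
    0 ≤ L ∧ IsC2 η η1 η2 univ ∧ Sz α L η univ ∧ Sz α L η1 univ ∧ Sz α L η2 univ ∧
    (∀ x, ‖x - x₀‖ ≤ ρ / 2 → η x = 1 ∧ η1 x = 0 ∧ η2 x = 0) ∧ (∀ x, 3 / 4 * ρ < ‖x - x₀‖ → η x = 0 ∧ η1 x = 0 ∧ η2 x = 0) ∧
    ∀ x, 0 ≤ η x ∧ η x ≤ 1 := by
  obtain ⟨η, η1, η2, L, hL, c1, c2, c3, c4, c5, c6, c7⟩ := exists_cut (d := d) h0 h1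
  have hr : 0 < ρ⁻¹ := inv_pos.2 hρ
  have e : ∀ x, ρ⁻¹ • (-x₀) + ρ⁻¹ • x = ρ⁻¹ • (x - x₀) := fun x => by module
  have en : ∀ x : EE d, ‖ρ⁻¹ • x‖ = ‖x‖ / ρ := fun x => by rw [norm_smul, Real.norm_of_nonneg hr.le]; ring
  have c1' := c1.scale (V := univ) (ρ⁻¹ • (-x₀)) ρ⁻¹ fun _ _ => trivial
  simp only [e] at c1'
  obtain ⟨t, ht⟩ : ∃ t, t = ρ⁻¹ := ⟨_, rfl⟩
  have sz : ∀ {G : Type} [NormedAddCommGroup G] {φ : EE d → G}, Sz α L φ univ →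
      Sz α (L * (1 + t ^ α)) (fun x => φ (t • (x - x₀))) univ := fun {G _ φ} h => by
    rw [← ht] at hr
    refine ⟨fun x _ => (h.1 _ trivial).trans (le_mul_of_one_le_right hL (le_add_of_nonneg_right (by positivity))), fun x _ y _ => (h.2 _ trivial _ trivial).trans ?_⟩
    have : t • (x - x₀) - t • (y - x₀) = t • (x - y) := by module
    rw [this, norm_smul, Real.norm_of_nonneg hr.le, Real.mul_rpow hr.le (norm_nonneg _)]
    have p1 : 0 ≤ t ^ α := by positivity
    have p2 : 0 ≤ L * ‖x - y‖ ^ α := by positivity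
    linarith
  rw [← ht] at c1' en hr
  have q : 0 ≤ L * (1 + t ^ α) := by positivity
  refine ⟨_, _, _, (1 + t + t ^ 2) * (L * (1 + t ^ α)), by positivity, c1', (sz c2).mono ?_, ((sz c3).csmul hr.le).mono ?_, ((sz c4).csmul (sq_nonneg t)).mono ?_,
    fun x hx => ?_, fun x hx => ?_, fun x => c7 _⟩
  · nlinarith [mul_nonneg hr.le q, mul_nonneg (sq_nonneg t) q]
  · nlinarith [mul_nonneg hr.le q, mul_nonneg (sq_nonneg t) q]
  · nlinarith [mul_nonneg hr.le q, mul_nonneg (sq_nonneg t) q]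
  · obtain ⟨a, b, c⟩ := c5 (t • (x - x₀)) (by rw [en, div_le_iff₀ hρ]; linarith)
    simp [a, b, c]
  · obtain ⟨a, b, c⟩ := c6 (t • (x - x₀)) (by rw [en, lt_div_iff₀ hρ]; linarith)
    simp [a, b, c]

lemma isC2_cutG {η u : EE d → ℝ} {η1 η2 u1 u2} {U Z : Set (EE d)} (hZ : IsClosed Z) (hZU : Z ⊆ U) (hη : IsC2 η η1 η2 univ)
    (hz : ∀ x, x ∉ Z → η x = 0 ∧ η1 x = 0 ∧ η2 x = 0) (hu : IsC2 u u1 u2 U) :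
    IsC2 (fun x => η x * u x) (fun x => η x • u1 x + u x • η1 x)
      (fun x => η x • u2 x + u x • η2 x + sten (η1 x) (u1 x)) univ := by
  intro x _
  by_cases hx : x ∈ Z
  · exact (show IsC2 η η1 η2 U from fun y _ => hη y trivial).mul hu x (hZU hx)
  · have hn : Zᶜ ∈ 𝓝 x := hZ.isOpen_compl.mem_nhds hx
    obtain ⟨e0, e1, e2⟩ := hz x hx
    constructor
    · beta_reduce; rw [e0, e1]; simp only [zero_smul, smul_zero, add_zero]
      refine (hasFDerivAt_const (0:ℝ) x).congr_of_eventuallyEq ?_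
      filter_upwards [hn] with y hy; simp [(hz y hy).1]
    · have : sten (0 : E1 d) (u1 x) = 0 := by ext v w; simp [sten_apply]
      beta_reduce; rw [e0, e1, e2, this]; simp only [zero_smul, smul_zero, add_zero]
      refine (hasFDerivAt_const (0 : E1 d) x).congr_of_eventuallyEq ?_
      filter_upwards [hn] with y hy; simp [(hz y hy).1, (hz y hy).2.1]

structure LCls (α l β : ℝ) (A : EE d → D2 d) (B : EE d → D1 d) (g : EE d → ℝ) (S : Set (EE d)) : Prop where
  el : ∀ x ∈ S, EllA l (A x)
  hA : Hol α β A S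
  hB : Sz α β B S
  hg : Sz α β g S

lemma LCls.subset {α l β : ℝ} {A : EE d → D2 d} {B : EE d → D1 d} {g : EE d → ℝ} {S T : Set (EE d)} (h : LCls α l β A B g S) (hT : T ⊆ S) :
    LCls α l β A B g T := ⟨fun x hx => h.el x (hT hx), h.hA.subset hT, h.hB.subset hT, h.hg.subset hT⟩

def IsSol (A : EE d → D2 d) (B : EE d → D1 d) (g u : EE d → ℝ) (u1 : EE d → E1 d) (u2 : EE d → E2 d) (S : Set (EE d)) : Prop :=
  IsC2 u u1 u2 S ∧ ContinuousOn u2 S ∧ ∀ x ∈ S, Lop (A x) (B x) (g x) (u2 x) (u1 x) (u x) = 0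

lemma IsSol.subset {A : EE d → D2 d} {B : EE d → D1 d} {g u : EE d → ℝ} {u1 : EE d → E1 d} {u2 : EE d → E2 d} {S T : Set (EE d)}
    (h : IsSol A B g u u1 u2 S) (hT : T ⊆ S) : IsSol A B g u u1 u2 T :=
  ⟨fun x hx => h.1 x (hT hx), h.2.1.mono hT, fun x hx => h.2.2 x (hT hx)⟩

set_option maxHeartbeats 1000000 in
theorem regul {α l β ρ : ℝ} (h0 : 0 < α) (h1 : α < 1) (hl0 : 0 < l) (hl1 : l ≤ 1) (hβ : 0 ≤ β) (hρ : 0 < ρ) {x₀ : EE d}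
    {A : EE d → D2 d} {B : EE d → D1 d} {g u : EE d → ℝ} {u1 u2} (hc : LCls α l β A B g (Metric.ball x₀ ρ))
    (hu : IsSol A B g u u1 u2 (Metric.ball x₀ ρ)) : ∃ K, 0 ≤ K ∧ Sz α K u2 (Metric.ball x₀ (ρ / 4)) ∧ ∀ x ∈ Metric.ball x₀ (ρ / 4), ‖u1 x‖ ≤ K := by
  obtain ⟨χ, χ1, χ2, L, hL, -, hχ, -, -, ha, hb, h01⟩ := cut_at h0 h1 x₀ hρ
  obtain ⟨η, η1, η2, L', hL', k1, k2, k3, k4, k5, k6, k7⟩ := cut_at h0 h1 x₀ (half_pos hρ)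
  obtain ⟨β', hβ', w1, w2, w3, w4⟩ := extA hl0 hl1 hβ hχ h01 (fun x hx => (hb x (by
    rw [Metric.mem_ball, dist_eq_norm, not_lt] at hx; linarith)).1) hc.el hc.hA hc.hB hc.hg
  set Z := Metric.closedBall x₀ (3 / 8 * ρ)
  have hZ : Z ⊆ Metric.ball x₀ ρ := Metric.closedBall_subset_ball (by linarith)
  have hcZ : IsCompact Z := isCompact_closedBall _ _
  have kz : ∀ x, x ∉ Z → η x = 0 ∧ η1 x = 0 ∧ η2 x = 0 := fun x hx => k6 x (by
    rw [Metric.mem_closedBall, dist_eq_norm, not_le] at hx; linarith)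
  have c0 : ContinuousOn u Z := fun x hx => (hu.1 x (hZ hx)).1.continuousAt.continuousWithinAt
  have c1 : ContinuousOn u1 Z := fun x hx => (hu.1 x (hZ hx)).2.continuousAt.continuousWithinAt
  obtain ⟨N0, n0⟩ := hcZ.exists_bound_of_continuousOn c0
  obtain ⟨N1, n1⟩ := hcZ.exists_bound_of_continuousOn c1
  obtain ⟨N2, n2⟩ := hcZ.exists_bound_of_continuousOn (hu.2.1.mono hZ)
  have hne : x₀ ∈ Z := Metric.mem_closedBall_self (by linarith)
  have p0 := (norm_nonneg _).trans (n0 _ hne)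
  have p1 := (norm_nonneg _).trans (n1 _ hne)
  have p2 := (norm_nonneg _).trans (n2 _ hne)
  have s0 := (lip_hol h0 h1 n0 (mv_ball (convex_closedBall _ _) (fun x hx => (hu.1 x (hZ hx)).1) n1) p0 p1).mono
    (by linarith : _ ≤ 2 * N0 + 3 * N1 + N2)
  have s1 := (lip_hol h0 h1 n1 (mv_ball (convex_closedBall _ _) (fun x hx => (hu.1 x (hZ hx)).2) n2) p1 p2).mono
    (by linarith : _ ≤ 2 * N0 + 3 * N1 + N2)
  obtain ⟨N, hN⟩ : ∃ N, N = 2 * N0 + 3 * N1 + N2 := ⟨_, rfl⟩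
  rw [← hN] at s0 s1
  have hN0 := s0.nonneg ⟨_, hne⟩
  have t0 : Sz α (2 * L' * N) (fun x => η x * u x) univ := k2.smul s0 hN0 hL' fun x _ h => (kz x h).1
  have bil : ∀ {G : Type} [NormedAddCommGroup G] [NormedSpace ℝ G] {φ : EE d → G}, Sz α L' φ univ → (∀ x, x ∉ Z → φ x = 0) →
      Sz α (2 * L' * N) (fun x => u x • φ x) univ := fun {G _ _ φ} h hz => by
    have := h.bil s0 (c := 1) zero_le_one hN0 hL' (fun x _ => hz x) (fun p q => q • p) (fun _ _ _ => smul_sub _ _ _) (fun _ _ _ => sub_smul _ _ _)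
      (fun p q => by rw [norm_smul]; linarith)
    rw [mul_one] at this; exact this
  have t1 := bil k3 fun x h => (kz x h).2.1
  have t2 : Sz α (4 * L' * N) (fun x => sten (η1 x) (u1 x)) univ := by
    have := k3.bil s1 (c := 2) zero_le_two hN0 hL' (fun x _ h => (kz x h).2.1) sten sten_sub_left sten_sub_right sten_norm
    norm_num at this; exact ⟨fun x _ => this.1 x, fun x _ y _ => this.2 x y⟩
  have t3 := (bil k4 fun x h => (kz x h).2.2).add t2
  have hLN : 0 ≤ L' * N := by positivity
  have gs : Sz α ‖β + 1‖ (fun _ : EE d => β + 1) univ := Sz_const _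
  rw [Real.norm_of_nonneg (by linarith)] at gs
  have fz := Lop_Sz (w2.mono (by linarith : β' ≤ β' + (β + 1))) (w3.mono (by linarith : β' ≤ β' + (β + 1)))
    (gs.mono (by linarith : β + 1 ≤ β' + (β + 1))) (t0.mono (by linarith : _ ≤ 6 * (L' * N))) (t1.mono (by linarith)) (t3.mono (by linarith))
  have g1 : ∀ x, 1 ≤ χ x • g x + (β + 1) := fun x => by
    by_cases hx : x ∈ Metric.ball x₀ ρ
    · have := (abs_le.1 (hc.hg.1 x hx)).1
      have a1 := mul_le_mul_of_nonneg_left this (h01 x).1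
      have a2 := mul_le_mul_of_nonneg_right (h01 x).2 hβ
      rw [smul_eq_mul]; linarith
    · rw [(hb x (by rw [Metric.mem_ball, dist_eq_norm, not_lt] at hx; linarith)).1, zero_smul]; linarith
  have hv := isC2_cutG Metric.isClosed_closedBall hZ k1 kz hu.1
  obtain ⟨v, v1, v2, ⟨K, gK⟩, hL⟩ := solve h0 h1 hl0 hl1 one_pos w1 (w2.2.mono (by linarith)) (w3.mono (by linarith))
    ((w4.add gs)) g1 fz
  have eq : ∀ x, v x = η x * u x := fun x => by
    have hd := hv.add (gK.1.smul (-1))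
    have := maxP_abs hd (K := 2 * L' * N + K) (ε := 1) (N := 0) (fun x => ?_) (fun x => (w1 x).toEll hl0 hl1) (fun x => w3.1 x trivial) one_pos g1 le_rfl
      (fun x => ?_) x
    · have := abs_nonpos_iff.1 (by linarith : |η x * u x + -1 * v x| ≤ 0); linarith
    · have a1 := t0.1 x trivial; have a2 := gK.2.1.1 x trivial
      rw [Real.norm_eq_abs] at a1 a2
      refine (abs_add_le _ _).trans ?_
      rw [neg_one_mul, abs_neg]; linarith
    · rw [Lop_add, Lop_smul, hL, abs_nonpos_iff]
      by_cases hx : x ∈ Z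
      · have e1 : χ x = 1 := (ha x (by rw [Metric.mem_closedBall, dist_eq_norm] at hx; linarith)).1
        have e2 := hu.2.2 x (hZ hx)
        simp only [Lop, e1, one_smul, add_sub_cancel, map_add, map_smul, smul_eq_mul] at e2 ⊢
        linear_combination η x * e2
      · obtain ⟨e1, e2, e3⟩ := kz x hx
        simp [Lop, e1, e2, e3]
  have un := IsC2.unique isOpen_univ hv ((funext eq : v = _) ▸ gK.1)
  have hK0 := gK.2.1.nonneg univ_nonempty
  have hin : ∀ x ∈ Metric.ball x₀ (ρ / 4), ‖x - x₀‖ ≤ ρ / 2 / 2 := fun x hx => by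
    rw [Metric.mem_ball, dist_eq_norm] at hx; linarith
  refine ⟨K, hK0, (gK.2.2.2.subset (subset_univ _)).congr fun x hx => ?_, fun x hx => ?_⟩
  · obtain ⟨e1, e2, e3⟩ := k5 x (hin x hx)
    have : sten (0 : E1 d) (u1 x) = 0 := by ext v w; simp [sten_apply]
    rw [← (un x trivial).2, e1, e2, e3, this]; simp
  · obtain ⟨e1, e2, e3⟩ := k5 x (hin x hx)
    have := gK.2.2.1.1 x trivial
    rw [← (un x trivial).1, e1, e2] at this; simpa using this

set_option maxHeartbeats 1000000 in
theorem intEst {α l β : ℝ} (h0 : 0 < α) (h1 : α < 1) (hl0 : 0 < l) (hl1 : l ≤ 1) (hβ : 0 ≤ β) :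
    ∃ d0 C, 0 < d0 ∧ d0 ≤ 1 ∧ 0 ≤ C ∧ ∀ (ρ : ℝ) (x₀ : EE d) (A : EE d → D2 d) (B : EE d → D1 d) (g u : EE d → ℝ) u1 u2 (N : ℝ), 0 < ρ → ρ ≤ d0 →
    LCls α l β A B g (Metric.ball x₀ ρ) → IsSol A B g u u1 u2 (Metric.ball x₀ ρ) → (∀ x ∈ Metric.ball x₀ ρ, |u x| ≤ N) →
    (∀ x ∈ Metric.ball x₀ (ρ / 8), ρ * ‖u1 x‖ ≤ C * N) ∧ ∀ x ∈ Metric.ball x₀ (ρ / 8), ρ ^ 2 * ‖u2 x‖ ≤ C * N ∧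
      ∀ y ∈ Metric.ball x₀ (ρ / 8), ρ ^ (2 + α) * ‖u2 x - u2 y‖ ≤ C * N * ‖x - y‖ ^ α := by
  set m := d / l + 1
  have hm : 1 ≤ m := le_add_of_nonneg_left (by positivity)
  obtain ⟨d0, C, hd0, hd1, hC, hw⟩ := weighted (d := d) h0 h1 hm hβ
  refine ⟨d0, 8 ^ 3 * C, hd0, hd1, by positivity, fun ρ x₀ A B g u u1 u2 N hρ hρd hc hu hN => ?_⟩
  have hN0 : 0 ≤ N := (abs_nonneg _).trans (hN x₀ (Metric.mem_ball_self hρ))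
  obtain ⟨K, hK, q2, q1⟩ := regul h0 h1 hl0 hl1 hβ hρ hc hu
  have hS : {x | 0 < ρ / 4 - ‖x - x₀‖} = Metric.ball x₀ (ρ / 4) := by ext x; simp [dist_eq_norm]
  have hsub : Metric.ball x₀ (ρ / 4) ⊆ Metric.ball x₀ ρ := Metric.ball_subset_ball (by linarith)
  have hm' : ∀ x, 0 < ρ / 4 - ‖x - x₀‖ → x ∈ Metric.ball x₀ (ρ / 4) := fun x hx => hS ▸ hx
  have hle : ∀ x, ρ / 4 - ‖x - x₀‖ ≤ 1 := fun x => by linarith [norm_nonneg (x - x₀)]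
  obtain ⟨r1, r2⟩ := hw (fun x => ρ / 4 - ‖x - x₀‖) A B g (fun _ => 0) u u1 u2 N 0
    ⟨fun x => by linarith [norm_nonneg (x - x₀)], fun x y => by
      rw [sub_sub_sub_cancel_left]; have := abs_norm_sub_norm_le (y - x₀) (x - x₀)
      rwa [sub_sub_sub_cancel_right, norm_sub_rev y x] at this⟩
    (by rw [hS]; exact fun x hx => (hc.el x (hsub hx)).toEll hl0 hl1) (by rw [hS]; exact hc.hA.subset hsub) (by rw [hS]; exact hc.hB.subset hsub)
    (by rw [hS]; exact hc.hg.subset hsub) (by rw [hS]; exact fun x hx => hu.1 x (hsub hx)) hN0 le_rfl (fun x hx => hN x (hsub (hm' x hx)))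
    ⟨K, fun x hx => (mul_le_of_le_one_left (norm_nonneg _) (hle x)).trans (q1 x (hm' x hx)), fun x hx =>
      ⟨(mul_le_of_le_one_left (norm_nonneg _) (pow_le_one₀ hx.le (hle x))).trans (q2.1 x (hm' x hx)), fun y hy =>
      (mul_le_of_le_one_left (norm_nonneg _) (Real.rpow_le_one (le_min hx.le hy.le) ((min_le_left _ _).trans (hle x)) (by linarith))).trans
        (q2.2 x (hm' x hx) y (hm' y hy))⟩⟩
    (fun x hx => ⟨by simp, fun y hy => by simp⟩) (fun x hx => hu.2.2 x (hsub (hm' x hx)))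
  rw [add_zero] at r1 r2
  have hCN : 0 ≤ C * N := by positivity
  have h8 : ∀ x ∈ Metric.ball x₀ (ρ / 8), ρ / 8 ≤ ρ / 4 - ‖x - x₀‖ := fun x hx => by
    rw [Metric.mem_ball, dist_eq_norm] at hx; linarith
  have hp : 0 < ρ / 8 := by positivity
  refine ⟨fun x hx => ?_, fun x hx => ⟨?_, fun y hy => ?_⟩⟩
  · have := r1 x (hp.trans_le (h8 x hx))
    have := (mul_le_mul_of_nonneg_right (h8 x hx) (norm_nonneg (u1 x))).trans this
    linarith
  · have := (r2 x (hp.trans_le (h8 x hx))).1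
    have := (mul_le_mul_of_nonneg_right (pow_le_pow_left₀ hp.le (h8 x hx) 2) (norm_nonneg (u2 x))).trans this
    linarith
  · have := (r2 x (hp.trans_le (h8 x hx))).2 y (hp.trans_le (h8 y hy))
    have := (mul_le_mul_of_nonneg_right (Real.rpow_le_rpow (z := 2 + α) hp.le (le_min (h8 x hx) (h8 y hy)) (by linarith)) (norm_nonneg (u2 x - u2 y))).trans this
    have e8 : (8:ℝ) ^ (2 + α) ≤ 8 ^ 3 := by
      rw [← Real.rpow_natCast]; exact Real.rpow_le_rpow_of_exponent_le (by norm_num) (by push_cast; linarith)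
    have e9 : (ρ / 8) ^ (2 + α) = ρ ^ (2 + α) / 8 ^ (2 + α) := Real.div_rpow hρ.le (by norm_num) _
    rw [e9, div_mul_eq_mul_div, div_le_iff₀ (by positivity)] at this
    refine this.trans ?_
    have : 0 ≤ C * N * ‖x - y‖ ^ α := by positivity
    linarith [mul_le_mul_of_nonneg_left e8 this]
end

section
open MeasureTheory Set Filter Topology
open scoped SchwartzMap ContDiff

open scoped SI
set_option linter.unusedSectionVars false
variable {d : ℕ} {F : Type} [NormedAddCommGroup F] [NormedSpace ℝ F]

lemma IsC2.compR {u : EE d → ℝ} {u1 u2} {U : Set (EE d)} (h : IsC2 u u1 u2 U) {φ φ1 φ2 : ℝ → ℝ}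
    (hφ : ∀ x ∈ U, HasDerivAt φ (φ1 (u x)) (u x) ∧ HasDerivAt φ1 (φ2 (u x)) (u x)) :
    IsC2 (fun x => φ (u x)) (fun x => φ1 (u x) • u1 x)
      (fun x => φ1 (u x) • u2 x + φ2 (u x) • ContinuousLinearMap.smulRight (u1 x) (u1 x)) U := by
  intro x hx
  obtain ⟨a1, a2⟩ := h x hx
  obtain ⟨b1, b2⟩ := hφ x hx
  refine ⟨b1.comp_hasFDerivAt x a1, ?_⟩
  refine (HasFDerivAt.smul (𝕜 := ℝ) (b2.comp_hasFDerivAt x a1) a2).congr_fderiv ?_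
  ext v w; simp; ring

lemma isC2_const (c : ℝ) (U : Set (EE d)) : IsC2 (fun _ => c) (fun _ => 0) (fun _ => 0) U :=
  fun x _ => ⟨hasFDerivAt_const c x, hasFDerivAt_const (0 : E1 d) x⟩

lemma EllA.lower {l : ℝ} {A : D2 d} (h : EllA l A) (p : E1 d) :
    l * ∑ i, p (eb i) * p (eb i) ≤ A (ContinuousLinearMap.smulRight p p) := by
  obtain ⟨a, ⟨-, h⟩, rfl⟩ := h
  have := (h fun i => p (eb i)).1
  rw [ell_apply] at this
  refine this.trans (le_of_eq ?_)
  simp only [qf, Aof_apply, ContinuousLinearMap.smulRight_apply, smul_apply, smul_eq_mul]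
  exact Finset.sum_congr rfl fun i _ => Finset.sum_congr rfl fun j _ => by ring

lemma EllA.nonpos {l : ℝ} (h0 : 0 < l) (h1 : l ≤ 1) {A : D2 d} (h : EllA l A) {T : E2 d} (hT : ∀ v, T v v ≤ 0) : A T ≤ 0 := by
  obtain ⟨M, rfl, -⟩ := h.toEll h0 h1; exact QM_nonpos _ hT

def qe (x₀ x : EE d) : ℝ := ell (x - x₀) (x - x₀)

lemma qe_isC2 (x₀ : EE d) : IsC2 (qe x₀) (fun x => (2:ℝ) • ell (x - x₀)) (fun _ => (2:ℝ) • ell) univ := by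
  have := (isC2_ell (d := d)).scale (V := univ) (-x₀) 1 fun _ _ => trivial
  simp only [one_smul, neg_add_eq_sub, one_pow] at this
  exact this

lemma qe_cont (x₀ : EE d) : Continuous (qe x₀) :=
  continuous_iff_continuousAt.2 fun x => ((qe_isC2 x₀) x trivial).1.continuousAt

lemma norm_of_qe {x₀ x : EE d} {R : ℝ} (hR : 0 ≤ R) (h : qe x₀ x ≤ R ^ 2) : ‖x - x₀‖ ≤ R :=
  (le_abs_self _).trans (abs_le_of_sq_le_sq ((sq_le_ell _).trans h) hR)

lemma barrier {l β : ℝ} (hl0 : 0 < l) (hl1 : l ≤ 1) (hβ : 0 ≤ β) : ∃ k : ℕ, 1 ≤ k ∧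
    ∀ (x₀ : EE d) (A : EE d → D2 d) (B : EE d → D1 d) (g u : EE d → ℝ) u1 u2 (U : Set (EE d)) (κ R s : ℝ), IsOpen U → 0 < κ → R ≤ 1 → 0 < R →
    (∀ x, qe x₀ x ≤ R ^ 2 → x ∈ U) → (∀ x ∈ U, EllA l (A x) ∧ ‖B x‖ ≤ β ∧ 0 ≤ g x ∧ g x ≤ β) → IsC2 u u1 u2 U →
    (∀ x ∈ U, 0 ≤ Lop (A x) (B x) (g x) (u2 x) (u1 x) (u x)) → (∀ x ∈ U, 0 ≤ u x) → 0 < s → (∀ x, qe x₀ x = κ ^ 2 → s ≤ u x) →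
    ∀ y, κ ^ 2 ≤ qe x₀ y → qe x₀ y ≤ R ^ 2 → s * (κ ^ 2) ^ k * (qe x₀ y ^ (-k:ℤ) - (R ^ 2) ^ (-k:ℤ)) ≤ u y := by
  obtain ⟨c, hc⟩ : ∃ c, c = ‖(2:ℝ) • ell (d := d)‖ := ⟨_, rfl⟩
  have hc0 : 0 ≤ c := by rw [hc]; exact norm_nonneg _
  obtain ⟨m, hm⟩ : ∃ m : ℝ, m = d / l + 1 := ⟨_, rfl⟩
  obtain ⟨k, hk⟩ := exists_nat_gt ((d * m ^ 2 * c + β * c + β) / (4 * l))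
  rw [div_lt_iff₀ (by positivity)] at hk
  refine ⟨k + 1, by omega, ?_⟩
  intro x₀ A B g u u1 u2 U κ R s hU hκ hR1 hR hsub hco hu hLu hu0 hs hsp y hy1 hy2
  set K := k + 1
  have hK1 : (1:ℝ) ≤ (K:ℝ) := by simp [K]
  have hKk : (K:ℝ) = k + 1 := by simp [K]
  set C := s * (κ ^ 2) ^ K
  have hC : 0 < C := by positivity
  by_contra! hcon
  let φ : ℝ → ℝ := fun t => t ^ (-K:ℤ)
  have hq := ((qe_isC2 x₀ : IsC2 _ _ _ univ))
  have hh : IsC2 (fun x => φ (qe x₀ x)) _ _ {x | 0 < qe x₀ x} := IsC2.compR (fun x _ => hq x trivial)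
    (φ := φ) (φ1 := fun t => ((-K:ℤ):ℝ) * t ^ ((-K:ℤ) - 1)) (φ2 := fun t => ((-K:ℤ):ℝ) * (((-K:ℤ) - 1 : ℤ) * t ^ ((-K:ℤ) - 1 - 1))) fun x hx =>
      ⟨hasDerivAt_zpow _ _ (Or.inl (ne_of_gt hx)), (hasDerivAt_zpow _ _ (Or.inl (ne_of_gt hx))).const_mul _⟩
  have hUo : IsOpen (U ∩ {x | 0 < qe x₀ x}) := hU.inter (isOpen_lt continuous_const (qe_cont x₀))
  have hv := (IsC2.smul (fun x hx => hu x hx.1 : IsC2 u u1 u2 (U ∩ {x | 0 < qe x₀ x})) (-1)).add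
    (IsC2.smul (IsC2.add (fun x hx => hh x hx.2) (isC2_const (-((R ^ 2) ^ (-K:ℤ))) _)) C)
  have hDc : IsCompact {x | κ ^ 2 ≤ qe x₀ x ∧ qe x₀ x ≤ R ^ 2} := by
    refine (isCompact_closedBall x₀ R).of_isClosed_subset ((isClosed_le continuous_const (qe_cont x₀)).inter (isClosed_le (qe_cont x₀) continuous_const)) ?_
    intro x hx; rw [Metric.mem_closedBall, dist_eq_norm]; exact norm_of_qe hR.le hx.2
  have hDU : ∀ x, κ ^ 2 ≤ qe x₀ x ∧ qe x₀ x ≤ R ^ 2 → x ∈ U ∩ {x | 0 < qe x₀ x} := fun x hx => ⟨hsub x hx.2, lt_of_lt_of_le (by positivity) hx.1⟩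
  obtain ⟨x, hxD, hmax⟩ := hDc.exists_isMaxOn ⟨y, hy1, hy2⟩ (f := fun x => -1 * u x + C * (φ (qe x₀ x) + -((R ^ 2) ^ (-K:ℤ))))
    (fun x hx => (hv x (hDU x hx)).1.continuousAt.continuousWithinAt)
  have hxU := hDU x hxD
  have pos : 0 < -1 * u x + C * (φ (qe x₀ x) + -((R ^ 2) ^ (-K:ℤ))) := 
    lt_of_lt_of_le (by simp only [φ]; linarith) (isMaxOn_iff.1 hmax y ⟨hy1, hy2⟩)
  have i1 : κ ^ 2 < qe x₀ x := lt_of_le_of_ne hxD.1 fun h => by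
    have a1 := hsp x h.symm
    have a2 : C * φ (qe x₀ x) = s := by
      simp only [φ, C, ← h, zpow_neg, zpow_natCast]; field_simp
    have a3 : 0 < C * (R ^ 2) ^ (-K:ℤ) := by positivity
    linarith
  have i2 : qe x₀ x < R ^ 2 := lt_of_le_of_ne hxD.2 fun h => by
    have := hu0 x hxU.1
    simp only [φ, h] at pos; linarith
  have hnb : {x | κ ^ 2 ≤ qe x₀ x ∧ qe x₀ x ≤ R ^ 2} ∈ 𝓝 x := by
    filter_upwards [(isOpen_lt continuous_const (qe_cont x₀)).mem_nhds i1, (isOpen_lt (qe_cont x₀) continuous_const).mem_nhds i2] with z h1 h2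
    exact ⟨h1.le, h2.le⟩
  obtain ⟨e1, e2⟩ := hv.localMax hUo hxU (hmax.isLocalMax hnb)
  obtain ⟨cE, cB, cg, cg'⟩ := hco x hxU.1
  have e3 := cE.nonpos hl0 hl1 e2
  have gen : ∀ T p r, A x T ≤ 0 → p = 0 → 0 < r → 0 ≤ Lop (A x) (B x) (g x) T p r := fun T p r a b c => by
    unfold Lop; rw [b, map_zero]; linarith [mul_nonneg cg c.le]
  have e4 := gen _ _ _ e3 e1 pos
  rw [Lop_add, Lop_smul, Lop_smul] at e4
  refine absurd e4 (not_le.2 ?_)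
  have l1 := hLu x hxU.1
  suffices hs : Lop (A x) (B x) (g x) ((((-K:ℤ):ℝ) * qe x₀ x ^ ((-K:ℤ) - 1)) • ((2:ℝ) • ell) + (((-K:ℤ):ℝ) * (((-K:ℤ) - 1 : ℤ) * qe x₀ x ^ ((-K:ℤ) - 1 - 1))) •
      ContinuousLinearMap.smulRight ((2:ℝ) • ell (x - x₀)) ((2:ℝ) • ell (x - x₀)) + 0)
      ((((-K:ℤ):ℝ) * qe x₀ x ^ ((-K:ℤ) - 1)) • ((2:ℝ) • ell (x - x₀)) + 0) (φ (qe x₀ x) + -(R ^ 2) ^ (-K:ℤ)) < 0 by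
    linarith [mul_neg_of_pos_of_neg hC hs]
  obtain ⟨t, ht⟩ : ∃ t, t = qe x₀ x := ⟨_, rfl⟩
  have t0 : 0 < t := by rw [ht]; exact hxU.2
  have t1 : t ≤ 1 := by rw [ht]; exact i2.le.trans (pow_le_one₀ hR.le hR1)
  have zn : ‖x - x₀‖ ≤ 1 := norm_of_qe zero_le_one (by rw [one_pow, ← ht]; exact t1)
  obtain ⟨P, hP⟩ : ∃ P, P = t ^ ((-K:ℤ) - 1 - 1) := ⟨_, rfl⟩
  have P0 : 0 < P := by rw [hP]; positivity
  have z1 : t ^ ((-K:ℤ) - 1) = P * t := by rw [hP, ← zpow_add_one₀ t0.ne']; congr 1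
  have z2 : φ t = P * t * t := by rw [← z1, ← zpow_add_one₀ t0.ne']; simp only [φ]; congr 1
  have b1 : A x ((2:ℝ) • ell) ≤ d * m ^ 2 * c := by
    refine (le_abs_self _).trans (((A x).le_opNorm _).trans ?_)
    rw [← hc]; gcongr; rw [hm]; exact (cE.toEll hl0 hl1).norm_le
  have b2 : - B x ((2:ℝ) • ell (x - x₀)) ≤ β * c := by
    refine (neg_le_abs _).trans (((B x).le_opNorm _).trans ?_)
    gcongr
    refine (((2:ℝ) • ell (d := d)).le_opNorm (x - x₀)).trans ?_
    rw [← hc]; exact mul_le_of_le_one_right hc0 zn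
  have b3 : 4 * (l * t) ≤ A x (ContinuousLinearMap.smulRight ((2:ℝ) • ell (x - x₀)) ((2:ℝ) • ell (x - x₀))) := by
    refine le_trans (le_of_eq ?_) (cE.lower _)
    rw [ht, qe, ell_apply, Finset.mul_sum, Finset.mul_sum, Finset.mul_sum]
    exact Finset.sum_congr rfl fun i _ => by simp [ell_apply, eb, Pi.single_apply]; ring
  have b4 : g x * (φ t + -(R ^ 2) ^ (-K:ℤ)) ≤ β * (P * t) := by
    have a1 : g x * (R ^ 2) ^ (-K:ℤ) ≥ 0 := by positivity
    have a2 : g x * φ t ≤ β * (P * t) := by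
      rw [z2]; exact mul_le_mul cg' (mul_le_of_le_one_right (by positivity) t1) (by positivity) hβ
    linarith
  rw [← ht, Lop]
  simp only [add_zero, map_add, map_smul (A x) (_ * _), map_smul (B x) (_ * _), smul_eq_mul, z1, ← hP]
  generalize A x ((2:ℝ) • ell) = a1 at *
  generalize B x ((2:ℝ) • ell (x - x₀)) = a2 at *
  generalize A x (ContinuousLinearMap.smulRight ((2:ℝ) • ell (x - x₀)) ((2:ℝ) • ell (x - x₀))) = a3 at *
  generalize g x * (φ t + -(R ^ 2) ^ (-K:ℤ)) = a4 at *
  push_cast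
  have hK0 : (0:ℝ) < K := by linarith
  have c1 := mul_le_mul_of_nonneg_left b1 (by positivity : 0 ≤ K * (P * t))
  have c2 := mul_le_mul_of_nonneg_left b2 (by positivity : 0 ≤ K * (P * t))
  have c3 := mul_le_mul_of_nonneg_left b3 (by positivity : 0 ≤ K * (K + 1) * P)
  have c4 : (d * m ^ 2 * c + β * c + β) < (K + 1) * (4 * l) := by rw [hKk]; linarith
  have c5 := mul_lt_mul_of_pos_left c4 (by positivity : 0 < K * (P * t))
  have c6 : β * (P * t) ≤ K * (P * t) * β := by
    have := mul_le_mul_of_nonneg_right hK1 (by positivity : 0 ≤ P * t * β); linarith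
  linarith
end

section
open MeasureTheory Set Filter Topology
open scoped SchwartzMap ContDiff

open scoped SI
set_option linter.unusedSectionVars false
variable {d : ℕ} {F : Type} [NormedAddCommGroup F] [NormedSpace ℝ F]

lemma qe_le (x₀ x : EE d) : qe x₀ x ≤ d * ‖x - x₀‖ ^ 2 := ell_le _

theorem smp {l β : ℝ} (hl0 : 0 < l) (hl1 : l ≤ 1) (hβ : 0 ≤ β) {A : EE d → D2 d} {B : EE d → D1 d} {g u : EE d → ℝ} {u1 u2}
    (hco : ∀ x, EllA l (A x) ∧ ‖B x‖ ≤ β ∧ 0 ≤ g x ∧ g x ≤ β) (hu : IsC2 u u1 u2 univ)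
    (hL : ∀ x, 0 ≤ Lop (A x) (B x) (g x) (u2 x) (u1 x) (u x)) (h0 : ∀ x, 0 ≤ u x) (y₀ : EE d) (hy₀ : 0 < u y₀) : ∀ x, 0 < u x := by
  obtain ⟨k, hk, hb⟩ := barrier (d := d) hl0 hl1 hβ
  have hcu : Continuous u := continuous_iff_continuousAt.2 fun x => (hu x trivial).1.continuousAt
  have hop : IsOpen {x | 0 < u x} := isOpen_lt continuous_const hcu
  have hcl : IsClosed {x | 0 < u x} := by
    refine isClosed_of_closure_subset fun x hx => ?_
    obtain ⟨y, hy1, hy⟩ := mem_closure_iff.1 hx (Metric.ball x (1 / (d + 1))) Metric.isOpen_ball (Metric.mem_ball_self (by positivity))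
    have hq : qe y x < 1 := by
      rw [Metric.mem_ball, dist_comm, dist_eq_norm] at hy1
      refine (qe_le _ _).trans_lt ?_
      have : ‖x - y‖ ^ 2 ≤ (1 / (d + 1 : ℝ)) ^ 2 := by gcongr
      have h2 : (d:ℝ) * (1 / (d + 1 : ℝ)) ^ 2 < 1 := by
        rw [div_pow, one_pow, mul_one_div, div_lt_one (by positivity)]; nlinarith [(Nat.cast_nonneg d : (0:ℝ) ≤ d)]
      exact lt_of_le_of_lt (by gcongr) h2
    change 0 < u y at hy
    obtain ⟨r, hr, hr2⟩ := Metric.isOpen_iff.1 (isOpen_lt continuous_const hcu : IsOpen {x | u y / 2 < u x}) y (by change u y / 2 < u y; linarith)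
    have near : ∀ z, qe y z ≤ (r / 2) ^ 2 → u y / 2 ≤ u z := fun z hz => le_of_lt (hr2 (by
      rw [Metric.mem_ball, dist_eq_norm]; linarith [norm_of_qe (by positivity) hz]))
    rcases le_total (qe y x) ((r / 2) ^ 2) with h | h
    · exact lt_of_lt_of_le (by linarith) (near x h)
    · have := hb y A B g u u1 u2 univ (r / 2) 1 (u y / 2) isOpen_univ (by positivity) le_rfl one_pos (fun _ _ => trivial) (fun x _ => hco x) hu
        (fun x _ => hL x) (fun x _ => h0 x) (by positivity) (fun z hz => near z hz.le) x h (by simpa using hq.le)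
      refine lt_of_lt_of_le ?_ this
      have hq0 : 0 < qe y x := lt_of_lt_of_le (by positivity) h
      have : 1 < qe y x ^ (-k:ℤ) := by
        rw [zpow_neg, zpow_natCast]; exact (one_lt_inv₀ (by positivity)).2 (pow_lt_one₀ hq0.le hq (by omega))
      rw [one_pow, one_zpow]
      have : 0 < qe y x ^ (-k:ℤ) - 1 := by linarith
      positivity
  have := (IsClopen.eq_univ ⟨hcl, hop⟩ ⟨y₀, hy₀⟩ : {x | 0 < u x} = univ)
  exact fun x => (this ▸ trivial : x ∈ {x | 0 < u x})

set_option maxHeartbeats 1000000 in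
theorem harnack {α l β : ℝ} (h0 : 0 < α) (h1 : α < 1) (hl0 : 0 < l) (hl1 : l ≤ 1) (hβ : 0 ≤ β) :
    ∃ R0, 0 < R0 ∧ R0 ≤ 1 ∧ ∀ R, 0 < R → R ≤ R0 → ∃ C, 0 < C ∧ ∀ (x₀ : EE d) (A : EE d → D2 d) (B : EE d → D1 d) (g u : EE d → ℝ) u1 u2,
    LCls α l β A B g (Metric.ball x₀ R) → (∀ x ∈ Metric.ball x₀ R, 0 ≤ g x) → IsSol A B g u u1 u2 (Metric.ball x₀ R) →
    (∀ x ∈ Metric.ball x₀ R, 0 ≤ u x) → ∀ x ∈ Metric.ball x₀ (R / (16 * (d + 1))), ∀ y ∈ Metric.ball x₀ (R / (16 * (d + 1))), u x ≤ C * u y := by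
  obtain ⟨k, hk, hb⟩ := barrier (d := d) hl0 hl1 hβ
  obtain ⟨d0, C1, hd0, hd1, hC1, hI⟩ := intEst (d := d) h0 h1 hl0 hl1 hβ
  refine ⟨d0, hd0, hd1, fun R hR hRd => ?_⟩
  obtain ⟨κ, hκ⟩ : ∃ κ : ℝ, κ = 1 / (32 + 4 * C1 * 4 ^ k) := ⟨_, rfl⟩
  have hκ0 : 0 < κ := by rw [hκ]; positivity
  have hk1 : κ * 32 + 4 * κ * C1 * 4 ^ k = 1 := by rw [hκ]; field_simp
  have hk2 : 0 ≤ 4 * κ * C1 * 4 ^ k := by positivity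
  obtain ⟨r, hr⟩ : ∃ r : ℝ, r = R / (8 * (d + 1)) := ⟨_, rfl⟩
  have hr0 : 0 < r := by rw [hr]; positivity
  have hrR : 8 * r * (d + 1) = R := by rw [hr]; field_simp
  have er : R / (16 * (d + 1)) = r / 2 := by rw [hr]; field_simp; norm_num
  have hd : (0:ℝ) ≤ d := Nat.cast_nonneg d
  have hr8 : 8 * r ≤ R := by rw [← hrR]; nlinarith
  refine ⟨2 / ((κ ^ 2) ^ k * (r / 2) ^ (2 * k)), by positivity, ?_⟩
  intro x₀ A B g u u1 u2 hc hg hu hu0 x hx y hy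
  rw [er] at hx hy
  have hsub : Metric.closedBall x₀ r ⊆ Metric.ball x₀ R := Metric.closedBall_subset_ball (by linarith)
  have hsub2 : Metric.ball x₀ (r / 2) ⊆ Metric.closedBall x₀ r := (Metric.ball_subset_closedBall).trans (Metric.closedBall_subset_closedBall (by linarith))
  rcases (hu0 x (hsub (hsub2 hx))).eq_or_lt with hx0 | hx0
  · rw [← hx0]; exact mul_nonneg (by positivity) (hu0 y (hsub (hsub2 hy)))
  obtain ⟨p, hpm, hmax⟩ := (isCompact_closedBall x₀ r).exists_isMaxOn ⟨x, hsub2 hx⟩ (f := fun z => u z * (r - ‖z - x₀‖) ^ (2 * k))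
    (ContinuousOn.mul (fun z hz => (hu.1 z (hsub hz)).1.continuousAt.continuousWithinAt) (by fun_prop))
  rw [isMaxOn_iff] at hmax
  have hx' : ‖x - x₀‖ < r / 2 := by rwa [Metric.mem_ball, dist_eq_norm] at hx
  have hy' : ‖y - x₀‖ < r / 2 := by rwa [Metric.mem_ball, dist_eq_norm] at hy
  have hp' : ‖p - x₀‖ ≤ r := by rwa [Metric.mem_closedBall, dist_eq_norm] at hpm
  have hm1 : u x * (r / 2) ^ (2 * k) ≤ u p * (r - ‖p - x₀‖) ^ (2 * k) := by
    refine le_trans ?_ (hmax x (hsub2 hx)); gcongr; linarith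
  obtain ⟨δ, hδ⟩ : ∃ δ, δ = r - ‖p - x₀‖ := ⟨_, rfl⟩
  rw [← hδ] at hm1
  have hδ0 : 0 < δ := lt_of_le_of_ne (by linarith) fun h => by
    rw [← h, zero_pow (by omega), mul_zero] at hm1
    have : 0 < u x * (r / 2) ^ (2 * k) := by positivity
    linarith
  have hup0 := hu0 p (hsub hpm)
  have hup : 0 < u p := lt_of_le_of_ne hup0 fun h => by
    rw [← h, zero_mul] at hm1
    have : 0 < u x * (r / 2) ^ (2 * k) := by positivity
    linarith
  have hδr : δ ≤ r := by linarith [norm_nonneg (p - x₀)]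
  have tri : ∀ z w v : EE d, ‖z - v‖ ≤ ‖z - w‖ + ‖w - v‖ := fun z w v => norm_sub_le_norm_sub_add_norm_sub _ _ _
  have hbp : ∀ z ∈ Metric.ball p (δ / 2), ‖z - x₀‖ < r - δ / 2 := fun z hz => by
    rw [Metric.mem_ball, dist_eq_norm] at hz; linarith [tri z p x₀]
  have hbs : Metric.ball p (δ / 2) ⊆ Metric.ball x₀ R := fun z hz => by
    rw [Metric.mem_ball, dist_eq_norm]; linarith [hbp z hz]
  have hN : ∀ z ∈ Metric.ball p (δ / 2), |u z| ≤ 4 ^ k * u p := fun z hz => by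
    have h2 := hbp z hz
    have hz0 := hu0 z (hbs hz)
    rw [abs_of_nonneg hz0]
    have := hmax z (by rw [Metric.mem_closedBall, dist_eq_norm]; linarith)
    beta_reduce at this
    rw [← hδ] at this
    have h3 : u z * (δ / 2) ^ (2 * k) ≤ u p * δ ^ (2 * k) := le_trans (by gcongr; linarith) this
    have e : (δ / 2) ^ (2 * k) = δ ^ (2 * k) / 4 ^ k := by rw [div_pow, pow_mul 2]; norm_num
    rw [e, mul_div_assoc', div_le_iff₀ (by positivity)] at h3
    exact le_of_mul_le_mul_right (by linarith) (by positivity : 0 < δ ^ (2 * k))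
  obtain ⟨I1, -⟩ := hI (δ / 2) p A B g u u1 u2 _ (by positivity) (by linarith) (hc.subset hbs) (hu.subset hbs) hN
  have near : ∀ z, qe p z ≤ (κ * δ) ^ 2 → u p / 2 ≤ u z := fun z hz => by
    have hz1 := norm_of_qe (by positivity) hz
    have hlt : κ * δ < δ / 2 / 8 := by
      have : κ * 32 * δ ≤ 1 * δ := by gcongr; linarith
      linarith
    have hs8 : Metric.ball p (δ / 2 / 8) ⊆ Metric.ball x₀ R := (Metric.ball_subset_ball (by linarith)).trans hbs
    have := mv_ball (convex_ball p (δ / 2 / 8)) (K := 2 * (C1 * (4 ^ k * u p)) / δ) (fun x hx => (hu.1 x (hs8 hx)).1) (fun x hx => by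
      rw [le_div_iff₀ hδ0]; have := I1 x hx; linarith) p (Metric.mem_ball_self (by positivity)) z (by rw [Metric.mem_ball, dist_eq_norm]; linarith)
    have h3 : 2 * (C1 * (4 ^ k * u p)) / δ * ‖p - z‖ ≤ u p / 2 := by
      rw [norm_sub_rev]
      calc _ ≤ 2 * (C1 * (4 ^ k * u p)) / δ * (κ * δ) := by gcongr
        _ = (4 * κ * C1 * 4 ^ k) * u p / 2 := by field_simp; ring
        _ ≤ 1 * u p / 2 := by gcongr; linarith
        _ = _ := by ring
    have := (le_abs_self _).trans (this.trans h3)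
    linarith
  suffices hfin : u p / 2 * ((κ * δ) ^ 2) ^ k ≤ u y by
    have e : ((κ * δ) ^ 2) ^ k = (κ ^ 2) ^ k * δ ^ (2 * k) := by rw [mul_pow, mul_pow, pow_mul]
    rw [e] at hfin
    rw [div_mul_eq_mul_div, le_div_iff₀ (by positivity)]
    have := mul_le_mul_of_nonneg_left hm1 (by positivity : 0 ≤ (κ ^ 2) ^ k)
    linarith
  rcases le_total (qe p y) ((κ * δ) ^ 2) with h | h
  · refine le_trans ?_ (near y h)
    have : κ * δ ≤ 1 := mul_le_one₀ (by linarith) hδ0.le (by linarith)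
    exact mul_le_of_le_one_right (by positivity) (pow_le_one₀ (by positivity) (pow_le_one₀ (by positivity) this))
  · have hyp : ‖y - p‖ ≤ 2 * r := by linarith [tri y x₀ p, norm_sub_rev x₀ p]
    have hq : qe p y ≤ (R / 2) ^ 2 / 4 := by
      refine (qe_le p y).trans ?_
      calc _ ≤ d * (2 * r) ^ 2 := by gcongr
        _ ≤ (8 * r * (d + 1) / 2) ^ 2 / 4 := by linarith [sq_nonneg r, mul_nonneg hd (sq_nonneg r), mul_nonneg (mul_nonneg hd hd) (sq_nonneg r)]
        _ = _ := by rw [hrR]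
    have hR2 : 0 < (R / 2) ^ 2 := by positivity
    have := hb p A B g u u1 u2 (Metric.ball x₀ R) (κ * δ) (R / 2) (u p / 2) Metric.isOpen_ball (by positivity) (by linarith) (by positivity)
      (fun z hz => by
        have := norm_of_qe (by positivity) hz
        rw [Metric.mem_ball, dist_eq_norm]; linarith [tri z p x₀])
      (fun z hz => ⟨hc.el z hz, hc.hB.1 z hz, hg z hz, (le_abs_self _).trans (hc.hg.1 z hz)⟩) hu.1 (fun z hz => (hu.2.2 z hz).ge) hu0
      (by positivity) (fun z hz => near z hz.le) y h (by linarith)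
    refine le_trans (le_mul_of_one_le_right (by positivity) ?_) this
    have hq0 : 0 < qe p y := lt_of_lt_of_le (by positivity) h
    simp only [zpow_neg, zpow_natCast]
    obtain ⟨a, ha⟩ : ∃ a, a = (R / 2) ^ 2 := ⟨_, rfl⟩
    rw [← ha] at hq hR2 ⊢
    have ha1 : a ≤ 1 := by rw [ha]; exact pow_le_one₀ (by positivity) (by linarith)
    have i1 : ((a / 4) ^ k)⁻¹ ≤ (qe p y ^ k)⁻¹ := inv_anti₀ (by positivity) (by gcongr)
    have i2 : ((a / 4) ^ k)⁻¹ = 4 ^ k * (a ^ k)⁻¹ := by rw [div_pow, inv_div]; ring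
    have i3 : 1 ≤ (a ^ k)⁻¹ := (one_le_inv₀ (by positivity)).2 (pow_le_one₀ hR2.le ha1)
    have i4 : (4:ℝ) ≤ 4 ^ k := by simpa using pow_le_pow_right₀ (by norm_num : (1:ℝ) ≤ 4) hk
    have i5 := mul_le_mul_of_nonneg_right i4 (zero_le_one.trans i3)
    linarith
end

section
open MeasureTheory Set Filter Topology
open scoped SchwartzMap ContDiff

open scoped SI
set_option linter.unusedSectionVars false
variable {d : ℕ} {F : Type} [NormedAddCommGroup F] [NormedSpace ℝ F]

lemma Sz.expo {α α' C : ℝ} {f : EE d → F} {S : Set (EE d)} (h : Sz α C f S) (h0 : 0 < α') (h1 : α' ≤ α) : Sz α' (2 * C) f S := by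
  refine ⟨fun x hx => (h.1 x hx).trans (by linarith [(norm_nonneg _).trans (h.1 x hx)]), fun x hx y hy => ?_⟩
  have hC := (norm_nonneg _).trans (h.1 x hx)
  rcases le_total ‖x - y‖ 1 with h2 | h2
  · have := Real.rpow_le_rpow_of_exponent_ge' (norm_nonneg (x - y)) h2 h0.le h1
    have := mul_le_mul_of_nonneg_left this hC
    have p : 0 ≤ C * ‖x - y‖ ^ α' := by positivity
    linarith [h.2 x hx y hy]
  · have := Real.one_le_rpow h2 h0.le
    have := mul_le_mul_of_nonneg_left this hC
    linarith [norm_sub_le (f x) (f y), h.1 x hx, h.1 y hy]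

def LocH (f : EE d → F) (Ω : Set (EE d)) : Prop := ∀ K ⊆ Ω, IsCompact K → ∃ α C, 0 < α ∧ α < 1 ∧ Sz α C f K

structure Dat (A : EE d → D2 d) (B : EE d → D1 d) (g : EE d → ℝ) (Ω : Set (EE d)) : Prop where
  el : ∀ K ⊆ Ω, IsCompact K → ∃ l, 0 < l ∧ l ≤ 1 ∧ ∀ x ∈ K, EllA l (A x)
  hA : LocH A Ω
  hB : LocH B Ω
  hg : LocH g Ω
  g0 : ∀ x ∈ Ω, 0 ≤ g x

lemma Dat.cls {A : EE d → D2 d} {B : EE d → D1 d} {g : EE d → ℝ} {Ω : Set (EE d)} (h : Dat A B g Ω) {K : Set (EE d)} (hK : K ⊆ Ω)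
    (hc : IsCompact K) : ∃ α l β, 0 < α ∧ α < 1 ∧ 0 < l ∧ l ≤ 1 ∧ 0 ≤ β ∧ LCls α l β A B g K := by
  obtain ⟨l, l0, l1, hl⟩ := h.el K hK hc
  obtain ⟨α1, C1, a1, b1, s1⟩ := h.hA K hK hc
  obtain ⟨α2, C2, a2, b2, s2⟩ := h.hB K hK hc
  obtain ⟨α3, C3, a3, b3, s3⟩ := h.hg K hK hc
  have hm : 0 < min α1 (min α2 α3) := lt_min a1 (lt_min a2 a3)
  have q1 := le_abs_self C1; have q2 := le_abs_self C2; have q3 := le_abs_self C3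
  have r1 := abs_nonneg C1; have r2 := abs_nonneg C2; have r3 := abs_nonneg C3
  refine ⟨min α1 (min α2 α3), l, 2 * (|C1| + |C2| + |C3|), hm, (min_le_left _ _).trans_lt b1, l0, l1, by positivity, hl,
    ((s1.expo hm (min_le_left _ _)).mono ?_).2, (s2.expo hm ((min_le_right _ _).trans (min_le_left _ _))).mono ?_,
    (s3.expo hm ((min_le_right _ _).trans (min_le_right _ _))).mono ?_⟩ <;> linarith

lemma exists_lipcut {α : ℝ} (h0 : 0 < α) (h1 : α < 1) {K Ω : Set (EE d)} (hK : IsCompact K) (hne : K.Nonempty) {δ : ℝ} (hδ : 0 < δ) :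
    ∃ (χ : EE d → ℝ) (L : ℝ), Sz α L χ univ ∧ (∀ x, 0 ≤ χ x ∧ χ x ≤ 1) ∧ (∀ x, x ∉ Metric.cthickening δ K → χ x = 0) ∧ ∀ x ∈ K, χ x = 1 := by
  have b : ∀ x, 0 ≤ max 0 (1 - Metric.infDist x K / δ) ∧ max 0 (1 - Metric.infDist x K / δ) ≤ 1 := fun x =>
    ⟨le_max_left _ _, max_le zero_le_one (sub_le_self _ (div_nonneg Metric.infDist_nonneg hδ.le))⟩
  refine ⟨fun x => max 0 (1 - Metric.infDist x K / δ), _, lip_hol h0 h1 (N := 1) (K := 1 / δ) (fun x _ => ?_) (fun x _ y _ => ?_) zero_le_one (by positivity), b,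
    fun x hx => ?_, fun x hx => ?_⟩
  · rw [Real.norm_of_nonneg (b x).1]; exact (b x).2
  · rw [Real.norm_eq_abs, max_comm 0, max_comm 0]
    refine (abs_max_sub_max_le_abs (1 - Metric.infDist x K / δ) (1 - Metric.infDist y K / δ) (0:ℝ)).trans ?_
    have := (Metric.lipschitz_infDist_pt K).dist_le_mul y x
    rw [NNReal.coe_one, one_mul, dist_eq_norm, dist_eq_norm, norm_sub_rev y x, Real.norm_eq_abs] at this
    rw [show 1 - Metric.infDist x K / δ - (1 - Metric.infDist y K / δ) = (Metric.infDist y K - Metric.infDist x K) / δ by ring, abs_div, abs_of_pos hδ,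
      one_div_mul_eq_div]
    gcongr
  · refine max_eq_left ?_
    by_contra! hlt
    obtain ⟨y, hy, e⟩ := hK.exists_infDist_eq_dist hne x
    have : Metric.infDist x K / δ < 1 := by linarith
    rw [div_lt_one hδ, e] at this
    exact hx (Metric.mem_cthickening_of_dist_le x y δ K hy this.le)
  · simp [Metric.infDist_zero_of_mem hx]

set_option maxHeartbeats 1000000 in
theorem approx (hd : 0 < d) {A : EE d → D2 d} {B : EE d → D1 d} {g : EE d → ℝ} {Ω : Set (EE d)} (hΩ : IsOpen Ω) (h : Dat A B g Ω) {K : Set (EE d)}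
    (hK : K ⊆ Ω) (hc : IsCompact K) (hne : K.Nonempty) {ε : ℝ} (hε : 0 < ε) :
    ∃ w w1 w2, IsC2 w w1 w2 univ ∧ Continuous w2 ∧ (∀ x, 0 < w x) ∧ ∀ x ∈ K, Lop (A x) (B x) (g x + ε) (w2 x) (w1 x) (w x) = 0 := by
  obtain ⟨δ, hδ, hsub⟩ := hc.exists_cthickening_subset_open hΩ hK
  have hS : IsCompact (Metric.cthickening δ K) := hc.cthickening
  obtain ⟨α, l, β, h0, h1, hl0, hl1, hβ, hL⟩ := h.cls hsub hS
  obtain ⟨χ, L, x1, x2, x3, x4⟩ := exists_lipcut (Ω := Ω) h0 h1 hc hne hδ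
  obtain ⟨β', hβ', w1, w2, w3, w4⟩ := extA hl0 hl1 hβ x1 x2 x3 hL.el hL.hA hL.hB hL.hg
  have f1 := (Sz_const (d := d) (α := α) (1:ℝ)).sub x1
  have g1 := (w4.add f1).add (Sz_const (d := d) (α := α) ε)
  have L0 := x1.nonneg univ_nonempty
  rw [norm_one, Real.norm_of_nonneg hε.le] at g1
  rw [norm_one] at f1
  have gp : ∀ x, 0 ≤ χ x • g x := fun x => by
    by_cases hx : x ∈ Metric.cthickening δ K
    · exact mul_nonneg (x2 x).1 (h.g0 x (hsub hx))
    · rw [x3 x hx, zero_smul]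
  have ge : ∀ x, ε ≤ χ x • g x + (1 - χ x) + ε := fun x => by linarith [gp x, (x2 x).2]
  obtain ⟨w, p, T, ⟨N, hN⟩, hw⟩ := solve (β := β' + (1 + L) + ε) h0 h1 hl0 hl1 hε w1 (w2.2.mono (by linarith)) (w3.mono (by linarith)) g1 ge f1
  have wn : ∀ x, 0 ≤ w x := fun x => by
    have := maxP (hN.1.smul (-1)) (K := N) (fun x => by linarith [(abs_le.1 (hN.2.1.1 x trivial)).1]) (fun x => (w1 x).toEll hl0 hl1) (fun x => w3.1 x trivial) hε ge le_rfl
      (fun x => by rw [Lop_smul, hw]; linarith [(x2 x).2]) x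
    by_contra! hlt
    nlinarith
  have : Nonempty (Fin d) := ⟨⟨0, hd⟩⟩
  obtain ⟨z, hz⟩ : ∃ z, z ∉ Metric.cthickening δ K := by
    by_contra! hall
    have := NormedSpace.noncompactSpace ℝ (EE d)
    exact noncompact_univ (EE d) ((eq_univ_of_forall hall) ▸ hS)
  obtain ⟨y, hy⟩ : ∃ y, 0 < w y := by
    by_contra! hall
    have e : w = fun _ => 0 := funext fun x => le_antisymm (hall x) (wn x)
    have := IsC2.unique isOpen_univ hN.1 (e ▸ isC2_const 0 univ) z trivial
    have h2 := hw z
    rw [this.1, this.2, e, x3 z hz] at h2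
    simp [Lop] at h2
  have wp := smp hl0 hl1 (by positivity : 0 ≤ β' + (1 + L) + ε) (fun x => ⟨w1 x, (w3.1 x trivial).trans (by linarith), by linarith [ge x],
    (le_abs_self _).trans (g1.1 x trivial)⟩) hN.1 (fun x => by rw [hw]; linarith [(x2 x).2]) wn y hy
  refine ⟨w, p, T, hN.1, hN.2.2.2.2.continuousOn h0 |> continuousOn_univ.1, wp, fun x hx => ?_⟩
  have := hw x
  rw [x4 x hx] at this
  simpa using this

lemma exh {Ω : Set (EE d)} (hΩ : IsOpen Ω) : ∃ K : ℕ → Set (EE d), (∀ n, IsCompact (K n) ∧ K n ⊆ Ω) ∧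
    ∀ C ⊆ Ω, IsCompact C → ∀ᶠ n in atTop, C ⊆ K n := by
  have := hΩ.locallyCompactSpace
  let E := CompactExhaustion.choice Ω
  refine ⟨fun n => Subtype.val '' E n, fun n => ⟨(E.isCompact n).image continuous_subtype_val, by simp⟩, fun C hC hc => ?_⟩
  obtain ⟨n, hn⟩ := E.exists_superset_of_isCompact (s := Subtype.val ⁻¹' C) (by
    rw [Subtype.isCompact_iff, Subtype.image_preimage_coe, inter_eq_right.2 hC]; exact hc)
  filter_upwards [eventually_ge_atTop n] with m hm x hx
  exact ⟨⟨x, hC hx⟩, E.subset hm (hn hx), rfl⟩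
end

section
open MeasureTheory Set Filter Topology
open scoped SchwartzMap ContDiff

open scoped SI
set_option linter.unusedSectionVars false
variable {d : ℕ} {F : Type} [NormedAddCommGroup F] [NormedSpace ℝ F]

lemma taylor {u : EE d → ℝ} {u1 u2} {x : EE d} {r K α : ℝ} (h : IsC2 u u1 u2 (Metric.ball x r)) (h0 : 0 < α) (hK : 0 ≤ K)
    (hb : ∀ z ∈ Metric.ball x r, ‖u2 z‖ ≤ K) (hh : ∀ z ∈ Metric.ball x r, ‖u2 z - u2 x‖ ≤ K * ‖z - x‖ ^ α) : ∀ z ∈ Metric.ball x r,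
    ‖u1 z - u1 x - u2 x (z - x)‖ ≤ K * ‖z - x‖ ^ α * ‖z - x‖ ∧ ‖u z - u x - u1 x (z - x)‖ ≤ K * ‖z - x‖ * ‖z - x‖ := by
  intro z hz
  have hr : 0 < r := dist_nonneg.trans_lt hz
  have hx : x ∈ Metric.ball x r := Metric.mem_ball_self hr
  have sub : Metric.closedBall x ‖z - x‖ ⊆ Metric.ball x r := Metric.closedBall_subset_ball (by rwa [Metric.mem_ball, dist_eq_norm] at hz)
  have m1 : x ∈ Metric.closedBall x ‖z - x‖ := Metric.mem_closedBall_self (norm_nonneg _)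
  have m2 : z ∈ Metric.closedBall x ‖z - x‖ := by rw [Metric.mem_closedBall, dist_eq_norm]
  refine ⟨Convex.norm_image_sub_le_of_norm_hasFDerivWithin_le' (𝕜 := ℝ) (fun y hy => (h y (sub hy)).2.hasFDerivWithinAt) (fun y hy => ?_) (convex_closedBall _ _) m1 m2,
    Convex.norm_image_sub_le_of_norm_hasFDerivWithin_le' (𝕜 := ℝ) (fun y hy => (h y (sub hy)).1.hasFDerivWithinAt) (fun y hy => ?_) (convex_closedBall _ _) m1 m2⟩
  · refine (hh y (sub hy)).trans ?_
    rw [Metric.mem_closedBall, dist_eq_norm] at hy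
    gcongr
  · have := (convex_ball x r).norm_image_sub_le_of_norm_hasFDerivWithin_le (𝕜 := ℝ) (fun y hy => (h y hy).2.hasFDerivWithinAt) hb hx (sub hy)
    refine this.trans ?_
    rw [Metric.mem_closedBall, dist_eq_norm] at hy
    gcongr

set_option maxHeartbeats 1000000 in
theorem locE {A : EE d → D2 d} {B : EE d → D1 d} {g : EE d → ℝ} {Ω : Set (EE d)} (hΩ : IsOpen Ω) (h : Dat A B g Ω) {x : EE d} (hx : x ∈ Ω) :
    ∃ R r α K : ℝ, 0 < r ∧ r ≤ R ∧ 0 < α ∧ 0 < K ∧ Metric.closedBall x R ⊆ Ω ∧ ∀ ε u u1 u2, 0 ≤ ε → ε ≤ 1 →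
      IsSol A B (fun y => g y + ε) u u1 u2 (Metric.ball x R) → (∀ y ∈ Metric.ball x R, 0 ≤ u y) → ∀ y ∈ Metric.ball x r,
        u y ≤ K * u x ∧ u x ≤ K * u y ∧ ‖u1 y‖ ≤ K * u x ∧ ‖u2 y‖ ≤ K * u x ∧ ‖u2 y - u2 x‖ ≤ K * u x * ‖y - x‖ ^ α := by
  obtain ⟨R1, hR1, sub⟩ := Metric.nhds_basis_closedBall.mem_iff.1 (hΩ.mem_nhds hx)
  obtain ⟨α, l, β, h0, h1, l0, l1, hβ, hL⟩ := h.cls sub (isCompact_closedBall x R1)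
  have hβ' : 0 ≤ β + 1 := by linarith
  obtain ⟨R0, hR0, -, hH⟩ := harnack (d := d) h0 h1 l0 l1 hβ'
  obtain ⟨d0, C', hd0, hd1, hC', hI⟩ := intEst (d := d) h0 h1 l0 l1 hβ'
  obtain ⟨R, hR⟩ : ∃ R, R = min R0 R1 := ⟨_, rfl⟩
  have Rp : 0 < R := hR ▸ lt_min hR0 hR1
  have sR : Metric.closedBall x R ⊆ Metric.closedBall x R1 := Metric.closedBall_subset_closedBall (hR ▸ min_le_right _ _)
  obtain ⟨C, hC, hH⟩ := hH R Rp (hR ▸ min_le_left _ _)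
  obtain ⟨ρ, hρ⟩ : ∃ ρ, ρ = min (R / (16 * (d + 1))) d0 := ⟨_, rfl⟩
  have q : 0 < R / (16 * ((d:ℝ) + 1)) := by positivity
  have ρp : 0 < ρ := hρ ▸ lt_min q hd0
  have ρ1 : ρ ≤ 1 := hρ ▸ (min_le_right _ _).trans hd1
  have ρq : ρ ≤ R / (16 * ((d:ℝ) + 1)) := hρ ▸ min_le_left _ _
  have qR : R / (16 * ((d:ℝ) + 1)) ≤ R := div_le_self Rp.le (by linarith [Nat.cast_nonneg (α := ℝ) d])
  have p3 : 0 < ρ ^ 3 := by positivity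
  refine ⟨R, ρ / 8, α, C + C' * C / ρ ^ 3, by positivity, by linarith, h0, by positivity, sR.trans sub, ?_⟩
  intro ε u u1 u2 e0 e1 hs hp y hy
  have lc : LCls α l (β + 1) A B (fun y => g y + ε) (Metric.ball x R) := by
    have hL' := hL.subset (Metric.ball_subset_closedBall.trans sR)
    refine ⟨hL'.el, hL'.hA.mono (by linarith), hL'.hB.mono (by linarith), (hL'.hg.add ((Sz_const ε).subset (subset_univ _))).mono ?_⟩
    rw [Real.norm_of_nonneg e0]; linarith
  have hH := hH x A B _ u u1 u2 lc (fun z hz => add_nonneg (h.g0 z (sub (sR (Metric.ball_subset_closedBall hz)))) e0) hs hp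
  have xm : x ∈ Metric.ball x (R / (16 * ((d:ℝ) + 1))) := Metric.mem_ball_self q
  have s1 : Metric.ball x ρ ⊆ Metric.ball x R := Metric.ball_subset_ball (ρq.trans qR)
  have s2 : Metric.ball x ρ ⊆ Metric.ball x (R / (16 * ((d:ℝ) + 1))) := Metric.ball_subset_ball ρq
  have s3 : Metric.ball x (ρ / 8) ⊆ Metric.ball x ρ := Metric.ball_subset_ball (by linarith)
  have ux := hp x (Metric.mem_ball_self Rp)
  have uy := hp y (s1 (s3 hy))
  have hI := hI ρ x A B _ u u1 u2 (C * u x) ρp (hρ ▸ min_le_right _ _) (lc.subset s1) (hs.subset s1) (fun z hz => by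
    rw [abs_of_nonneg (hp z (s1 hz))]; exact hH z (s2 hz) x xm)
  have xm8 : x ∈ Metric.ball x (ρ / 8) := Metric.mem_ball_self (by positivity)
  have key : ∀ v w e : ℝ, 0 ≤ v → 0 ≤ w → ρ ^ 3 ≤ e → e * v ≤ C' * (C * u x) * w → v ≤ (C + C' * C / ρ ^ 3) * u x * w := fun v w e hv hw he hvw => by
    have a1 : v ≤ C' * (C * u x) * w / ρ ^ 3 := by rw [le_div_iff₀ p3, mul_comm]; exact (mul_le_mul_of_nonneg_right he hv).trans hvw
    have a2 : 0 ≤ C * u x * w := by positivity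
    have a3 : (C + C' * C / ρ ^ 3) * u x * w = C * u x * w + C' * (C * u x) * w / ρ ^ 3 := by ring
    linarith
  have le : ∀ v : ℝ, 0 ≤ v → C * v ≤ (C + C' * C / ρ ^ 3) * v := fun v hv => mul_le_mul_of_nonneg_right (le_add_of_nonneg_right (by positivity)) hv
  refine ⟨(hH y (s2 (s3 hy)) x xm).trans (le _ ux), (hH x xm y (s2 (s3 hy))).trans (le _ uy), ?_, ?_, ?_⟩
  · simpa using key ‖u1 y‖ 1 ρ (norm_nonneg _) zero_le_one (pow_le_of_le_one ρp.le ρ1 (by norm_num)) (by simpa using hI.1 y hy)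
  · simpa using key ‖u2 y‖ 1 (ρ ^ 2) (norm_nonneg _) zero_le_one (pow_le_pow_of_le_one ρp.le ρ1 (by norm_num)) (by simpa using (hI.2 y hy).1)
  · refine key _ _ (ρ ^ (2 + α)) (norm_nonneg _) (by positivity) ?_ ((hI.2 y hy).2 x xm8)
    rw [← Real.rpow_natCast]
    exact Real.rpow_le_rpow_of_exponent_ge ρp ρ1 (by push_cast; linarith)

lemma bdd_lim {E : Type} [NormedAddCommGroup E] [ProperSpace E] {f : ℕ → E} {K : ℝ} (h : ∀ᶠ n in atTop, ‖f n‖ ≤ K) :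
    ∃ l, Tendsto f (hyperfilter ℕ) (𝓝 l) := by
  obtain ⟨l, -, hl⟩ := (isCompact_closedBall (0:E) K).ultrafilter_le_nhds' ((hyperfilter ℕ).map f) (by
    refine Nat.hyperfilter_le_atTop (mem_of_superset h fun n hn => ?_)
    simpa using hn)
  exact ⟨l, hl⟩

lemma tz {x : EE d} {K β : ℝ} (hβ : 0 < β) : Tendsto (fun z => K * ‖z - x‖ ^ β) (𝓝 x) (𝓝 0) := by
  have : ContinuousAt (fun z => K * ‖z - x‖ ^ β) x :=
    (Continuous.mul continuous_const (Continuous.rpow_const (by fun_prop) fun _ => Or.inr hβ.le)).continuousAt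
  simpa [ContinuousAt, Real.zero_rpow hβ.ne'] using this

lemma hasF {f : EE d → F} {f' : EE d →L[ℝ] F} {x : EE d} {r K β : ℝ} (hr : 0 < r) (hβ : 0 < β)
    (h : ∀ z ∈ Metric.ball x r, ‖f z - f x - f' (z - x)‖ ≤ K * ‖z - x‖ ^ β * ‖z - x‖) : HasFDerivAt f f' x := by
  rw [hasFDerivAt_iff_isLittleO, Asymptotics.isLittleO_iff]
  intro c hc
  filter_upwards [Metric.ball_mem_nhds x hr, (tz hβ).eventually_le_const hc] with z hz hz2
  exact (h z hz).trans (mul_le_mul_of_nonneg_right hz2 (norm_nonneg _))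

set_option maxHeartbeats 1000000 in
theorem APT (hd : 0 < d) {A : EE d → D2 d} {B : EE d → D1 d} {g : EE d → ℝ} {Ω : Set (EE d)} (hΩ : IsOpen Ω) (hcon : IsConnected Ω) (h : Dat A B g Ω) :
    ∃ w w1 w2, IsC2 w w1 w2 Ω ∧ ContinuousOn w2 Ω ∧ (∀ x ∈ Ω, 0 < w x) ∧ ∀ x ∈ Ω, Lop (A x) (B x) (g x) (w2 x) (w1 x) (w x) = 0 := by
  obtain ⟨x0, hx0⟩ := hcon.nonempty
  obtain ⟨K, hK, hKe⟩ := exh hΩ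
  have ex : ∀ n : ℕ, ∃ w w1 w2, IsC2 w w1 w2 univ ∧ Continuous w2 ∧ (∀ x, 0 < w x) ∧ w x0 = 1 ∧ ∀ x ∈ K n,
      Lop (A x) (B x) (g x + 1 / ((n:ℝ) + 1)) (w2 x) (w1 x) (w x) = 0 := fun n => by
    obtain ⟨w, w1, w2, a1, a2, a3, a4⟩ := approx hd hΩ h (insert_subset hx0 (hK n).2) ((hK n).1.insert x0) (insert_nonempty _ _)
      (by positivity : 0 < 1 / ((n:ℝ) + 1))
    exact ⟨_, _, _, a1.smul (w x0)⁻¹, by fun_prop, fun x => mul_pos (inv_pos.2 (a3 x0)) (a3 x), inv_mul_cancel₀ (a3 x0).ne',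
      fun x hx => by rw [Lop_smul, a4 x (mem_insert_of_mem _ hx), mul_zero]⟩
  choose w w1 w2 c1 c2 c3 c4 c5 using ex
  have hloc : ∀ x ∈ Ω, ∃ r α K : ℝ, 0 < r ∧ 0 < α ∧ 0 < K ∧ Metric.ball x r ⊆ Ω ∧ ∀ᶠ n in atTop, ∀ y ∈ Metric.ball x r, w n y ≤ K * w n x ∧ w n x ≤ K * w n y ∧
      ‖w1 n y‖ ≤ K * w n x ∧ ‖w2 n y‖ ≤ K * w n x ∧ ‖w2 n y - w2 n x‖ ≤ K * w n x * ‖y - x‖ ^ α := fun x hx => by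
    obtain ⟨R, r, α, C, r0, rR, h0, hC, sub, H⟩ := locE hΩ h hx
    refine ⟨r, α, C, r0, h0, hC, (Metric.ball_subset_closedBall.trans (Metric.closedBall_subset_closedBall rR)).trans sub, ?_⟩
    filter_upwards [hKe _ sub (isCompact_closedBall _ _)] with n hn
    exact H (1 / ((n:ℝ) + 1)) (w n) (w1 n) (w2 n) (by positivity) (by rw [div_le_one (by positivity)]; linarith [Nat.cast_nonneg (α := ℝ) n])
      ⟨fun y _ => c1 n y trivial, (c2 n).continuousOn, fun y hy => c5 n y (hn (Metric.ball_subset_closedBall hy))⟩ (fun y _ => (c3 n y).le)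
  have hrel : ∀ x ∈ Ω, ∀ y ∈ Ω, ∃ C, 0 < C ∧ ∀ᶠ n in atTop, w n y ≤ C * w n x := fun x hx y hy => by
    refine hcon.isPreconnected.induction₂' (fun x y => ∃ C, 0 < C ∧ ∀ᶠ n in atTop, w n y ≤ C * w n x) (fun x hx => ?_) ?_ hx hy
    · obtain ⟨r, α, C, r0, -, hC, -, H⟩ := hloc x hx
      filter_upwards [mem_nhdsWithin_of_mem_nhds (Metric.ball_mem_nhds x r0)] with y hy
      exact ⟨⟨C, hC, H.mono fun n hn => (hn y hy).1⟩, ⟨C, hC, H.mono fun n hn => (hn y hy).2.1⟩⟩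
    · rintro x y z - - - ⟨C, hC, H⟩ ⟨C', hC', H'⟩
      refine ⟨C' * C, by positivity, ?_⟩
      filter_upwards [H, H'] with n hn hn'
      rw [mul_assoc]
      exact hn'.trans (mul_le_mul_of_nonneg_left hn hC'.le)
  have hb : ∀ x ∈ Ω, ∃ r α K : ℝ, 0 < r ∧ 0 < α ∧ 0 < K ∧ Metric.ball x r ⊆ Ω ∧ ∀ᶠ n in atTop, 1 ≤ K * w n x ∧ ∀ y ∈ Metric.ball x r, ‖w n y‖ ≤ K ∧
      ‖w1 n y‖ ≤ K ∧ ‖w2 n y‖ ≤ K ∧ ‖w2 n y - w2 n x‖ ≤ K * ‖y - x‖ ^ α := fun x hx => by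
    obtain ⟨r, α, C, r0, h0, hC, hs, H⟩ := hloc x hx
    obtain ⟨C1, p1, H1⟩ := hrel x0 hx0 x hx
    obtain ⟨C2, p2, H2⟩ := hrel x hx x0 hx0
    refine ⟨r, α, C * C1 + C2, r0, h0, by positivity, hs, ?_⟩
    filter_upwards [H, H1, H2] with n hn h1 h2
    rw [c4, mul_one] at h1
    rw [c4] at h2
    have le : C * w n x ≤ C * C1 + C2 := by have := mul_le_mul_of_nonneg_left h1 hC.le; linarith
    have p := c3 n x
    refine ⟨h2.trans (mul_le_mul_of_nonneg_right (le_add_of_nonneg_left (by positivity)) p.le), fun y hy => ?_⟩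
    obtain ⟨q1, q2, q3, q4, q5⟩ := hn y hy
    refine ⟨?_, q3.trans le, q4.trans le, q5.trans (mul_le_mul_of_nonneg_right le (by positivity))⟩
    rw [Real.norm_of_nonneg (c3 n y).le]; exact q1.trans le
  have lim : ∀ x, ∃ v v1 v2, x ∈ Ω → Tendsto (fun n => w n x) (hyperfilter ℕ) (𝓝 v) ∧ Tendsto (fun n => w1 n x) (hyperfilter ℕ) (𝓝 v1) ∧
      Tendsto (fun n => w2 n x) (hyperfilter ℕ) (𝓝 v2) := fun x => by
    by_cases hx : x ∈ Ω
    · obtain ⟨r, α, C, r0, -, -, -, H⟩ := hb x hx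
      have hm := Metric.mem_ball_self (x := x) r0
      have := FiniteDimensional.proper ℝ (E1 d)
      have := FiniteDimensional.proper ℝ (E2 d)
      obtain ⟨v, hv⟩ := bdd_lim (H.mono fun n hn => (hn.2 x hm).1)
      obtain ⟨v1, hv1⟩ := bdd_lim (H.mono fun n hn => (hn.2 x hm).2.1)
      obtain ⟨v2, hv2⟩ := bdd_lim (H.mono fun n hn => (hn.2 x hm).2.2.1)
      exact ⟨v, v1, v2, fun _ => ⟨hv, hv1, hv2⟩⟩
    · exact ⟨0, 0, 0, fun h => absurd h hx⟩
  choose v v1 v2 hv using lim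
  have hU := Nat.hyperfilter_le_atTop
  have hT : ∀ x ∈ Ω, ∃ r α K : ℝ, 0 < r ∧ 0 < α ∧ ∀ z ∈ Metric.ball x r, ‖v z - v x - v1 x (z - x)‖ ≤ K * ‖z - x‖ ^ (1:ℝ) * ‖z - x‖ ∧
      ‖v1 z - v1 x - v2 x (z - x)‖ ≤ K * ‖z - x‖ ^ α * ‖z - x‖ ∧ ‖v2 z - v2 x‖ ≤ K * ‖z - x‖ ^ α := fun x hx => by
    obtain ⟨r, α, C, r0, h0, hC, hs, H⟩ := hb x hx
    refine ⟨r, α, C, r0, h0, fun z hz => ?_⟩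
    have T := H.mono fun n hn => taylor (fun y _ => c1 n y trivial) h0 hC.le (fun y hy => (hn.2 y hy).2.2.1) (fun y hy => (hn.2 y hy).2.2.2) z hz
    obtain ⟨t1, t2, t3⟩ := hv x hx
    obtain ⟨s1, s2, s3⟩ := hv z (hs hz)
    rw [Real.rpow_one]
    exact ⟨le_of_tendsto ((s1.sub t1).sub (((ContinuousLinearMap.apply ℝ ℝ (z - x)).continuous.tendsto _).comp t2)).norm (hU (T.mono fun n hn => hn.2)),
      le_of_tendsto ((s2.sub t2).sub (((ContinuousLinearMap.apply ℝ (E1 d) (z - x)).continuous.tendsto _).comp t3)).norm (hU (T.mono fun n hn => hn.1)),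
      le_of_tendsto (s3.sub t3).norm (hU (H.mono fun n hn => (hn.2 z hz).2.2.2))⟩
  refine ⟨v, v1, v2, fun x hx => ?_, fun x hx => ?_, fun x hx => ?_, fun x hx => ?_⟩
  · obtain ⟨r, α, C, r0, h0, H⟩ := hT x hx
    exact ⟨hasF r0 one_pos fun z hz => (H z hz).1, hasF r0 h0 fun z hz => (H z hz).2.1⟩
  · obtain ⟨r, α, C, r0, h0, H⟩ := hT x hx
    refine ContinuousAt.continuousWithinAt (tendsto_iff_norm_sub_tendsto_zero.2 (squeeze_zero' (.of_forall fun _ => norm_nonneg _) ?_ (tz (K := C) h0)))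
    filter_upwards [Metric.ball_mem_nhds x r0] with z hz using (H z hz).2.2
  · obtain ⟨r, α, C, r0, h0, hC, hs, H⟩ := hb x hx
    have := ge_of_tendsto ((hv x hx).1.const_mul C) (hU (H.mono fun n hn => hn.1))
    exact pos_of_mul_pos_right (one_pos.trans_le this) hC.le
  · obtain ⟨t1, t2, t3⟩ := hv x hx
    have e : Tendsto (fun n : ℕ => g x + 1 / ((n:ℝ) + 1)) (hyperfilter ℕ) (𝓝 (g x + 0)) := (tendsto_one_div_add_atTop_nhds_zero_nat.mono_left hU).const_add _
    rw [add_zero] at e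
    have T : Tendsto (fun n : ℕ => Lop (A x) (B x) (g x + 1 / ((n:ℝ) + 1)) (w2 n x) (w1 n x) (w n x)) (hyperfilter ℕ) (𝓝 (Lop (A x) (B x) (g x) (v2 x) (v1 x) (v x))) :=
      ((((A x).continuous.tendsto _).comp t3).neg.add (((B x).continuous.tendsto _).comp t2)).add (e.mul t1)
    refine tendsto_nhds_unique T (tendsto_const_nhds.congr' (hU ?_))
    filter_upwards [hKe {x} (singleton_subset_iff.2 hx) isCompact_singleton] with n hn
    exact (c5 n x (hn rfl)).symm
end

section
open MeasureTheory Set Filter Topology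
open scoped SchwartzMap ContDiff

open scoped SI
set_option linter.unusedSectionVars false
variable {d : ℕ} {F G H : Type} [NormedAddCommGroup F] [NormedSpace ℝ F] [NormedAddCommGroup G] [NormedSpace ℝ G] [NormedAddCommGroup H] [NormedSpace ℝ H]

lemma locS {f : EE d → F} {Ω : Set (EE d)} (h : ∀ x ∈ Ω, ∃ t ∈ 𝓝 x, ∃ α C : ℝ, 0 < α ∧ Hol α C f t) : LocH f Ω := by
  intro K hK hc
  have : ∃ α C δ : ℝ, 0 < α ∧ α < 1 ∧ 0 ≤ C ∧ 0 < δ ∧ δ ≤ 1 ∧ ∀ x ∈ K, ∀ y, ‖x - y‖ < δ → ‖f x‖ ≤ C ∧ ‖f x - f y‖ ≤ C * ‖x - y‖ ^ α := by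
    refine hc.induction_on (p := fun S => ∃ α C δ : ℝ, 0 < α ∧ α < 1 ∧ 0 ≤ C ∧ 0 < δ ∧ δ ≤ 1 ∧ ∀ x ∈ S, ∀ y, ‖x - y‖ < δ → ‖f x‖ ≤ C ∧ ‖f x - f y‖ ≤ C * ‖x - y‖ ^ α)
      ⟨1/2, 0, 1, by norm_num, by norm_num, le_rfl, one_pos, le_rfl, fun x hx => hx.elim⟩ ?_ ?_ ?_
    · rintro s t st ⟨α, C, δ, a, b, c, e, f, g⟩
      exact ⟨α, C, δ, a, b, c, e, f, fun x hx => g x (st hx)⟩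
    · rintro s t ⟨α, C, δ, a, b, c, e, f, g⟩ ⟨α', C', δ', a', b', c', e', f', g'⟩
      have q : ∀ (r c0 c1 α0 α1 : ℝ), 0 ≤ r → r < 1 → 0 ≤ c0 → c0 ≤ c1 → 0 < α1 → α1 ≤ α0 → c0 * r ^ α0 ≤ c1 * r ^ α1 := fun r c0 c1 α0 α1 h1 h2 h3 h4 h5 h6 =>
        mul_le_mul h4 (Real.rpow_le_rpow_of_exponent_ge' h1 h2.le h5.le h6) (by positivity) (h3.trans h4)
      have am : 0 < min α α' := lt_min a a'
      refine ⟨min α α', max C C', min δ δ', am, (min_le_left _ _).trans_lt b, le_max_of_le_left c, lt_min e e', (min_le_left _ _).trans f, ?_⟩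
      rintro x (hx | hx) y hy
      · have := g x hx y (hy.trans_le (min_le_left _ _))
        exact ⟨this.1.trans (le_max_left _ _), this.2.trans (q _ _ _ _ _ (norm_nonneg _) (hy.trans_le ((min_le_left _ _).trans f)) c (le_max_left _ _) am (min_le_left _ _))⟩
      · have := g' x hx y (hy.trans_le (min_le_right _ _))
        exact ⟨this.1.trans (le_max_right _ _), this.2.trans (q _ _ _ _ _ (norm_nonneg _) (hy.trans_le ((min_le_left _ _).trans f)) c' (le_max_right _ _) am (min_le_right _ _))⟩
    · intro x hx
      obtain ⟨t, ht, α, C, h0, hH⟩ := h x (hK hx)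
      obtain ⟨ρ, hρ, hb⟩ := Metric.mem_nhds_iff.1 ht
      obtain ⟨r, hr⟩ : ∃ r, r = min ρ 1 / 2 := ⟨_, rfl⟩
      have r0 : 0 < r := hr ▸ half_pos (lt_min hρ one_pos)
      have r1 : 2 * r ≤ 1 := by linarith [min_le_right ρ 1]
      have r2 : 2 * r ≤ ρ := by linarith [min_le_left ρ 1]
      have am : 0 < min α (1/2) := lt_min h0 (by norm_num)
      have C0 := abs_nonneg C
      have key : ∀ y ∈ t, ∀ z ∈ t, ‖y - z‖ ≤ 1 → ‖f y - f z‖ ≤ |C| * ‖y - z‖ ^ min α (1/2) := fun y hy z hz hyz =>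
        (hH y hy z hz).trans (mul_le_mul (le_abs_self _) (Real.rpow_le_rpow_of_exponent_ge' (norm_nonneg _) hyz am.le (min_le_left _ _)) (by positivity) C0)
      refine ⟨Metric.ball x r, mem_nhdsWithin_of_mem_nhds (Metric.ball_mem_nhds x r0), min α (1/2), |C| + ‖f x‖, r, am,
        (min_le_right _ _).trans_lt (by norm_num), by positivity, r0, by linarith, fun y hy z hz => ?_⟩
      rw [Metric.mem_ball, dist_eq_norm] at hy
      have n1 : ‖z - x‖ < 2 * r := by
        have := norm_add_le (z - y) (y - x)
        rw [sub_add_sub_cancel, norm_sub_rev z y] at this; linarith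
      have mx := hb (Metric.mem_ball_self hρ)
      have my : y ∈ t := hb (by rw [Metric.mem_ball, dist_eq_norm]; linarith)
      have mz : z ∈ t := hb (by rw [Metric.mem_ball, dist_eq_norm]; linarith)
      constructor
      · have h1 := key y my x mx (by linarith)
        have h2 : |C| * ‖y - x‖ ^ min α (1/2) ≤ |C| * 1 := mul_le_mul_of_nonneg_left (Real.rpow_le_one (norm_nonneg _) (by linarith) am.le) C0
        have h3 := norm_le_norm_add_norm_sub' (f y) (f x)
        linarith
      · exact (key y my z mz (by linarith)).trans (mul_le_mul_of_nonneg_right (by linarith [norm_nonneg (f x)]) (by positivity))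
  obtain ⟨α, C, δ, h0, h1, C0, d0, d1, hh⟩ := this
  have q : 0 ≤ 2 * C / δ := by positivity
  refine ⟨α, C + 2 * C / δ, h0, h1, fun x hx => (hh x hx x (by simpa using d0)).1.trans (by linarith), fun x hx y hy => ?_⟩
  have p : 0 ≤ ‖x - y‖ ^ α := by positivity
  by_cases hxy : ‖x - y‖ < δ
  · exact (hh x hx y hxy).2.trans (mul_le_mul_of_nonneg_right (by linarith) p)
  · have b1 := (hh x hx x (by simpa using d0)).1
    have b2 := (hh y hy y (by simpa using d0)).1
    have b3 : δ ≤ ‖x - y‖ ^ α := (Real.rpow_one δ ▸ Real.rpow_le_rpow_of_exponent_ge d0 d1 h1.le).trans (Real.rpow_le_rpow d0.le (not_lt.1 hxy) h0.le)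
    have b4 : 2 * C ≤ 2 * C / δ * ‖x - y‖ ^ α := by
      have := mul_le_mul_of_nonneg_left b3 q
      rwa [div_mul_cancel₀ _ d0.ne'] at this
    have b5 : 0 ≤ C * ‖x - y‖ ^ α := by positivity
    linarith [norm_sub_le (f x) (f y)]

lemma LocH.pair {f : EE d → F} {g : EE d → G} {Ω : Set (EE d)} (hf : LocH f Ω) (hg : LocH g Ω) {K : Set (EE d)} (hK : K ⊆ Ω) (hc : IsCompact K) :
    ∃ α C, 0 < α ∧ α < 1 ∧ 0 ≤ C ∧ Sz α C f K ∧ Sz α C g K := by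
  obtain ⟨α1, C1, a1, b1, s1⟩ := hf K hK hc
  obtain ⟨α2, C2, a2, b2, s2⟩ := hg K hK hc
  have hm : 0 < min α1 α2 := lt_min a1 a2
  have q1 := le_abs_self C1; have q2 := le_abs_self C2
  have r1 := abs_nonneg C1; have r2 := abs_nonneg C2
  refine ⟨min α1 α2, 2 * (|C1| + |C2|), hm, (min_le_left _ _).trans_lt b1, by positivity,
    (s1.expo hm (min_le_left _ _)).mono ?_, (s2.expo hm (min_le_right _ _)).mono ?_⟩ <;> linarith

lemma LocH.add {f g : EE d → F} {Ω : Set (EE d)} (hf : LocH f Ω) (hg : LocH g Ω) : LocH (fun x => f x + g x) Ω := fun K hK hc => by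
  obtain ⟨α, C, h0, h1, -, s1, s2⟩ := hf.pair hg hK hc
  exact ⟨α, _, h0, h1, s1.add s2⟩

lemma LocH.bil {f : EE d → F} {g : EE d → G} {Ω : Set (EE d)} (hf : LocH f Ω) (hg : LocH g Ω) (Φ : F →L[ℝ] G →L[ℝ] H) :
    LocH (fun x => Φ (f x) (g x)) Ω := fun K hK hc => by
  obtain ⟨α, C, h0, h1, hC, s1, s2⟩ := hf.pair hg hK hc
  exact ⟨α, _, h0, h1, s1.bil s2 (norm_nonneg Φ) hC hC (fun x hx hx' => absurd hx hx') (fun a b => Φ a b) (fun p p' q => by simp) (fun p q q' => by simp)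
    (fun p q => Φ.le_opNorm₂ p q)⟩

lemma LocH.const (v : F) (Ω : Set (EE d)) : LocH (fun _ => v) Ω := fun K _ _ => ⟨1/2, ‖v‖, by norm_num, by norm_num, (Sz_const v).subset (subset_univ _)⟩

lemma LocH.clm {f : EE d → F} {Ω : Set (EE d)} (hf : LocH f Ω) (φ : F →L[ℝ] G) : LocH (fun x => φ (f x)) Ω :=
  (LocH.const φ Ω).bil hf (ContinuousLinearMap.id ℝ (F →L[ℝ] G))

lemma LocH.sum {ι : Type} {s : Finset ι} {f : ι → EE d → F} {Ω : Set (EE d)} (hf : ∀ i, LocH (f i) Ω) : LocH (fun x => ∑ i ∈ s, f i x) Ω := by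
  classical
  induction s using Finset.induction_on with
  | empty => simpa using LocH.const (0:F) Ω
  | insert a s ha ih => simp only [Finset.sum_insert ha]; exact (hf a).add ih

lemma LocH.cont {f : EE d → F} {Ω : Set (EE d)} (hΩ : IsOpen Ω) (hf : LocH f Ω) : ContinuousOn f Ω := fun x hx => by
  obtain ⟨R1, hR1, sub⟩ := Metric.nhds_basis_closedBall.mem_iff.1 (hΩ.mem_nhds hx)
  obtain ⟨α, C, h0, h1, h⟩ := hf _ sub (isCompact_closedBall x R1)
  exact ((h.2.continuousOn h0).continuousAt (Metric.closedBall_mem_nhds x hR1)).continuousWithinAt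

lemma LocH.ofLH {f : EE d → ℝ} {Ω : Set (EE d)} (hΩ : IsOpen Ω) (h : LocallyHolderOn f Ω) : LocH f Ω := locS fun x hx => by
  obtain ⟨α, C, h0, -, s, hs, H⟩ := h x hx
  rw [hΩ.nhdsWithin_eq hx] at hs
  refine ⟨s, hs, α, C, h0, fun y hy z hz => ?_⟩
  simpa [dist_eq_norm] using H.dist_le hy hz

lemma LocH.ofC1 {f : EE d → F} {f' : EE d → EE d →L[ℝ] F} {Ω : Set (EE d)} (hΩ : IsOpen Ω) (h : ∀ x ∈ Ω, HasFDerivAt f (f' x) x) (hc : ContinuousOn f' Ω) : LocH f Ω := locS fun x hx => by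
  have h1 : ∀ᶠ y in 𝓝 x, ‖f' y‖ < ‖f' x‖ + 1 := ((hc.continuousAt (hΩ.mem_nhds hx)).norm.eventually_lt_const (by linarith))
  obtain ⟨r, hr, hb⟩ := Metric.mem_nhds_iff.1 (h1.and (hΩ.mem_nhds hx))
  refine ⟨_, Metric.ball_mem_nhds x hr, 1, ‖f' x‖ + 1, one_pos, fun y hy z hz => ?_⟩
  rw [Real.rpow_one]
  exact (convex_ball x r).norm_image_sub_le_of_norm_hasFDerivWithin_le (𝕜 := ℝ) (fun y hy => (h y (hb hy).2).hasFDerivWithinAt) (fun y hy => (hb hy).1.le) hz hy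
end

section
open MeasureTheory Set Filter Topology
open scoped SchwartzMap ContDiff

open scoped SI
set_option linter.unusedSectionVars false
variable {d : ℕ} {F : Type} [NormedAddCommGroup F] [NormedSpace ℝ F]

lemma qf_smul (a : Fin d → Fin d → ℝ) (t : ℝ) (x : EE d) : qf a (t • x) = t ^ 2 * qf a x := by
  simp only [qf, Finset.mul_sum, Pi.smul_apply, smul_eq_mul]
  exact Finset.sum_congr rfl fun i _ => Finset.sum_congr rfl fun j _ => by ring

lemma ell_cpt (hd : 0 < d) {a : Fin d → Fin d → EE d → ℝ} {K : Set (EE d)} (hc : ∀ i j, ContinuousOn (a i j) K) (hK : IsCompact K)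
    (hs : ∀ x ∈ K, ∀ i j, a i j x = a j i x) (hp : ∀ x ∈ K, ∀ ξ : EE d, ξ ≠ 0 → 0 < qf (fun i j => a i j x) ξ) :
    ∃ l, 0 < l ∧ l ≤ 1 ∧ ∀ x ∈ K, EllA l (Aof fun i j => a i j x) := by
  rcases K.eq_empty_or_nonempty with rfl | hne
  · exact ⟨1, one_pos, le_rfl, fun x hx => hx.elim⟩
  have : Nonempty (Fin d) := ⟨⟨0, hd⟩⟩
  have S := hK.prod (isCompact_sphere (0 : EE d) 1)
  have Sn : (K ×ˢ Metric.sphere (0 : EE d) 1).Nonempty := hne.prod (NormedSpace.sphere_nonempty.2 zero_le_one)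
  have cont : ContinuousOn (fun p : EE d × EE d => qf (fun i j => a i j p.1) p.2) (K ×ˢ Metric.sphere (0 : EE d) 1) :=
    continuousOn_finsetSum _ fun i _ => continuousOn_finsetSum _ fun j _ =>
      (((hc i j).comp continuousOn_fst fun p hp => hp.1).mul (by fun_prop)).mul (by fun_prop)
  obtain ⟨P, hP, hmin⟩ := S.exists_isMinOn Sn cont
  obtain ⟨P', hP', hmax⟩ := S.exists_isMaxOn Sn cont
  obtain ⟨m, hm⟩ : ∃ m, m = qf (fun i j => a i j P.1) P.2 := ⟨_, rfl⟩
  obtain ⟨M, hM⟩ : ∃ m, m = qf (fun i j => a i j P'.1) P'.2 := ⟨_, rfl⟩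
  have m0 : 0 < m := hm ▸ hp _ hP.1 _ (ne_zero_of_mem_unit_sphere (⟨P.2, hP.2⟩ : Metric.sphere (0 : EE d) 1))
  have M0 : 0 < M := m0.trans_le (hm ▸ hM ▸ isMinOn_iff.1 hmin P' hP')
  have dp : (0:ℝ) < d := by exact_mod_cast hd
  have key : ∀ x ∈ K, ∀ ξ : EE d, m * ‖ξ‖ ^ 2 ≤ qf (fun i j => a i j x) ξ ∧ qf (fun i j => a i j x) ξ ≤ M * ‖ξ‖ ^ 2 := fun x hx ξ => by
    rcases eq_or_ne ξ 0 with rfl | h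
    · simp [qf]
    have n0 : 0 < ‖ξ‖ := norm_pos_iff.2 h
    have mem : (x, ‖ξ‖⁻¹ • ξ) ∈ K ×ˢ Metric.sphere (0 : EE d) 1 := ⟨hx, by simp [norm_smul, n0.ne']⟩
    have e : qf (fun i j => a i j x) ξ = qf (fun i j => a i j x) (‖ξ‖⁻¹ • ξ) * ‖ξ‖ ^ 2 := by
      rw [qf_smul]; field_simp
    have b1 := isMinOn_iff.1 hmin _ mem
    have b2 := isMaxOn_iff.1 hmax _ mem
    rw [e]
    exact ⟨mul_le_mul_of_nonneg_right (hm ▸ b1) (by positivity), mul_le_mul_of_nonneg_right (hM ▸ b2) (by positivity)⟩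
  obtain ⟨l, hl⟩ : ∃ l, l = min 1 (min (m / d) M⁻¹) := ⟨_, rfl⟩
  have l0 : 0 < l := hl ▸ lt_min one_pos (lt_min (by positivity) (by positivity))
  have l1 : l ≤ m / d := hl ▸ (min_le_right _ _).trans (min_le_left _ _)
  have l2 : M ≤ l⁻¹ := by
    rw [le_inv_comm₀ M0 l0]; exact hl ▸ (min_le_right _ _).trans (min_le_right _ _)
  refine ⟨l, l0, hl ▸ min_le_left _ _, fun x hx => ⟨_, ⟨hs x hx, fun ξ => ⟨?_, ?_⟩⟩, rfl⟩⟩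
  · refine le_trans ?_ (key x hx ξ).1
    have h1 := mul_le_mul l1 (ell_le ξ) (ell_nonneg ξ) (by positivity)
    have h2 : m / d * (d * ‖ξ‖ ^ 2) = m * ‖ξ‖ ^ 2 := by field_simp
    linarith
  · exact (key x hx ξ).2.trans (mul_le_mul l2 (sq_le_ell ξ) (by positivity) (inv_pos.2 l0).le)

def Bof (b : Fin d → ℝ) : D1 d := ∑ i, b i • ContinuousLinearMap.apply ℝ ℝ (eb i : EE d)

lemma toC2 {u : EE d → ℝ} {Ω : Set (EE d)} (hΩ : IsOpen Ω) (h : ContDiffOn ℝ 2 u Ω) :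
    IsC2 u (fderiv ℝ u) (fderiv ℝ (fderiv ℝ u)) Ω ∧ ContinuousOn (fderiv ℝ (fderiv ℝ u)) Ω := by
  have h1 : ContDiffOn ℝ 1 (fderiv ℝ u) Ω := h.fderiv_of_isOpen hΩ (by norm_num)
  exact ⟨fun x hx => ⟨((h.differentiableOn (by norm_num)).differentiableAt (hΩ.mem_nhds hx)).hasFDerivAt,
    ((h1.differentiableOn (by norm_num)).differentiableAt (hΩ.mem_nhds hx)).hasFDerivAt⟩, h1.continuousOn_fderiv_of_isOpen hΩ le_rfl⟩

lemma ofC2 {u : EE d → ℝ} {u1 u2} {Ω : Set (EE d)} (hΩ : IsOpen Ω) (h : IsC2 u u1 u2 Ω) (hc : ContinuousOn u2 Ω) : ContDiffOn ℝ 2 u Ω := by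
  have h1 : ContDiffOn ℝ 1 u1 Ω := by
    rw [show (1 : WithTop ℕ∞) = 0 + 1 by norm_num, contDiffOn_succ_iff_fderiv_of_isOpen hΩ]
    exact ⟨fun x hx => (h x hx).2.differentiableAt.differentiableWithinAt, by simp, contDiffOn_zero.2 (hc.congr fun x hx => (h x hx).2.fderiv)⟩
  rw [show (2 : WithTop ℕ∞) = 1 + 1 by norm_num, contDiffOn_succ_iff_fderiv_of_isOpen hΩ]
  exact ⟨fun x hx => (h x hx).1.differentiableAt.differentiableWithinAt, by simp, h1.congr fun x hx => (h x hx).1.fderiv⟩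

lemma ellOp_eq {u : EE d → ℝ} {u1 u2} {Ω : Set (EE d)} (hΩ : IsOpen Ω) (h : IsC2 u u1 u2 Ω) (a : Fin d → Fin d → EE d → ℝ) (b : Fin d → EE d → ℝ)
    (c : EE d → ℝ) {x : EE d} (hx : x ∈ Ω) :
    ellOp a b c u x = Lop (Aof fun i j => a i j x) (Bof fun i => b i x) (c x) (u2 x) (u1 x) (u x) := by
  have e1 : ∀ i, pd1 u i x = u1 x (eb i) := fun i => by rw [pd1, (h x hx).1.fderiv]
  have e2 : ∀ i j, pd2 u i j x = u2 x (eb i) (eb j) := fun i j => by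
    have h1 : (fun y => fderiv ℝ u y (Pi.single j 1)) =ᶠ[𝓝 x] fun y => ContinuousLinearMap.apply ℝ ℝ (eb j : EE d) (u1 y) := by
      filter_upwards [hΩ.mem_nhds hx] with y hy
      rw [(h y hy).1.fderiv]; rfl
    have h2 := ((ContinuousLinearMap.apply ℝ ℝ (eb j : EE d)).hasFDerivAt.comp x (h x hx).2).congr_of_eventuallyEq h1
    rw [pd2, h2.fderiv]; rfl
  simp only [ellOp, Lop, Aof_apply, Bof, sum_apply, smul_apply, smul_eq_mul, ContinuousLinearMap.apply_apply, e1, e2]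

abbrev tn : E1 d →L[ℝ] E1 d →L[ℝ] E2 d := ContinuousLinearMap.smulRightL ℝ (EE d) (E1 d)

lemma logL {A : EE d → D2 d} {B : EE d → D1 d} {c k u : EE d → ℝ} {u1 u2} {U : Set (EE d)} (h : IsC2 u u1 u2 U) (hc : ContinuousOn u2 U)
    (hp : ∀ x ∈ U, 0 < u x) (he : ∀ x ∈ U, Lop (A x) (B x) (c x) (u2 x) (u1 x) (u x) = k x * u x) :
    ∃ p q Q, IsC2 p q Q U ∧ ContinuousOn Q U ∧ ∀ x ∈ U, Lop (A x) (B x) (c x) (Q x + tn (q x) (q x)) (q x) 1 = k x := by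
  have cu : ContinuousOn u U := fun x hx => (h x hx).1.continuousAt.continuousWithinAt
  have cu1 : ContinuousOn u1 U := fun x hx => (h x hx).2.continuousAt.continuousWithinAt
  refine ⟨_, _, _, h.compR (φ := Real.log) (φ1 := fun t => t⁻¹) (φ2 := fun t => -(t ^ 2)⁻¹) (fun x hx => ⟨Real.hasDerivAt_log (hp x hx).ne', hasDerivAt_inv (hp x hx).ne'⟩),
    ((cu.inv₀ fun x hx => (hp x hx).ne').smul hc).add (((cu.pow 2).inv₀ fun x hx => (pow_pos (hp x hx) 2).ne').neg.smul ((tn.continuous.comp_continuousOn cu1).clm_apply cu1)), fun x hx => ?_⟩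
  have h0 := (hp x hx).ne'
  have := he x hx
  refine mul_left_cancel₀ h0 ?_
  rw [← Lop_smul, mul_comm (u x) (k x), ← this]
  congr 1
  · ext v w
    simp only [ContinuousLinearMap.smulRightL_apply_apply, smul_apply, add_apply, ContinuousLinearMap.smulRight_apply, smul_eq_mul]
    field_simp; ring
  · rw [smul_smul, mul_inv_cancel₀ h0, one_smul]
  · rw [mul_one]

lemma expL {A : EE d → D2 d} {B : EE d → D1 d} {c k p : EE d → ℝ} {q Q} {U : Set (EE d)} (h : IsC2 p q Q U) (hc : ContinuousOn Q U)
    (he : ∀ x ∈ U, Lop (A x) (B x) (c x) (Q x + tn (q x) (q x)) (q x) 1 = k x) :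
    ∃ u u1 u2, IsC2 u u1 u2 U ∧ ContinuousOn u2 U ∧ (∀ x ∈ U, 0 < u x) ∧ ∀ x ∈ U, Lop (A x) (B x) (c x) (u2 x) (u1 x) (u x) = k x * u x := by
  have cp : ContinuousOn p U := fun x hx => (h x hx).1.continuousAt.continuousWithinAt
  have cq : ContinuousOn q U := fun x hx => (h x hx).2.continuousAt.continuousWithinAt
  refine ⟨_, _, _, h.compR (φ := Real.exp) (φ1 := Real.exp) (φ2 := Real.exp) (fun x _ => ⟨Real.hasDerivAt_exp _, Real.hasDerivAt_exp _⟩),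
    (cp.rexp.smul hc).add (cp.rexp.smul ((tn.continuous.comp_continuousOn cq).clm_apply cq)), fun x _ => Real.exp_pos _, fun x hx => ?_⟩
  rw [← he x hx, mul_comm, ← Lop_smul, mul_one, smul_add]; rfl

lemma alg (A : D2 d) (B : D1 d) {c k0 k1 s : ℝ} {Q0 Q1 Y : E2 d} {q0 q1 y : E1 d} (h0 : Lop A B c (Q0 + tn q0 q0) q0 1 = k0)
    (h1 : Lop A B c (Q1 + tn q1 q1) q1 1 = k1)
    (h : Lop A (B + (-1:ℝ) • A.comp (tn ((1 - s) • q0 + s • q1) + tn.flip ((1 - s) • q0 + s • q1))) (s * (1 - s) * A (tn (q0 + (-1:ℝ) • q1) (q0 + (-1:ℝ) • q1))) (Y + tn y y) y 1 = 0) :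
    Lop A B c ((1 - s) • Q0 + s • Q1 + Y + tn ((1 - s) • q0 + s • q1 + y) ((1 - s) • q0 + s • q1 + y)) ((1 - s) • q0 + s • q1 + y) 1 = (1 - s) * k0 + s * k1 := by
  rw [← h0, ← h1, ← add_zero ((1 - s) * _ + _), ← h]
  simp only [Lop, map_add, map_smul, add_apply, smul_apply, ContinuousLinearMap.comp_apply, ContinuousLinearMap.flip_apply, smul_eq_mul]
  ring
end

section
open MeasureTheory Set Filter Topology
open scoped SchwartzMap ContDiff

open scoped SI
set_option linter.unusedSectionVars false
variable {d : ℕ} {F : Type} [NormedAddCommGroup F] [NormedSpace ℝ F]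

section
variable {Ω : Set (EE d)} {A : EE d → D2 d} {q0 : EE d → E1 d}
lemma LAof {a : Fin d → Fin d → EE d → ℝ} (h : ∀ i j, LocH (a i j) Ω) : LocH (fun x => Aof fun i j => a i j x) Ω := by
    unfold Aof
    refine LocH.sum fun i => LocH.sum fun j => ?_
    exact (h i j).bil (LocH.const _ Ω) (ContinuousLinearMap.lsmul ℝ ℝ)
lemma LBof {b : Fin d → EE d → ℝ} (h : ∀ i, LocH (b i) Ω) : LocH (fun x => Bof fun i => b i x) Ω := by
    unfold Bof
    refine LocH.sum fun i => ?_
    exact (h i).bil (LocH.const _ Ω) (ContinuousLinearMap.lsmul ℝ ℝ)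
lemma Llin {f : EE d → F} (h : LocH f Ω) (c : ℝ) : LocH (fun x => c • f x) Ω :=
  h.clm (c • ContinuousLinearMap.id ℝ F)
lemma Lcmp (hA : LocH A Ω) (hq : LocH q0 Ω) : LocH (fun x => (A x).comp (tn (q0 x) + tn.flip (q0 x))) Ω := 
  hA.bil ((hq.clm tn).add (hq.clm tn.flip)) (ContinuousLinearMap.compL ℝ (E1 d) (E2 d) ℝ)
lemma Lgg (hA : LocH A Ω) (hq : LocH q0 Ω) : LocH (fun x => A x (tn (q0 x) (q0 x))) Ω := 
  hA.bil (hq.bil hq tn) (ContinuousLinearMap.id ℝ (D2 d))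
end

set_option maxHeartbeats 200000 in
theorem mix {Ω : Set (EE d)} (hΩ : IsOpen Ω) (hconn : IsConnected Ω)
    {a : Fin d → Fin d → EE d → ℝ} {b : Fin d → EE d → ℝ} {c W V : EE d → ℝ}
    (ha : ∀ i j, LocallyHolderOn (a i j) Ω) (hb : ∀ i, LocallyHolderOn (b i) Ω)
    (hsym : ∀ x ∈ Ω, ∀ i j, a i j x = a j i x)
    (hposdef : ∀ x ∈ Ω, ∀ ξ : Fin d → ℝ, ξ ≠ 0 → 0 < ∑ i, ∑ j, a i j x * ξ i * ξ j) {μ₀ μ₁ s l0 l1 : ℝ} (hs : s ∈ Set.Icc (0 : ℝ) 1)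
    (h0 : l0 ∈ posSpec Ω a b c W V μ₀) (h1 : l1 ∈ posSpec Ω a b c W V μ₁) :
    s * l1 + (1 - s) * l0 ∈ posSpec Ω a b c W V (s * μ₁ + (1 - s) * μ₀) := by
  obtain ⟨u0, c0, p0, e0⟩ := h0
  obtain ⟨u1, c1, p1, e1⟩ := h1
  rcases Nat.eq_zero_or_pos d with rfl | hd
  · refine ⟨u0, c0, p0, fun x hx => ?_⟩
    have f0 := e0 x hx
    have f1 := e1 x hx
    simp only [ellOp, Finset.univ_eq_empty, Finset.sum_empty, neg_zero, zero_add] at f0 f1 ⊢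
    have g0 := mul_right_cancel₀ (p0 x hx).ne' f0
    have g1 := mul_right_cancel₀ (p1 x hx).ne' f1
    congr 1
    linear_combination (1 - s) * g0 + s * g1
  obtain ⟨i0, k0⟩ := toC2 hΩ c0
  obtain ⟨i1, k1⟩ := toC2 hΩ c1
  obtain ⟨A, hA⟩ : ∃ A : EE d → D2 d, A = fun x => Aof fun i j => a i j x := ⟨_, rfl⟩
  obtain ⟨B, hB⟩ : ∃ B : EE d → D1 d, B = fun x => Bof fun i => b i x := ⟨_, rfl⟩
  have HE : ∀ {u : EE d → ℝ} {v1 v2}, IsC2 u v1 v2 Ω → ∀ x ∈ Ω, ellOp a b c u x = Lop (A x) (B x) (c x) (v2 x) (v1 x) (u x) := fun h x hx => by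
    rw [hA, hB]; exact ellOp_eq hΩ h a b c hx
  obtain ⟨P0, q0, Q0, j0, m0, n0⟩ := logL i0 k0 p0 (fun x hx => (HE i0 x hx).symm.trans (e0 x hx))
  obtain ⟨P1, q1, Q1, j1, m1, n1⟩ := logL i1 k1 p1 (fun x hx => (HE i1 x hx).symm.trans (e1 x hx))
  have LA : LocH A Ω := by rw [hA]; exact LAof fun i j => LocH.ofLH hΩ (ha i j)
  have LB : LocH B Ω := by rw [hB]; exact LBof fun i => LocH.ofLH hΩ (hb i)
  have L0 : LocH q0 Ω := LocH.ofC1 hΩ (fun x hx => (j0 x hx).2) m0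
  have L1 : LocH q1 Ω := LocH.ofC1 hΩ (fun x hx => (j1 x hx).2) m1
  have LB' := LB.add (Llin (Lcmp LA ((Llin L0 (1 - s)).add (Llin L1 s))) (-1))
  have Lg := Llin (Lgg LA (L0.add (Llin L1 (-1)))) (s * (1 - s))
  have el : ∀ K ⊆ Ω, IsCompact K → ∃ l, 0 < l ∧ l ≤ 1 ∧ ∀ x ∈ K, EllA l (A x) := fun K hK hc => by
    rw [hA]
    exact ell_cpt hd (fun i j => ((LocH.ofLH hΩ (ha i j)).cont hΩ).mono hK) hc (fun x hx => hsym x (hK hx)) (fun x hx => hposdef x (hK hx))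
  obtain ⟨w, w1, w2, hw, cw, pw, ew⟩ := APT hd hΩ hconn ⟨el, LA, LB', Lg, fun x hx => by
    obtain ⟨l, l0, -, hl⟩ := el {x} (singleton_subset_iff.2 hx) isCompact_singleton
    refine mul_nonneg (mul_nonneg hs.1 (sub_nonneg.2 hs.2)) (le_trans ?_ ((hl x rfl).lower _))
    exact mul_nonneg l0.le (Finset.sum_nonneg fun i _ => mul_self_nonneg _)⟩
  obtain ⟨η, y, Y, jw, mw, nw⟩ := logL (k := fun _ => 0) hw cw pw (fun x hx => (ew x hx).trans (zero_mul _).symm)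
  have hψ := ((j0.smul (1 - s)).add (j1.smul s)).add jw
  have cψ : ContinuousOn (fun x => (1 - s) • Q0 x + s • Q1 x + Y x) Ω := ((m0.const_smul (1 - s)).add (m1.const_smul s)).add mw
  have eψ : ∀ x ∈ Ω, Lop (A x) (B x) (c x) ((1 - s) • Q0 x + s • Q1 x + Y x + tn ((1 - s) • q0 x + s • q1 x + y x) ((1 - s) • q0 x + s • q1 x + y x))
      ((1 - s) • q0 x + s • q1 x + y x) 1 = (1 - s) * (μ₀ * W x + l0 * V x) + s * (μ₁ * W x + l1 * V x) := fun x hx => by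
    have := nw x hx
    exact alg (A x) (B x) (n0 x hx) (n1 x hx) this
  obtain ⟨u, v1, v2, hu, cu, pu, eu⟩ := expL (k := fun x => (1 - s) * (μ₀ * W x + l0 * V x) + s * (μ₁ * W x + l1 * V x)) hψ cψ eψ
  refine ⟨u, ofC2 hΩ hu cu, pu, fun x hx => ?_⟩
  rw [HE hu x hx, eu x hx]
  ring

lemma mul_sSup_le {S : Set ℝ} {s Y : ℝ} (hS : S.Nonempty) (hs : 0 ≤ s) (h : ∀ a ∈ S, s * a ≤ Y) : s * sSup S ≤ Y := by
  rcases hs.eq_or_lt with rfl | hs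
  · obtain ⟨a, ha⟩ := hS
    simpa using h a ha
  · rw [mul_comm, ← le_div_iff₀ hs]
    exact csSup_le hS fun a ha => by rw [le_div_iff₀ hs, mul_comm]; exact h a ha
end

/-- Theorem 2.9(ii): the generalized principal eigenvalue
`λ₀(μ) = λ₀(P - μW, Ω, V)` is a concave function of `μ` where it is finite. -/
theorem stmt2 (d : ℕ) (Ω : Set (Fin d → ℝ)) (hopen : IsOpen Ω) (hconn : IsConnected Ω)
    (a : Fin d → Fin d → (Fin d → ℝ) → ℝ) (b : Fin d → (Fin d → ℝ) → ℝ)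
    (c W V : (Fin d → ℝ) → ℝ)
    (ha : ∀ i j, LocallyHolderOn (a i j) Ω) (hb : ∀ i, LocallyHolderOn (b i) Ω)
    (hc : LocallyHolderOn c Ω) (hW : LocallyHolderOn W Ω) (hV : LocallyHolderOn V Ω)
    (hsym : ∀ x ∈ Ω, ∀ i j, a i j x = a j i x)
    (hposdef : ∀ x ∈ Ω, ∀ ξ : Fin d → ℝ, ξ ≠ 0 → 0 < ∑ i, ∑ j, a i j x * ξ i * ξ j)
    (lam0 : ℝ → ℝ) (hlam0 : ∀ μ : ℝ, lam0 μ = sSup (posSpec Ω a b c W V μ))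
    (μ₀ μ₁ s : ℝ) (hs : s ∈ Set.Icc (0 : ℝ) 1)
    (h₀ : (posSpec Ω a b c W V μ₀).Nonempty ∧ BddAbove (posSpec Ω a b c W V μ₀))
    (h₁ : (posSpec Ω a b c W V μ₁).Nonempty ∧ BddAbove (posSpec Ω a b c W V μ₁))
    (hₛ : (posSpec Ω a b c W V (s * μ₁ + (1 - s) * μ₀)).Nonempty ∧
      BddAbove (posSpec Ω a b c W V (s * μ₁ + (1 - s) * μ₀))) :
    s * lam0 μ₁ + (1 - s) * lam0 μ₀ ≤ lam0 (s * μ₁ + (1 - s) * μ₀) := by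
  rw [hlam0, hlam0, hlam0]
  have key : ∀ l1 ∈ posSpec Ω a b c W V μ₁, ∀ l0 ∈ posSpec Ω a b c W V μ₀, s * l1 + (1 - s) * l0 ≤ sSup (posSpec Ω a b c W V (s * μ₁ + (1 - s) * μ₀)) :=
    fun l1 h1 l0 h0 => le_csSup hₛ.2 (mix hopen hconn ha hb hsym hposdef hs h0 h1)
  have k1 := mul_sSup_le (Y := sSup (posSpec Ω a b c W V (s * μ₁ + (1 - s) * μ₀)) - (1 - s) * sSup (posSpec Ω a b c W V μ₀)) h₁.1 hs.1 fun l1 h1 => by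
    have := mul_sSup_le (Y := sSup (posSpec Ω a b c W V (s * μ₁ + (1 - s) * μ₀)) - s * l1) h₀.1 (sub_nonneg.2 hs.2) fun l0 h0 => by linarith [key l1 h1 l0 h0]
    linarith
  linarith
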